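/- arXiv:2004.12063 — 2 statements merged into one kernel-verified Lean document; each statement's English description precedes it below -/
import Mathlib

section
/- Let p ≥ 4 be an even integer, and let E ∈ ℝ be the constant such that max_{x ∈ Σ_n} H_n(x;Y^{(n)}) converges to E in probability as n → ∞, where Y^{(n)} is a p-tensor on ℝ^n with i.i.d. N(0,1) entries (E = E_p(Σ)). Then there exist ε > 0, constants 0 ≤ ν₁ < ν₂ ≤ 1, c > 0, and n₀ such that for all n ≥ n₀, when Y and Y′ are independent p-tensors on ℝ^n with i.i.d. N(0,1) entries, with probability at least 1 − exp(−cn) the following both hold: (a) the family 𝒜(Y,Y′) = { cos(τ)·H_n(·;Y) + sin(τ)·H_n(·;Y′) : τ ∈ [0,π/2] } satisfies the (E−ε, ν₁, ν₂)-overlap gap property on the domain Σ_n with overlap R(x,y) = |⟨x,y⟩|/n; and (b) H_n(·;Y) and H_n(·;Y′) are ν₁-separated above E−ε with respect to R. -/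
open MeasureTheory ProbabilityTheory

/-- The law of a `p`-tensor on `ℝ^n` with i.i.d. `N(0,1)` entries. -/
noncomputable def tensorGaussian (p n : ℕ) : Measure ((Fin p → Fin n) → ℝ) :=
  Measure.pi fun _ => gaussianReal 0 1

/-- The `p`-spin Hamiltonian `H_n(x; Y) = n^{-(p+1)/2} ⟨Y, x^{⊗p}⟩`. -/
noncomputable def Hpspin (p n : ℕ) (Y : (Fin p → Fin n) → ℝ) (x : Fin n → ℝ) : ℝ :=
  (n : ℝ) ^ (-(((p : ℝ) + 1) / 2)) * ∑ j : Fin p → Fin n, Y j * ∏ l, x (j l)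

/-- The sphere `𝒮_n = {x ∈ ℝ^n : ‖x‖₂ = √n}`. -/
def sphereSet (n : ℕ) : Set (Fin n → ℝ) := {x | ∑ i, (x i) ^ 2 = n}

/-- The hypercube `Σ_n = {+1, -1}^n`. -/
def cubeSet (n : ℕ) : Set (Fin n → ℝ) := {x | ∀ i, x i = 1 ∨ x i = -1}

/-- The normalized overlap `R(x, y) = |⟨x, y⟩| / n`. -/
noncomputable def olap (n : ℕ) (x y : Fin n → ℝ) : ℝ := |∑ i, x i * y i| / n

/-- A family `F` of functions on a domain `Dom` satisfies the `(μ, ν₁, ν₂)`-overlap gap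
property for the overlap `R`. -/
def HasOGP {X : Type*} (F : Set (X → ℝ)) (Dom : Set X) (R : X → X → ℝ)
    (μ ν₁ ν₂ : ℝ) : Prop :=
  ∀ f₁ ∈ F, ∀ f₂ ∈ F, ∀ x₁ ∈ Dom, ∀ x₂ ∈ Dom, μ ≤ f₁ x₁ → μ ≤ f₂ x₂ →
    R x₁ x₂ ∈ Set.Icc (0 : ℝ) ν₁ ∪ Set.Icc ν₂ 1

/-- Two functions `f, g` on a domain `Dom` are `ν`-separated above `μ` with respect to the
overlap `R`. -/
def SeparatedAbove {X : Type*} (f g : X → ℝ) (Dom : Set X) (R : X → X → ℝ)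
    (μ ν : ℝ) : Prop :=
  ∀ x ∈ Dom, ∀ y ∈ Dom, μ ≤ f x → μ ≤ g y → R x y ≤ ν

/-- The interpolated family `𝒜(Y, Y') = {cos τ H_n(·;Y) + sin τ H_n(·;Y') : τ ∈ [0, π/2]}`. -/
noncomputable def pspinFamily (p n : ℕ) (Y Y' : (Fin p → Fin n) → ℝ) :
    Set ((Fin n → ℝ) → ℝ) :=
  {h | ∃ τ ∈ Set.Icc (0 : ℝ) (Real.pi / 2),
    h = fun x => Real.cos τ * Hpspin p n Y x + Real.sin τ * Hpspin p n Y' x}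

/-- `f` is a random polynomial of degree at most `D` in the entries of a `p`-tensor:
for each `ω` (the internal randomness), every coordinate of `f ω` is the evaluation of a
multivariate polynomial of total degree at most `D`. -/
def IsRandPolyT (p n D : ℕ) {Ω : Type*}
    (f : Ω → ((Fin p → Fin n) → ℝ) → Fin n → ℝ) : Prop :=
  ∀ ω, ∃ P : Fin n → MvPolynomial (Fin p → Fin n) ℝ,
    (∀ i, (P i).totalDegree ≤ D) ∧ ∀ Y i, f ω Y i = MvPolynomial.eval Y (P i)

/-- `f` `(μ, δ, γ)`-optimizes the `p`-spin Hamiltonian on the sphere `𝒮_n`: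
`E_{Y,ω} ‖f(Y,ω)‖₂² = n`, and with probability at least `1 - δ` both
`H_n(g_f(Y,ω); Y) ≥ μ` and `‖f(Y,ω)‖₂ ≥ γ √n`, where `g_f = √n f / ‖f‖₂`. -/
noncomputable def OptimizesSphere (p n : ℕ) {Ω : Type*} [MeasurableSpace Ω] (Pω : Measure Ω)
    (f : Ω → ((Fin p → Fin n) → ℝ) → Fin n → ℝ) (μ δ γ : ℝ) : Prop :=
  (∫ z, ∑ i, (f z.2 z.1 i) ^ 2 ∂((tensorGaussian p n).prod Pω)) = n ∧
  ENNReal.ofReal (1 - δ) ≤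
    ((tensorGaussian p n).prod Pω)
      {z | μ ≤ Hpspin p n z.1
              (fun i => Real.sqrt n * f z.2 z.1 i / Real.sqrt (∑ j, (f z.2 z.1 j) ^ 2)) ∧
           γ * Real.sqrt n ≤ Real.sqrt (∑ j, (f z.2 z.1 j) ^ 2)}

/-- There is no random degree-`D` polynomial that `(μ, δ, γ)`-optimizes the `p`-spin
Hamiltonian on the sphere `𝒮_n`. -/
def NoRandPolyOptSphere (p n D : ℕ) (μ δ γ : ℝ) : Prop :=
  ∀ (Ω : Type) [MeasurableSpace Ω] (Pω : Measure Ω), IsProbabilityMeasure Pω →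
    ∀ f : Ω → ((Fin p → Fin n) → ℝ) → Fin n → ℝ,
      IsRandPolyT p n D f → ¬ OptimizesSphere p n Pω f μ δ γ

/-- The sign function, applied entrywise to round onto the hypercube. -/
noncomputable def sgn (x : ℝ) : ℝ := if 0 ≤ x then 1 else -1

/-- `f` `(μ, δ, γ, η)`-optimizes the `p`-spin Hamiltonian on the hypercube `Σ_n`:
`E_{Y,ω} ‖f(Y,ω)‖₂² = n`, and with probability at least `1 - δ` both
`H_n(sgn(f(Y,ω)); Y) ≥ μ` and `|{i : |f_i(Y,ω)| ≥ γ}| ≥ (1 - η) n`. -/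
noncomputable def OptimizesIsing (p n : ℕ) {Ω : Type*} [MeasurableSpace Ω] (Pω : Measure Ω)
    (f : Ω → ((Fin p → Fin n) → ℝ) → Fin n → ℝ) (μ δ γ η : ℝ) : Prop :=
  (∫ z, ∑ i, (f z.2 z.1 i) ^ 2 ∂((tensorGaussian p n).prod Pω)) = n ∧
  ENNReal.ofReal (1 - δ) ≤
    ((tensorGaussian p n).prod Pω)
      {z | μ ≤ Hpspin p n z.1 (fun i => sgn (f z.2 z.1 i)) ∧
           (1 - η) * n ≤ (({i | γ ≤ |f z.2 z.1 i|} : Set (Fin n)).ncard : ℝ)}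

/-- There is no random degree-`D` polynomial that `(μ, δ, γ, η)`-optimizes the `p`-spin
Hamiltonian on the hypercube `Σ_n`. -/
def NoRandPolyOptIsing (p n D : ℕ) (μ δ γ η : ℝ) : Prop :=
  ∀ (Ω : Type) [MeasurableSpace Ω] (Pω : Measure Ω), IsProbabilityMeasure Pω →
    ∀ f : Ω → ((Fin p → Fin n) → ℝ) → Fin n → ℝ,
      IsRandPolyT p n D f → ¬ OptimizesIsing p n Pω f μ δ γ η

/-- The maximum of the `p`-spin Hamiltonian over the hypercube `Σ_n`. -/
noncomputable def maxCube (p n : ℕ) (Y : (Fin p → Fin n) → ℝ) : ℝ :=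
  sSup ((fun x => Hpspin p n Y x) '' cubeSet n)


/-- standard Gaussian on a finite product -/
noncomputable def gG (ι : Type) [Fintype ι] : Measure (ι → ℝ) :=
  Measure.pi fun _ => gaussianReal 0 1

instance gG_prob (ι : Type) [Fintype ι] : IsProbabilityMeasure (gG ι) := by
  unfold gG; infer_instance

lemma gR_shift_density (a : ℝ) : gaussianReal a 1 =
    (gaussianReal 0 1).withDensity (fun x => ENNReal.ofReal (Real.exp (a * x - a ^ 2 / 2))) := by
  rw [gaussianReal_of_var_ne_zero _ one_ne_zero, gaussianReal_of_var_ne_zero _ one_ne_zero,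
    ← withDensity_mul _ (measurable_gaussianPDF 0 1) (by fun_prop)]
  congr 1
  ext x
  simp only [Pi.mul_apply, gaussianPDF]
  rw [← ENNReal.ofReal_mul (gaussianPDFReal_nonneg 0 1 x)]
  congr 1
  simp only [gaussianPDFReal, mul_assoc, ← Real.exp_add]
  congr 2
  simp; ring

lemma gR_exp_integrable (a : ℝ) : Integrable (fun x => Real.exp (a * x - a ^ 2 / 2))
    (gaussianReal 0 1) := by
  simp only [Real.exp_sub]
  exact (integrable_exp_mul_gaussianReal a).div_const _

lemma gG_shift_density {ι : Type} [Fintype ι] (a : ι → ℝ) :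
    (gG ι).map (fun Y => Y + a) = (gG ι).withDensity
      (fun Y => ENNReal.ofReal (Real.exp (∑ j, (a j * Y j - (a j) ^ 2 / 2)))) := by
  have h1 : (gG ι).map (fun Y => Y + a) = Measure.pi fun i => gaussianReal (a i) 1 := by
    have := Measure.pi_map_pi (μ := fun _ : ι => gaussianReal 0 1) (f := fun i x => x + a i)
      (fun i => by fun_prop)
    have h2 : (fun Y : ι → ℝ => Y + a) = fun x i => x i + a i := by
      ext; simp
    rw [gG, h2, this]
    congr 1
    ext1 i
    rw [gaussianReal_map_add_const]; simp
  rw [h1]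
  apply Measure.pi_eq
  intro s hs
  rw [withDensity_apply _ (MeasurableSet.univ_pi hs)]
  have hint : ∀ i, Integrable ((s i).indicator (fun x => Real.exp (a i * x - (a i) ^ 2 / 2)))
      (gaussianReal 0 1) := fun i => (gR_exp_integrable (a i)).indicator (hs i)
  rw [← lintegral_indicator (MeasurableSet.univ_pi hs)]
  have key : ∀ Y : ι → ℝ, (Set.univ.pi s).indicator
      (fun Y => ENNReal.ofReal (Real.exp (∑ j, (a j * Y j - (a j) ^ 2 / 2)))) Y =
      ENNReal.ofReal (∏ i, (s i).indicator (fun x => Real.exp (a i * x - (a i) ^ 2 / 2)) (Y i)) := by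
    intro Y
    by_cases h : Y ∈ Set.univ.pi s
    · rw [Set.indicator_of_mem h, Real.exp_sum]
      congr 1
      refine Finset.prod_congr rfl fun i _ => ?_
      rw [Set.indicator_of_mem (h i (Set.mem_univ i))]
    · rw [Set.indicator_of_notMem h]
      simp only [Set.mem_pi, Set.mem_univ, true_imp_iff, not_forall] at h
      obtain ⟨i, hi⟩ := h
      rw [Finset.prod_eq_zero (Finset.mem_univ i)]
      · simp
      · rw [Set.indicator_of_notMem hi]
  simp_rw [key]
  have hnn : ∀ i x, 0 ≤ (s i).indicator (fun x => Real.exp (a i * x - (a i) ^ 2 / 2)) x :=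
    fun i x => Set.indicator_nonneg (fun _ _ => (Real.exp_pos _).le) x
  rw [← ofReal_integral_eq_lintegral_ofReal]
  · rw [gG, integral_fintype_prod_eq_prod
      (f := fun i => (s i).indicator (fun x => Real.exp (a i * x - (a i) ^ 2 / 2)))]
    rw [ENNReal.ofReal_prod_of_nonneg (fun i _ => integral_nonneg (hnn i))]
    refine Finset.prod_congr rfl fun i _ => ?_
    rw [gR_shift_density (a i), withDensity_apply _ (hs i), ← lintegral_indicator (hs i),
      ofReal_integral_eq_lintegral_ofReal (hint i) (ae_of_all _ (hnn i))]
    congr 1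
    ext x
    by_cases hx : x ∈ s i <;> simp [hx]
  · exact Integrable.fintype_prod (f := fun i =>
      (s i).indicator (fun x => Real.exp (a i * x - (a i) ^ 2 / 2))) hint
  · exact ae_of_all _ fun Y => Finset.prod_nonneg fun i _ => hnn i _

/-- linear form -/
noncomputable def lin {ι : Type} [Fintype ι] (a Y : ι → ℝ) : ℝ := ∑ j, a j * Y j

@[fun_prop]
lemma lin_continuous {ι : Type} [Fintype ι] (a : ι → ℝ) : Continuous (lin a) := by
  unfold lin; fun_prop

@[fun_prop]
lemma lin_measurable {ι : Type} [Fintype ι] (a : ι → ℝ) : Measurable (lin a) :=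
  (lin_continuous a).measurable

lemma lin_add {ι : Type} [Fintype ι] (a Y Z : ι → ℝ) : lin a (Y + Z) = lin a Y + lin a Z := by
  simp [lin, mul_add, Finset.sum_add_distrib]

lemma lin_comm {ι : Type} [Fintype ι] (a Y : ι → ℝ) : lin a Y = lin Y a := by
  simp [lin, mul_comm]

lemma lin_add_left {ι : Type} [Fintype ι] (a b Y : ι → ℝ) : lin (a + b) Y = lin a Y + lin b Y := by
  simp [lin, add_mul, Finset.sum_add_distrib]

lemma lin_smul_right {ι : Type} [Fintype ι] (a Y : ι → ℝ) (s : ℝ) : lin a (s • Y) = s * lin a Y := by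
  simp [lin, Finset.mul_sum]; exact Finset.sum_congr rfl fun _ _ => by ring

lemma lin_smul_left {ι : Type} [Fintype ι] (a Y : ι → ℝ) (s : ℝ) : lin (s • a) Y = s * lin a Y := by
  rw [lin_comm, lin_smul_right, lin_comm]

lemma gG_dens_eq {ι : Type} [Fintype ι] (a Y : ι → ℝ) :
    ∑ j, (a j * Y j - (a j) ^ 2 / 2) = lin a Y - lin a a / 2 := by
  simp [lin, Finset.sum_sub_distrib, Finset.sum_div]
  exact Finset.sum_congr rfl fun _ _ => by ring

lemma gG_shift_lintegral {ι : Type} [Fintype ι] (a : ι → ℝ) (f : (ι → ℝ) → ENNReal)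
    (hf : Measurable f) :
    ∫⁻ Y, f (Y + a) ∂(gG ι) =
      ∫⁻ Y, ENNReal.ofReal (Real.exp (lin a Y - lin a a / 2)) * f Y ∂(gG ι) := by
  rw [← lintegral_map (f := f) (g := fun Y => Y + a) hf (by fun_prop), gG_shift_density,
    lintegral_withDensity_eq_lintegral_mul _ (by fun_prop) hf]
  simp only [gG_dens_eq, Pi.mul_apply]

lemma gG_shift_integral {ι : Type} [Fintype ι] (a : ι → ℝ) (f : (ι → ℝ) → ℝ)
    (hf : Measurable f) :
    ∫ Y, f (Y + a) ∂(gG ι) =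
      ∫ Y, Real.exp (lin a Y - lin a a / 2) * f Y ∂(gG ι) := by
  have : ∫ Y, f (Y + a) ∂(gG ι) = ∫ Y, f Y ∂((gG ι).map (fun Y => Y + a)) := by
    rw [integral_map (by fun_prop) hf.aestronglyMeasurable]
  rw [this, gG_shift_density, integral_withDensity_eq_integral_toReal_smul (by fun_prop)
    (by simp)]
  refine integral_congr_ae (ae_of_all _ fun Y => ?_)
  simp only [gG_dens_eq, ENNReal.toReal_ofReal (Real.exp_pos _).le, smul_eq_mul]

lemma gG_exp_integrable {ι : Type} [Fintype ι] (a : ι → ℝ) :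
    Integrable (fun Y => Real.exp (lin a Y)) (gG ι) := by
  simp only [lin, Real.exp_sum]
  exact Integrable.fintype_prod (f := fun i x => Real.exp (a i * x))
    (fun i => integrable_exp_mul_gaussianReal (a i))

lemma gG_mgf {ι : Type} [Fintype ι] (a : ι → ℝ) :
    ∫ Y, Real.exp (lin a Y) ∂(gG ι) = Real.exp (lin a a / 2) := by
  have h := gG_shift_integral a (fun _ => 1) (by fun_prop)
  simp only [integral_const, mul_one, Real.exp_sub, integral_div] at h
  simp at h
  field_simp at h
  linarith

lemma gG_abs_lin_le {ι : Type} [Fintype ι] (a Y : ι → ℝ) :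
    Real.exp |lin a Y| ≤ Real.exp (lin a Y) + Real.exp (lin (-a) Y) := by
  have : lin (-a) Y = - lin a Y := by simp [lin]
  rw [this]
  rcases abs_cases (lin a Y) with ⟨h, _⟩ | ⟨h, _⟩ <;> rw [h] <;>
    linarith [Real.exp_pos (lin a Y), Real.exp_pos (-lin a Y)]

lemma gG_exp_abs_integrable {ι : Type} [Fintype ι] (a : ι → ℝ) :
    Integrable (fun Y => Real.exp |lin a Y|) (gG ι) := by
  refine Integrable.mono' ((gG_exp_integrable a).add (gG_exp_integrable (-a)))
    (by fun_prop) (ae_of_all _ fun Y => ?_)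
  rw [Real.norm_eq_abs, abs_of_pos (Real.exp_pos _)]
  exact gG_abs_lin_le a Y

lemma gG_coord_integrable {ι : Type} [Fintype ι] (i : ι) (f : ℝ → ℝ)
    (hf : Integrable f (gaussianReal 0 1)) : Integrable (fun Y => f (Y i)) (gG ι) := by
  exact (measurePreserving_eval (μ := fun _ : ι => gaussianReal 0 1) i).integrable_comp_of_integrable hf

lemma gG_coord_integral {ι : Type} [Fintype ι] (i : ι) (f : ℝ → ℝ)
    (hf : Measurable f) : ∫ Y, f (Y i) ∂(gG ι) = ∫ x, f x ∂(gaussianReal 0 1) := by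
  have h := (measurePreserving_eval (μ := fun _ : ι => gaussianReal 0 1) i)
  rw [← h.map_eq, integral_map h.measurable.aemeasurable (hf.aestronglyMeasurable)]
  rfl

lemma gG_abs_integrable {ι : Type} [Fintype ι] (i : ι) : Integrable (fun Y => |Y i|) (gG ι) :=
  gG_coord_integrable i _ ((memLp_id_gaussianReal' 1 (by simp)).integrable le_rfl).abs


lemma gG_ibp {ι : Type} [Fintype ι] (a : ι → ℝ) (g g' : (ι → ℝ) → ℝ) (C : ℝ)
    (hg : Continuous g) (hg' : Continuous g') (hb : ∀ Y, |g Y| ≤ 1) (hb' : ∀ Y, |g' Y| ≤ C)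
    (hd : ∀ (Y : ι → ℝ) (s : ℝ), HasDerivAt (fun s : ℝ => g (Y + s • a)) (g' (Y + s • a)) s) :
    ∫ Y, lin a Y * g Y ∂(gG ι) = ∫ Y, g' Y ∂(gG ι) := by
  have h1 : HasDerivAt (fun s : ℝ => ∫ Y, g (Y + s • a) ∂(gG ι))
      (∫ Y, g' (Y + (0 : ℝ) • a) ∂(gG ι)) 0 := by
    refine (hasDerivAt_integral_of_dominated_loc_of_deriv_le (F := fun (s : ℝ) Y => g (Y + s • a))
      (F' := fun (s : ℝ) Y => g' (Y + s • a)) (bound := fun _ => C)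
      (s := Set.univ) Filter.univ_mem ?_ ?_ ?_ ?_ ?_ ?_).2
    · exact Filter.Eventually.of_forall fun s => Continuous.aestronglyMeasurable (by fun_prop)
    · refine Integrable.mono' (integrable_const 1)
        (Continuous.aestronglyMeasurable (by fun_prop)) (ae_of_all _ fun Y => hb _)
    · exact Continuous.aestronglyMeasurable (by fun_prop)
    · exact ae_of_all _ fun Y s _ => hb' _
    · exact integrable_const C
    · exact ae_of_all _ fun Y s _ => hd Y s
  have h2 : HasDerivAt (fun s : ℝ => ∫ Y, Real.exp (s * lin a Y - s ^ 2 * (lin a a / 2)) * g Y ∂(gG ι))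
      (∫ Y, Real.exp (0 * lin a Y - 0 ^ 2 * (lin a a / 2)) * (lin a Y - 2 * 0 * (lin a a / 2)) * g Y ∂(gG ι)) 0 := by
    refine (hasDerivAt_integral_of_dominated_loc_of_deriv_le
      (F := fun (s : ℝ) Y => Real.exp (s * lin a Y - s ^ 2 * (lin a a / 2)) * g Y)
      (F' := fun (s : ℝ) Y => Real.exp (s * lin a Y - s ^ 2 * (lin a a / 2)) *
        (lin a Y - 2 * s * (lin a a / 2)) * g Y)
      (bound := fun Y => (1 + lin a a) * Real.exp |lin (2 • a) Y|)
      (s := Set.Ioo (-1) 1) (Ioo_mem_nhds (by norm_num) (by norm_num)) ?_ ?_ ?_ ?_ ?_ ?_).2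
    · exact Filter.Eventually.of_forall fun s => Continuous.aestronglyMeasurable (by fun_prop)
    · refine Integrable.mono' (integrable_const 1)
        (Continuous.aestronglyMeasurable (by fun_prop)) (ae_of_all _ fun Y => ?_)
      simpa using hb Y
    · exact Continuous.aestronglyMeasurable (by fun_prop)
    · refine ae_of_all _ fun Y s hs => ?_
      have hQ : 0 ≤ lin a a := Finset.sum_nonneg fun i _ => mul_self_nonneg _
      have e1 : lin (2 • a) Y = 2 * lin a Y := by
        have := lin_smul_left a Y 2
        rw [← this]; congr 1; ext; simp
      rw [e1, Real.norm_eq_abs, abs_mul, abs_mul, abs_of_pos (Real.exp_pos _)]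
      have hsa : |s| ≤ 1 := abs_le.2 ⟨hs.1.le, hs.2.le⟩
      have a1 : Real.exp (s * lin a Y - s ^ 2 * (lin a a / 2)) ≤ Real.exp |lin a Y| := by
        apply Real.exp_le_exp.2
        have : s * lin a Y ≤ |lin a Y| := by
          calc s * lin a Y ≤ |s * lin a Y| := le_abs_self _
            _ = |s| * |lin a Y| := abs_mul _ _
            _ ≤ 1 * |lin a Y| := by gcongr
            _ = _ := one_mul _
        nlinarith [sq_nonneg s]
      have a2 : |lin a Y - 2 * s * (lin a a / 2)| ≤ (1 + lin a a) * Real.exp |lin a Y| := by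
        have h3 : |lin a Y - 2 * s * (lin a a / 2)| ≤ |lin a Y| + |s| * lin a a := by
          calc _ ≤ |lin a Y| + |2 * s * (lin a a / 2)| := abs_sub _ _
            _ = |lin a Y| + |s| * lin a a := by
              congr 1
              rw [show 2 * s * (lin a a / 2) = s * lin a a by ring, abs_mul, abs_of_nonneg hQ]
        have h4 := Real.add_one_le_exp |lin a Y|
        have h5 := abs_nonneg (lin a Y)
        nlinarith [abs_nonneg s]
      calc _ ≤ Real.exp |lin a Y| * ((1 + lin a a) * Real.exp |lin a Y|) * 1 := by
            gcongr
            exact hb Y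
        _ = _ := by
            rw [abs_mul, show |(2:ℝ)| = 2 by norm_num, two_mul, Real.exp_add]; ring
    · exact (gG_exp_abs_integrable _).const_mul _
    · refine ae_of_all _ fun Y s _ => ?_
      refine HasDerivAt.mul_const (HasDerivAt.exp ?_) _
      refine ((hasDerivAt_id s).mul_const (lin a Y)).sub
        (((hasDerivAt_pow 2 s)).mul_const (lin a a / 2)) |>.congr_deriv ?_
      simp
  have h3 : (fun s : ℝ => ∫ Y, g (Y + s • a) ∂(gG ι)) =
      (fun s : ℝ => ∫ Y, Real.exp (s * lin a Y - s ^ 2 * (lin a a / 2)) * g Y ∂(gG ι)) := by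
    ext s
    rw [gG_shift_integral (s • a) g hg.measurable]
    simp only [lin_smul_left, lin_smul_right]
    congr 1; ext Y; congr 2; ring
  rw [h3] at h1
  have := h1.unique h2
  simp at this
  exact this.symm


section
variable {α ι κ : Type} [Fintype ι] [Fintype κ]

/-- partition function -/
noncomputable def Zf (S : Finset α) (c : α → ℝ) (v : α → ι → ℝ) (Y : ι → ℝ) : ℝ :=
  ∑ y ∈ S, c y * Real.exp (lin (v y) Y)

/-- Gibbs weight -/
noncomputable def gib (S : Finset α) (c : α → ℝ) (v : α → ι → ℝ) (y : α) (Y : ι → ℝ) : ℝ :=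
  c y * Real.exp (lin (v y) Y) / Zf S c v Y

/-- log partition function -/
noncomputable def LSE (S : Finset α) (c : α → ℝ) (v : α → ι → ℝ) (Y : ι → ℝ) : ℝ :=
  Real.log (Zf S c v Y)

lemma Zf_pos (S : Finset α) (hS : S.Nonempty) (c : α → ℝ) (hc : ∀ y, 0 < c y) (v : α → ι → ℝ)
    (Y : ι → ℝ) : 0 < Zf S c v Y :=
  Finset.sum_pos (fun y _ => mul_pos (hc y) (Real.exp_pos _)) hS

lemma Zf_cont (S : Finset α) (c : α → ℝ) (v : α → ι → ℝ) : Continuous (Zf S c v) := by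
  unfold Zf; fun_prop

lemma gib_cont (S : Finset α) (hS : S.Nonempty) (c : α → ℝ) (hc : ∀ y, 0 < c y) (v : α → ι → ℝ)
    (y : α) : Continuous (gib S c v y) := by
  unfold gib
  exact Continuous.div (by fun_prop) (Zf_cont S c v) fun Y => (Zf_pos S hS c hc v Y).ne'

lemma LSE_cont (S : Finset α) (hS : S.Nonempty) (c : α → ℝ) (hc : ∀ y, 0 < c y) (v : α → ι → ℝ) :
    Continuous (LSE S c v) := by
  unfold LSE
  exact Continuous.log (Zf_cont S c v) fun Y => (Zf_pos S hS c hc v Y).ne'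

lemma gib_nonneg (S : Finset α) (hS : S.Nonempty) (c : α → ℝ) (hc : ∀ y, 0 < c y) (v : α → ι → ℝ)
    (y : α) (Y : ι → ℝ) : 0 ≤ gib S c v y Y :=
  div_nonneg (mul_pos (hc y) (Real.exp_pos _)).le (Zf_pos S hS c hc v Y).le

lemma gib_sum (S : Finset α) (hS : S.Nonempty) (c : α → ℝ) (hc : ∀ y, 0 < c y) (v : α → ι → ℝ)
    (Y : ι → ℝ) : ∑ y ∈ S, gib S c v y Y = 1 := by
  unfold gib
  rw [← Finset.sum_div]
  exact div_self (Zf_pos S hS c hc v Y).ne'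

lemma gib_le_one (S : Finset α) (hS : S.Nonempty) (c : α → ℝ) (hc : ∀ y, 0 < c y) (v : α → ι → ℝ)
    (y : α) (hy : y ∈ S) (Y : ι → ℝ) : gib S c v y Y ≤ 1 := by
  rw [← gib_sum S hS c hc v Y]
  exact Finset.single_le_sum (f := fun y => gib S c v y Y)
    (fun y _ => gib_nonneg S hS c hc v y Y) hy

lemma LSE_lip (S : Finset α) (hS : S.Nonempty) (c : α → ℝ) (hc : ∀ y, 0 < c y) (v : α → ι → ℝ)
    (K : ι → ℝ) (hK : ∀ y ∈ S, ∀ j, |v y j| ≤ K j) (Y Y' : ι → ℝ) :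
    |LSE S c v Y - LSE S c v Y'| ≤ ∑ j, K j * |Y j - Y' j| := by
  have main : ∀ Y Y' : ι → ℝ, LSE S c v Y ≤ LSE S c v Y' + ∑ j, K j * |Y j - Y' j| := by
    intro Y Y'
    unfold LSE
    rw [← Real.log_exp (∑ j, K j * |Y j - Y' j|), ← Real.log_mul (Zf_pos S hS c hc v Y').ne'
      (Real.exp_pos _).ne']
    apply Real.log_le_log (Zf_pos S hS c hc v Y)
    unfold Zf
    rw [Finset.sum_mul]
    refine Finset.sum_le_sum fun y hy => ?_
    rw [mul_assoc, ← Real.exp_add]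
    refine mul_le_mul_of_nonneg_left (Real.exp_le_exp.2 ?_) (hc y).le
    rw [← sub_le_iff_le_add']
    unfold lin
    rw [← Finset.sum_sub_distrib]
    refine Finset.sum_le_sum fun j _ => ?_
    rw [← mul_sub]
    calc _ ≤ |v y j * (Y j - Y' j)| := le_abs_self _
      _ = |v y j| * |Y j - Y' j| := abs_mul _ _
      _ ≤ _ := by gcongr; exact hK y hy j
  rw [abs_le]
  have h1 := main Y Y'
  have h2 := main Y' Y
  simp only [abs_sub_comm (Y' _)] at h2
  constructor <;> linarith

lemma LSE_integrable (S : Finset α) (hS : S.Nonempty) (c : α → ℝ) (hc : ∀ y, 0 < c y)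
    (v : α → ι → ℝ) : Integrable (LSE S c v) (gG ι) := by
  have hb : Integrable (fun Y : ι → ℝ => |LSE S c v 0| + ∑ j, (∑ y ∈ S, |v y j|) * |Y j|) (gG ι) :=
    (integrable_const _).add (integrable_finsetSum _ fun j _ => (gG_abs_integrable j).const_mul _)
  refine hb.mono' (LSE_cont S hS c hc v).aestronglyMeasurable (ae_of_all _ fun Y => ?_)
  have := LSE_lip S hS c hc v (fun j => ∑ y ∈ S, |v y j|)
    (fun y hy j => Finset.single_le_sum (f := fun y => |v y j|) (fun _ _ => abs_nonneg _) hy) Y 0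
  simp only [Pi.zero_apply, sub_zero] at this
  rw [Real.norm_eq_abs]
  have h3 := abs_sub_abs_le_abs_sub (LSE S c v Y) (LSE S c v 0)
  linarith

lemma Z_hasDeriv (S : Finset α) (c : α → ℝ) (U : α → ℝ → ℝ) (U' : α → ℝ)
    (t : ℝ) (hU : ∀ y ∈ S, HasDerivAt (U y) (U' y) t) :
    HasDerivAt (fun t => ∑ y ∈ S, c y * Real.exp (U y t))
      (∑ y ∈ S, c y * Real.exp (U y t) * U' y) t := by
  refine HasDerivAt.fun_sum fun y hy => ?_
  have := ((hU y hy).exp).const_mul (c y)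
  rwa [← mul_assoc] at this

lemma gib_hasDeriv (S : Finset α) (hS : S.Nonempty) (c : α → ℝ) (hc : ∀ y, 0 < c y)
    (v : α → ι → ℝ) (a : ι → ℝ) (y : α) (Y : ι → ℝ) (s : ℝ) :
    HasDerivAt (fun s : ℝ => gib S c v y (Y + s • a))
      (gib S c v y (Y + s • a) * (lin (v y) a - ∑ z ∈ S, gib S c v z (Y + s • a) * lin (v z) a)) s := by
  have hU : ∀ z, HasDerivAt (fun s : ℝ => lin (v z) (Y + s • a)) (lin (v z) a) s := by
    intro z
    simp only [lin_add, lin_smul_right]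
    simpa using ((hasDerivAt_id s).mul_const (lin (v z) a)).const_add (lin (v z) Y)
  have h1 := Z_hasDeriv S c (fun z s => lin (v z) (Y + s • a)) (fun z => lin (v z) a) s
    (fun z _ => hU z)
  have h2 := ((hU y).exp).const_mul (c y)
  have hZ := (Zf_pos S hS c hc v (Y + s • a)).ne'
  have h3 := h2.div h1 hZ
  refine h3.congr_deriv ?_
  have e : ∑ z ∈ S, gib S c v z (Y + s • a) * lin (v z) a =
     (∑ z ∈ S, c z * Real.exp (lin (v z) (Y + s • a)) * lin (v z) a) / Zf S c v (Y + s • a) := by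
    rw [Finset.sum_div]
    refine Finset.sum_congr rfl fun z _ => ?_
    unfold gib; ring
  rw [e]
  unfold gib
  change (_ * Zf S c v (Y + s • a) - _) / (Zf S c v (Y + s • a)) ^ 2 = _
  field_simp

lemma gib_ibp (S : Finset α) (hS : S.Nonempty) (c : α → ℝ) (hc : ∀ y, 0 < c y)
    (v : α → ι → ℝ) (a : ι → ℝ) (y : α) (hy : y ∈ S) :
    ∫ Y, lin a Y * gib S c v y Y ∂(gG ι) =
     ∫ Y, gib S c v y Y * (lin (v y) a - ∑ z ∈ S, gib S c v z Y * lin (v z) a) ∂(gG ι) := by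
  have hcont := fun z => gib_cont S hS c hc v z
  refine gG_ibp a _ _ (|lin (v y) a| + ∑ z ∈ S, |lin (v z) a|) (hcont y) (by fun_prop) ?_ ?_ ?_
  · intro Y
    rw [abs_of_nonneg (gib_nonneg S hS c hc v y Y)]
    exact gib_le_one S hS c hc v y hy Y
  · intro Y
    rw [abs_mul, abs_of_nonneg (gib_nonneg S hS c hc v y Y)]
    have h1 : |lin (v y) a - ∑ z ∈ S, gib S c v z Y * lin (v z) a| ≤
        |lin (v y) a| + ∑ z ∈ S, |lin (v z) a| := by
      refine (abs_sub _ _).trans ?_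
      gcongr
      refine (Finset.abs_sum_le_sum_abs _ _).trans (Finset.sum_le_sum fun z hz => ?_)
      rw [abs_mul, abs_of_nonneg (gib_nonneg S hS c hc v z Y)]
      exact mul_le_of_le_one_left (abs_nonneg _) (gib_le_one S hS c hc v z hz Y)
    exact (mul_le_of_le_one_left (abs_nonneg _) (gib_le_one S hS c hc v y hy Y)).trans h1
  · intro Y s
    exact gib_hasDeriv S hS c hc v a y Y s

/-- interpolated vectors -/
noncomputable def ivec (v : α → ι → ℝ) (w : α → κ → ℝ) (a b : ℝ) (y : α) : ι ⊕ κ → ℝ :=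
  Sum.elim (fun i => a * v y i) (fun k => b * w y k)

lemma lin_ivec (v : α → ι → ℝ) (w : α → κ → ℝ) (a b : ℝ) (y : α) (Y : ι ⊕ κ → ℝ) :
    lin (ivec v w a b y) Y = a * lin (v y) (fun i => Y (Sum.inl i)) +
      b * lin (w y) (fun i => Y (Sum.inr i)) := by
  unfold lin ivec
  rw [Fintype.sum_sum_type, Finset.mul_sum, Finset.mul_sum]
  simp [mul_assoc]

lemma lin_ivec_ivec (v : α → ι → ℝ) (w : α → κ → ℝ) (a b a' b' : ℝ) (y z : α) :
    lin (ivec v w a b y) (ivec v w a' b' z) = a * a' * lin (v y) (v z) +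
      b * b' * lin (w y) (w z) := by
  rw [lin_ivec]
  have h1 : (fun i => ivec v w a' b' z (Sum.inl i)) = a' • v z := by ext; simp [ivec]
  have h2 : (fun i => ivec v w a' b' z (Sum.inr i)) = b' • w z := by ext; simp [ivec]
  rw [h1, h2, lin_smul_right, lin_smul_right]; ring

lemma gG_inl_integral (f : (ι → ℝ) → ℝ) (hf : Measurable f) :
    ∫ Y, f (fun i => Y (Sum.inl i)) ∂(gG (ι ⊕ κ)) = ∫ Y, f Y ∂(gG ι) := by
  have h1 := (measurePreserving_sumPiEquivProdPi (fun _ : ι ⊕ κ => gaussianReal 0 1))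
  have h2 := (measurePreserving_fst (μ := gG ι) (ν := gG κ))
  have h3 := h2.comp h1
  rw [← h3.map_eq, integral_map h3.measurable.aemeasurable hf.aestronglyMeasurable]
  rfl

lemma gG_inr_integral (f : (κ → ℝ) → ℝ) (hf : Measurable f) :
    ∫ Y, f (fun i => Y (Sum.inr i)) ∂(gG (ι ⊕ κ)) = ∫ Y, f Y ∂(gG κ) := by
  have h1 := (measurePreserving_sumPiEquivProdPi (fun _ : ι ⊕ κ => gaussianReal 0 1))
  have h2 := (measurePreserving_snd (μ := gG ι) (ν := gG κ))
  have h3 := h2.comp h1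
  rw [← h3.map_eq, integral_map h3.measurable.aemeasurable hf.aestronglyMeasurable]
  rfl

theorem gauss_compare (S : Finset α) (hS : S.Nonempty) (c : α → ℝ) (hc : ∀ y, 0 < c y)
    (v : α → ι → ℝ) (w : α → κ → ℝ) (K : ℝ)
    (hK : ∀ y ∈ S, ∀ z ∈ S, (lin (v y) (v y) - lin (v y) (v z)) -
      (lin (w y) (w y) - lin (w y) (w z)) ≤ 2 * K) :
    ∫ Y, LSE S c v Y ∂(gG ι) ≤ ∫ Y, LSE S c w Y ∂(gG κ) + K := by
  classical
  set u : ℝ → α → ι ⊕ κ → ℝ := fun t => ivec v w (Real.cos t) (Real.sin t) with hu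
  set u' : ℝ → α → ι ⊕ κ → ℝ := fun t => ivec v w (-Real.sin t) (Real.cos t) with hu'
  set F : ℝ → ℝ := fun t => ∫ Y, LSE S c (u t) Y ∂(gG (ι ⊕ κ)) with hF
  have hder : ∀ t Y y, HasDerivAt (fun t => lin (u t y) Y) (lin (u' t y) Y) t := by
    intro t Y y
    simp only [hu, hu', lin_ivec]
    exact ((Real.hasDerivAt_cos t).mul_const _).add ((Real.hasDerivAt_sin t).mul_const _)
  have hFd : ∀ t, HasDerivAt F (∫ Y, ∑ y ∈ S, gib S c (u t) y Y * lin (u' t y) Y ∂(gG (ι ⊕ κ))) t := by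
    intro t
    refine (hasDerivAt_integral_of_dominated_loc_of_deriv_le
      (F := fun (t : ℝ) Y => LSE S c (u t) Y)
      (F' := fun (t : ℝ) Y => ∑ y ∈ S, gib S c (u t) y Y * lin (u' t y) Y)
      (bound := fun Y => ∑ y ∈ S, (∑ i, |v y i| * |Y (Sum.inl i)| + ∑ k, |w y k| * |Y (Sum.inr k)|))
      (s := Set.univ) Filter.univ_mem ?_ ?_ ?_ ?_ ?_ ?_).2
    · exact Filter.Eventually.of_forall fun s =>
        (LSE_cont S hS c hc _).aestronglyMeasurable
    · exact LSE_integrable S hS c hc _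
    · have hcont := fun z => gib_cont S hS c hc (u t) z
      exact Continuous.aestronglyMeasurable (by fun_prop)
    · refine ae_of_all _ fun Y s _ => ?_
      rw [Real.norm_eq_abs]
      refine (Finset.abs_sum_le_sum_abs _ _).trans (Finset.sum_le_sum fun y hy => ?_)
      rw [abs_mul, abs_of_nonneg (gib_nonneg S hS c hc _ y Y)]
      refine (mul_le_of_le_one_left (abs_nonneg _) (gib_le_one S hS c hc _ y hy Y)).trans ?_
      simp only [hu', lin_ivec]
      refine (abs_add_le _ _).trans ?_
      rw [abs_mul, abs_mul]
      have e1 : |-Real.sin s| ≤ 1 := by rw [abs_neg]; exact Real.abs_sin_le_one s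
      have e2 := Real.abs_cos_le_one s
      refine add_le_add ((mul_le_of_le_one_left (abs_nonneg _) e1).trans ?_)
        ((mul_le_of_le_one_left (abs_nonneg _) e2).trans ?_)
      · unfold lin
        refine (Finset.abs_sum_le_sum_abs _ _).trans (Finset.sum_le_sum fun z hz => ?_)
        rw [abs_mul]
      · unfold lin
        refine (Finset.abs_sum_le_sum_abs _ _).trans (Finset.sum_le_sum fun z hz => ?_)
        rw [abs_mul]
    · refine integrable_finsetSum _ fun y _ => ?_
      exact (integrable_finsetSum _ fun i _ => (gG_abs_integrable _).const_mul _).add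
        (integrable_finsetSum _ fun i _ => (gG_abs_integrable _).const_mul _)
    · refine ae_of_all _ fun Y s _ => ?_
      have h1 := Z_hasDeriv S c (fun z s => lin (u s z) Y) (fun z => lin (u' s z) Y) s
        (fun z _ => hder s Y z)
      have h2 := h1.log (Zf_pos S hS c hc (u s) Y).ne'
      refine h2.congr_deriv ?_
      rw [Finset.sum_div]
      refine Finset.sum_congr rfl fun z _ => ?_
      unfold gib Zf; ring
  have hFd2 : ∀ t, (∫ Y, ∑ y ∈ S, gib S c (u t) y Y * lin (u' t y) Y ∂(gG (ι ⊕ κ))) =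
      ∫ Y, ∑ y ∈ S, ∑ z ∈ S, gib S c (u t) y Y * gib S c (u t) z Y *
        (Real.sin t * Real.cos t * ((lin (w y) (w y) - lin (w y) (w z)) -
          (lin (v y) (v y) - lin (v y) (v z)))) ∂(gG (ι ⊕ κ)) := by
    intro t
    have hcont := fun z => gib_cont S hS c hc (u t) z
    have hint : ∀ y z, z ∈ S → y ∈ S → ∀ C : ℝ, Integrable (fun Y => gib S c (u t) y Y * gib S c (u t) z Y * C)
        (gG (ι ⊕ κ)) := by
      intro y z hz hy C
      refine Integrable.mono' (integrable_const |C|) (Continuous.aestronglyMeasurable (by fun_prop))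
        (ae_of_all _ fun Y => ?_)
      rw [Real.norm_eq_abs, abs_mul, abs_mul, abs_of_nonneg (gib_nonneg S hS c hc _ y Y),
        abs_of_nonneg (gib_nonneg S hS c hc _ z Y)]
      exact mul_le_of_le_one_left (abs_nonneg _) (mul_le_one₀ (gib_le_one S hS c hc _ y hy Y)
        (gib_nonneg S hS c hc _ z Y) (gib_le_one S hS c hc _ z hz Y))
    rw [integral_finsetSum, integral_finsetSum]
    · refine Finset.sum_congr rfl fun y hy => ?_
      have h1 := gib_ibp S hS c hc (u t) (u' t y) y hy
      simp only [mul_comm (lin (u' t y) _)] at h1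
      rw [h1]
      congr 1
      ext Y
      have h2 := gib_sum S hS c hc (u t) Y
      have h3 : lin (u t y) (u' t y) = ∑ z ∈ S, gib S c (u t) z Y * lin (u t y) (u' t y) := by
        rw [← Finset.sum_mul, h2, one_mul]
      rw [h3, ← Finset.sum_sub_distrib, Finset.mul_sum]
      refine Finset.sum_congr rfl fun z hz => ?_
      simp only [hu, hu', lin_ivec_ivec]
      rw [lin_comm (v z), lin_comm (w z)]
      ring
    · exact fun y hy => integrable_finsetSum _ fun z hz => hint y z hz hy _
    · intro y hy
      have hb : Integrable (fun Y => Real.exp |lin (u' t y) Y|) (gG (ι ⊕ κ)) := gG_exp_abs_integrable _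
      refine hb.mono' (Continuous.aestronglyMeasurable (by fun_prop)) (ae_of_all _ fun Y => ?_)
      rw [Real.norm_eq_abs, abs_mul, abs_of_nonneg (gib_nonneg S hS c hc _ y Y)]
      refine (mul_le_of_le_one_left (abs_nonneg _) (gib_le_one S hS c hc _ y hy Y)).trans ?_
      linarith [Real.add_one_le_exp |lin (u' t y) Y|]
  have hmono : MonotoneOn (fun t => F t + K * (Real.sin t) ^ 2) (Set.Icc 0 (Real.pi / 2)) := by
    have hd : ∀ t, HasDerivAt (fun t => F t + K * (Real.sin t) ^ 2)
        ((∫ Y, ∑ y ∈ S, gib S c (u t) y Y * lin (u' t y) Y ∂(gG (ι ⊕ κ))) +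
          K * (2 * Real.sin t * Real.cos t)) t := by
      intro t
      refine (hFd t).add (HasDerivAt.const_mul K ?_)
      simpa using (Real.hasDerivAt_sin t).fun_pow 2
    refine monotoneOn_of_deriv_nonneg (convex_Icc _ _)
      (fun t _ => (hd t).continuousAt.continuousWithinAt)
      (fun t _ => (hd t).differentiableAt.differentiableWithinAt) ?_
    intro t ht
    rw [interior_Icc] at ht
    rw [(hd t).deriv, hFd2 t]
    have hsc : 0 ≤ Real.sin t * Real.cos t :=
      mul_nonneg (Real.sin_nonneg_of_nonneg_of_le_pi ht.1.le (by linarith [ht.2, Real.pi_pos]))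
        (Real.cos_nonneg_of_mem_Icc ⟨by linarith [ht.1, Real.pi_pos], ht.2.le⟩)
    have hlow : ∫ _Y, (-(2 * K * (Real.sin t * Real.cos t)) : ℝ) ∂(gG (ι ⊕ κ)) ≤
      ∫ Y, ∑ y ∈ S, ∑ z ∈ S, gib S c (u t) y Y * gib S c (u t) z Y *
        (Real.sin t * Real.cos t * ((lin (w y) (w y) - lin (w y) (w z)) -
          (lin (v y) (v y) - lin (v y) (v z)))) ∂(gG (ι ⊕ κ)) := by
      have hcont := fun z => gib_cont S hS c hc (u t) z
      refine integral_mono (integrable_const _) ?_ ?_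
      · refine integrable_finsetSum _ fun y hy => integrable_finsetSum _ fun z hz => ?_
        refine Integrable.mono' (integrable_const |(Real.sin t * Real.cos t * ((lin (w y) (w y) - lin (w y) (w z)) -
          (lin (v y) (v y) - lin (v y) (v z))))|) (Continuous.aestronglyMeasurable (by fun_prop))
          (ae_of_all _ fun Y => ?_)
        rw [Real.norm_eq_abs, abs_mul, abs_mul, abs_of_nonneg (gib_nonneg S hS c hc _ y Y),
          abs_of_nonneg (gib_nonneg S hS c hc _ z Y)]
        exact mul_le_of_le_one_left (abs_nonneg _) (mul_le_one₀ (gib_le_one S hS c hc _ y hy Y)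
          (gib_nonneg S hS c hc _ z Y) (gib_le_one S hS c hc _ z hz Y))
      · intro Y
        have h2 := gib_sum S hS c hc (u t) Y
        have e : -(2 * K * (Real.sin t * Real.cos t)) =
            ∑ y ∈ S, ∑ z ∈ S, gib S c (u t) y Y * gib S c (u t) z Y *
              (-(2 * K * (Real.sin t * Real.cos t))) := by
          simp only [← Finset.sum_mul, ← Finset.mul_sum, h2]; ring
        show -(2 * K * (Real.sin t * Real.cos t)) ≤ _
        rw [e]
        refine Finset.sum_le_sum fun y hy => Finset.sum_le_sum fun z hz => ?_
        refine mul_le_mul_of_nonneg_left ?_ (mul_nonneg (gib_nonneg S hS c hc _ y Y)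
          (gib_nonneg S hS c hc _ z Y))
        nlinarith [hK y hy z hz]
    rw [integral_const] at hlow
    simp at hlow
    nlinarith [hlow]
  have h0 : F 0 = ∫ Y, LSE S c v Y ∂(gG ι) := by
    rw [← gG_inl_integral (κ := κ) _ (LSE_cont S hS c hc v).measurable]
    simp only [hF, LSE, Zf, hu, lin_ivec]
    simp
  have h1 : F (Real.pi / 2) = ∫ Y, LSE S c w Y ∂(gG κ) := by
    rw [← gG_inr_integral (ι := ι) _ (LSE_cont S hS c hc w).measurable]
    simp only [hF, LSE, Zf, hu, lin_ivec]
    simp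
  have := hmono (Set.left_mem_Icc.2 (by positivity)) (Set.right_mem_Icc.2 (by positivity))
    (by positivity : (0:ℝ) ≤ Real.pi / 2)
  simp only [h0, h1] at this
  simpa using this

end


/-- weighted l1-Lipschitz -/
def LipK {ι : Type} [Fintype ι] (F : (ι → ℝ) → ℝ) (K : ι → ℝ) : Prop :=
  ∀ Y Y', |F Y - F Y'| ≤ ∑ j, K j * |Y j - Y' j|

lemma LipK.cont {ι : Type} [Fintype ι] {F : (ι → ℝ) → ℝ} {K : ι → ℝ} (h : LipK F K) :
    Continuous F := by
  rw [continuous_iff_continuousAt]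
  intro Y
  rw [ContinuousAt, tendsto_iff_dist_tendsto_zero]
  refine squeeze_zero (g := fun Y' : ι → ℝ => ∑ j, K j * |Y' j - Y j|)
    (fun _ => dist_nonneg) (fun Y' => h Y' Y) ?_
  have hc : Continuous fun Y' : ι → ℝ => ∑ j, K j * |Y' j - Y j| := by fun_prop
  have := hc.tendsto Y
  simpa using this

lemma gG_coord_memLp {ι : Type} [Fintype ι] (i : ι) : MemLp (fun Y : ι → ℝ => Y i) 2 (gG ι) := by
  exact (memLp_id_gaussianReal' 2 (by simp)).comp_measurePreserving
    (measurePreserving_eval (μ := fun _ : ι => gaussianReal 0 1) i)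

lemma LipK.memLp {ι : Type} [Fintype ι] {F : (ι → ℝ) → ℝ} {K : ι → ℝ} (h : LipK F K) :
    MemLp F 2 (gG ι) := by
  have hb : MemLp (fun Y : ι → ℝ => |F 0| + ∑ j, K j * |Y j|) 2 (gG ι) := by
    have h1 : ∀ j : ι, MemLp (fun Y : ι → ℝ => K j * |Y j|) 2 (gG ι) := fun j =>
      MemLp.const_mul (f := fun Y : ι → ℝ => |Y j|) (gG_coord_memLp j).norm (K j)
    exact (memLp_const (|F 0|)).add (memLp_finsetSum Finset.univ fun j _ => h1 j)
  refine hb.mono h.cont.aestronglyMeasurable (ae_of_all _ fun Y => ?_)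
  have h1 := h Y 0
  simp only [Pi.zero_apply, sub_zero] at h1
  have h3 := abs_sub_abs_le_abs_sub (F Y) (F 0)
  rw [Real.norm_eq_abs, Real.norm_eq_abs]
  exact le_trans (by linarith) (le_abs_self _)

lemma var_le_about {Ω : Type} [MeasurableSpace Ω] (μ : Measure Ω) [IsProbabilityMeasure μ]
    (f : Ω → ℝ) (hf : MemLp f 2 μ) (c : ℝ) :
    ∫ x, f x ^ 2 ∂μ - (∫ x, f x ∂μ) ^ 2 ≤ ∫ x, (f x - c) ^ 2 ∂μ := by
  have h1 : Integrable f μ := hf.integrable (by norm_num)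
  have h2 : Integrable (fun x => f x ^ 2) μ := hf.integrable_sq
  have e : ∫ x, (f x - c) ^ 2 ∂μ = ∫ x, f x ^ 2 ∂μ - 2 * c * ∫ x, f x ∂μ + c ^ 2 := by
    have : ∀ x, (f x - c) ^ 2 = f x ^ 2 - 2 * c * f x + c ^ 2 := fun x => by ring
    simp_rw [this]
    rw [integral_add (f := fun x => f x ^ 2 - 2 * c * f x) (h2.sub (h1.const_mul _))
      (integrable_const _), integral_sub h2 (h1.const_mul _), integral_const_mul]
    simp
  rw [e]
  nlinarith [sq_nonneg (∫ x, f x ∂μ - c)]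

lemma gR_sq : ∫ x, x ^ 2 ∂(gaussianReal 0 1) = 1 := by
  have h := variance_eq_sub (memLp_id_gaussianReal' (μ := 0) (v := 1) 2 (by simp))
  rw [variance_id_gaussianReal] at h
  simp [integral_id_gaussianReal] at h
  linarith

lemma lip1_memLp (f : ℝ → ℝ) (κ : ℝ) (hf : ∀ x y, |f x - f y| ≤ κ * |x - y|) :
    MemLp f 2 (gaussianReal 0 1) := by
  have hκ : 0 ≤ κ := by
    have := (abs_nonneg _).trans (hf 1 0); simpa using this
  have hc : LipschitzWith κ.toNNReal f := LipschitzWith.of_dist_le_mul fun x y => by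
    rw [Real.dist_eq, Real.dist_eq, Real.coe_toNNReal _ hκ]; exact hf x y
  have hb : MemLp (fun x : ℝ => |f 0| + κ * |x|) 2 (gaussianReal 0 1) := by
    have h0 : MemLp (fun x : ℝ => x) 2 (gaussianReal 0 1) := memLp_id_gaussianReal' 2 (by simp)
    have h1 : MemLp (fun x : ℝ => |x|) 2 (gaussianReal 0 1) := h0.norm
    exact (memLp_const (|f 0|)).add (h1.const_mul κ)
  refine hb.mono hc.continuous.aestronglyMeasurable (ae_of_all _ fun Y => ?_)
  have h1 := hf Y 0
  simp only [sub_zero] at h1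
  have h3 := abs_sub_abs_le_abs_sub (f Y) (f 0)
  rw [Real.norm_eq_abs, Real.norm_eq_abs]
  exact le_trans (by linarith) (le_abs_self _)

lemma var1 (f : ℝ → ℝ) (κ : ℝ) (hf : ∀ x y, |f x - f y| ≤ κ * |x - y|) :
    ∫ x, f x ^ 2 ∂(gaussianReal 0 1) - (∫ x, f x ∂(gaussianReal 0 1)) ^ 2 ≤ κ ^ 2 := by
  have hm := lip1_memLp f κ hf
  refine (var_le_about _ f hm (f 0)).trans ?_
  have : κ ^ 2 = ∫ x, κ ^ 2 * x ^ 2 ∂(gaussianReal 0 1) := by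
    rw [integral_const_mul, gR_sq, mul_one]
  rw [this]
  have h2 : MemLp (fun x => f x - f 0) 2 (gaussianReal 0 1) := hm.sub (memLp_const _)
  refine integral_mono h2.integrable_sq
    ((memLp_id_gaussianReal' 2 (by simp)).integrable_sq.const_mul _) fun x => ?_
  show (f x - f 0) ^ 2 ≤ κ ^ 2 * x ^ 2
  rw [← mul_pow, ← sq_abs]
  have h1 := hf x 0
  simp only [sub_zero] at h1
  calc |f x - f 0| ^ 2 ≤ (κ * |x|) ^ 2 := by gcongr
    _ = _ := by rw [mul_pow, mul_pow, sq_abs]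

lemma varFin (k : ℕ) : ∀ (F : (Fin k → ℝ) → ℝ) (K : Fin k → ℝ), LipK F K →
    ∫ Y, F Y ^ 2 ∂(gG (Fin k)) - (∫ Y, F Y ∂(gG (Fin k))) ^ 2 ≤ ∑ j, K j ^ 2 := by
  induction k with
  | zero =>
    intro F K h
    have : ∀ Y : Fin 0 → ℝ, F Y = F 0 := fun Y => by rw [Subsingleton.elim Y 0]
    simp_rw [this]; simp
  | succ k ih =>
    intro F K h
    have hmp := measurePreserving_piFinSuccAbove (fun _ : Fin (k+1) => gaussianReal 0 1) 0
    have hmp' := hmp.symm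
    have hval : ∀ (G : (Fin (k+1) → ℝ) → ℝ), Integrable G (gG (Fin (k+1))) →
      Integrable (fun q : ℝ × (Fin k → ℝ) => G (Fin.cons q.1 q.2)) ((gaussianReal 0 1).prod (gG (Fin k)))
        ∧ ∫ Y, G Y ∂(gG (Fin (k+1))) = ∫ y, ∫ x, G (Fin.cons x y) ∂(gaussianReal 0 1) ∂(gG (Fin k)) := by
      intro G hG
      have e : (fun q : ℝ × (Fin k → ℝ) => G (Fin.cons q.1 q.2)) =
          G ∘ ⇑(MeasurableEquiv.piFinSuccAbove (fun _ => ℝ) 0).symm := by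
        ext q
        simp [MeasurableEquiv.piFinSuccAbove]
        rfl
      have h1 : Integrable (fun q : ℝ × (Fin k → ℝ) => G (Fin.cons q.1 q.2))
          ((gaussianReal 0 1).prod (gG (Fin k))) := by
        have := hmp'.integrable_comp_of_integrable hG
        rw [e]
        exact this
      refine ⟨h1, ?_⟩
      rw [← integral_prod_symm _ h1]
      have := hmp'.integral_comp' (g := G)
      rw [gG, ← this, e]
      rfl
    have hm := h.memLp
    have hsl : ∀ y x x', |F (Fin.cons x y) - F (Fin.cons x' y)| ≤ K 0 * |x - x'| := by
      intro y x x'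
      have := h (Fin.cons x y) (Fin.cons x' y)
      simpa [Fin.sum_univ_succ] using this
    have hI1 := fun y => (lip1_memLp _ _ (hsl y)).integrable (by norm_num)
    have hI2 := fun y => (lip1_memLp _ _ (hsl y)).integrable_sq
    set g : (Fin k → ℝ) → ℝ := fun y => ∫ x, F (Fin.cons x y) ∂(gaussianReal 0 1) with hg
    have hgl : LipK g (fun j => K j.succ) := by
      intro y y'
      rw [hg]
      simp only
      rw [← integral_sub (hI1 y) (hI1 y')]
      refine (abs_integral_le_integral_abs).trans ?_
      have : ∫ x, |F (Fin.cons x y) - F (Fin.cons x y')| ∂(gaussianReal 0 1) ≤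
          ∫ _x, (∑ j : Fin k, K j.succ * |y j - y' j|) ∂(gaussianReal 0 1) := by
        refine integral_mono ((hI1 y).sub (hI1 y')).abs (integrable_const _) fun x => ?_
        have := h (Fin.cons x y) (Fin.cons x y')
        simpa [Fin.sum_univ_succ] using this
      simpa using this
    obtain ⟨i1, e1⟩ := hval _ (hm.integrable (by norm_num))
    obtain ⟨i2, e2⟩ := hval _ hm.integrable_sq
    have h5 := ih g _ hgl
    rw [e1, e2, Fin.sum_univ_succ]
    have h6 : ∫ y, ∫ x, F (Fin.cons x y) ^ 2 ∂(gaussianReal 0 1) ∂(gG (Fin k)) ≤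
        ∫ y, (g y ^ 2 + K 0 ^ 2) ∂(gG (Fin k)) := by
      refine integral_mono i2.integral_prod_right (hgl.memLp.integrable_sq.add (integrable_const _))
        fun y => ?_
      have := var1 _ _ (hsl y)
      simp only [hg]
      linarith
    rw [integral_add hgl.memLp.integrable_sq (integrable_const _)] at h6
    simp at h6
    linarith

lemma varG {ι : Type} [Fintype ι] (F : (ι → ℝ) → ℝ) (K : ι → ℝ) (h : LipK F K) :
    Var[F; gG ι] ≤ ∑ j, K j ^ 2 := by
  rw [variance_eq_sub h.memLp]
  simp only [Pi.pow_apply]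
  have e := (Fintype.equivFin ι).symm
  set e := (Fintype.equivFin ι).symm
  have hmp := measurePreserving_piCongrLeft (fun _ : ι => gaussianReal 0 1) e
  have hval : ∀ G : (ι → ℝ) → ℝ, ∫ Y, G Y ∂(gG ι) = ∫ Y, G (fun i => Y (e.symm i)) ∂(gG (Fin (Fintype.card ι))) := by
    intro G
    have := hmp.integral_comp' (g := G)
    rw [gG, ← this]
    congr 1
    ext Y
    congr 1
    ext i
    have := Equiv.piCongrLeft_apply_apply (fun _ : ι => ℝ) e Y (e.symm i)
    rw [MeasurableEquiv.coe_piCongrLeft]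
    rw [Equiv.apply_symm_apply] at this
    exact this
  rw [hval F, hval (fun Y => F Y ^ 2)]
  have h2 : LipK (fun Y : Fin (Fintype.card ι) → ℝ => F (fun i => Y (e.symm i))) (fun j => K (e j)) := by
    intro Y Y'
    refine (h _ _).trans (le_of_eq ?_)
    rw [← e.sum_comp]
    simp
  refine (varFin _ _ _ h2).trans (le_of_eq ?_)
  exact e.sum_comp (fun j => K j ^ 2)

/-- Chebyshev for LipK functions -/
lemma chebG {ι : Type} [Fintype ι] (F : (ι → ℝ) → ℝ) (K : ι → ℝ) (h : LipK F K) (V t : ℝ)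
    (hV : ∑ j, K j ^ 2 ≤ V) (ht : 0 < t) :
    (gG ι).real {Y | t ≤ |F Y - ∫ Y, F Y ∂(gG ι)|} ≤ V / t ^ 2 := by
  have h1 := meas_ge_le_variance_div_sq h.memLp ht
  have h2 := (varG F K h).trans hV
  rw [Measure.real]
  refine ENNReal.toReal_le_of_le_ofReal ?_ (h1.trans (ENNReal.ofReal_le_ofReal ?_))
  · have : 0 ≤ V := (variance_nonneg _ _).trans h2
    positivity
  · gcongr

/-- If F is at least A with probability at least q, its mean is at least A - sqrt (2 V / q). -/
lemma mean_ge_of_prob {ι : Type} [Fintype ι] (F : (ι → ℝ) → ℝ) (K : ι → ℝ) (h : LipK F K)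
    (V A q : ℝ) (hV : ∑ j, K j ^ 2 ≤ V) (hV0 : 0 < V) (hq : 0 < q)
    (hP : q ≤ (gG ι).real {Y | A ≤ F Y}) :
    A - Real.sqrt (2 * V / q) ≤ ∫ Y, F Y ∂(gG ι) := by
  by_contra hcon
  push Not at hcon
  have ht : 0 < Real.sqrt (2 * V / q) := Real.sqrt_pos.2 (by positivity)
  have h1 := chebG F K h V _ hV ht
  rw [Real.sq_sqrt (by positivity)] at h1
  have h2 : (gG ι).real {Y | A ≤ F Y} ≤
      (gG ι).real {Y | Real.sqrt (2 * V / q) ≤ |F Y - ∫ Y, F Y ∂(gG ι)|} := by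
    refine measureReal_mono (fun Y (hY : A ≤ F Y) => ?_)
    show _ ≤ |F Y - ∫ Y, F Y ∂(gG ι)|
    exact le_trans (by linarith) (le_abs_self _)
  have h3 : V / (2 * V / q) = q / 2 := by field_simp
  linarith

/-- upper tail -/
lemma prob_ge_le {ι : Type} [Fintype ι] (F : (ι → ℝ) → ℝ) (K : ι → ℝ) (h : LipK F K)
    (V A t : ℝ) (hV : ∑ j, K j ^ 2 ≤ V) (ht : 0 < t)
    (hm : ∫ Y, F Y ∂(gG ι) + t ≤ A) :
    (gG ι).real {Y | A ≤ F Y} ≤ V / t ^ 2 := by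
  refine le_trans (measureReal_mono (fun Y (hY : A ≤ F Y) => ?_)) (chebG F K h V t hV ht)
  show _ ≤ |F Y - ∫ Y, F Y ∂(gG ι)|
  exact le_trans (by linarith) (le_abs_self _)

lemma prob_le_le {ι : Type} [Fintype ι] (F : (ι → ℝ) → ℝ) (K : ι → ℝ) (h : LipK F K)
    (V A t : ℝ) (hV : ∑ j, K j ^ 2 ≤ V) (ht : 0 < t)
    (hm : A + t ≤ ∫ Y, F Y ∂(gG ι)) :
    (gG ι).real {Y | F Y ≤ A} ≤ V / t ^ 2 := by
  refine le_trans (measureReal_mono (fun Y (hY : F Y ≤ A) => ?_)) (chebG F K h V t hV ht)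
  show _ ≤ |F Y - ∫ Y, F Y ∂(gG ι)|
  rw [abs_sub_comm]
  exact le_trans (by linarith) (le_abs_self _)


open Classical in
/-- cube as a finset -/
noncomputable def cubeF (n : ℕ) : Finset (Fin n → ℝ) := Fintype.piFinset fun _ => {1, -1}

lemma mem_cubeF {n : ℕ} {x : Fin n → ℝ} : x ∈ cubeF n ↔ ∀ i, x i = 1 ∨ x i = -1 := by
  simp [cubeF, Fintype.mem_piFinset]

lemma mem_cubeF_iff {n : ℕ} {x : Fin n → ℝ} : x ∈ cubeF n ↔ x ∈ cubeSet n := by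
  rw [mem_cubeF]; rfl

lemma cube_sq {n : ℕ} {x : Fin n → ℝ} (hx : x ∈ cubeF n) (i : Fin n) : x i * x i = 1 := by
  rcases mem_cubeF.1 hx i with h | h <;> rw [h] <;> norm_num

lemma cube_abs {n : ℕ} {x : Fin n → ℝ} (hx : x ∈ cubeF n) (i : Fin n) : |x i| = 1 := by
  rcases mem_cubeF.1 hx i with h | h <;> rw [h] <;> norm_num

lemma cubeF_sum_prod {n : ℕ} (f : Fin n → ℝ → ℝ) :
    ∑ y ∈ cubeF n, ∏ i, f i (y i) = ∏ i, (f i 1 + f i (-1)) := by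
  classical
  unfold cubeF
  rw [Finset.sum_prod_piFinset]
  refine Finset.prod_congr rfl fun i _ => ?_
  rw [Finset.sum_pair (by norm_num)]

lemma cubeF_card (n : ℕ) : ((cubeF n).card : ℝ) = 2 ^ n := by
  have := cubeF_sum_prod (n := n) (fun _ _ => 1)
  simp at this
  rw [this]; norm_num

lemma cubeF_sum_exp {n : ℕ} (h : Fin n → ℝ) :
    ∑ y ∈ cubeF n, Real.exp (∑ i, h i * y i) = ∏ i, (Real.exp (h i) + Real.exp (-h i)) := by
  have := cubeF_sum_prod (n := n) (fun i t => Real.exp (h i * t))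
  simp only [← Real.exp_sum] at this
  rw [this]; simp

lemma cubeF_one (n : ℕ) : (1 : Fin n → ℝ) ∈ cubeF n := mem_cubeF.2 fun _ => Or.inl rfl

lemma cubeF_nonempty (n : ℕ) : (cubeF n).Nonempty := ⟨1, cubeF_one n⟩

/-- signed overlap -/
noncomputable def ov (n : ℕ) (x y : Fin n → ℝ) : ℝ := (∑ i, x i * y i) / n

lemma ov_comm (n : ℕ) (x y : Fin n → ℝ) : ov n x y = ov n y x := by
  simp [ov, mul_comm]

lemma olap_eq (n : ℕ) (x y : Fin n → ℝ) : olap n x y = |ov n x y| := by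
  rw [olap, ov, abs_div, Nat.abs_cast]

lemma ov_self {n : ℕ} (hn : 0 < n) {x : Fin n → ℝ} (hx : x ∈ cubeF n) : ov n x x = 1 := by
  have : (n : ℝ) ≠ 0 := by positivity
  simp [ov, cube_sq hx, this]

lemma ov_abs_le {n : ℕ} {x y : Fin n → ℝ} (hx : x ∈ cubeF n) (hy : y ∈ cubeF n) :
    |ov n x y| ≤ 1 := by
  rw [ov, abs_div, Nat.abs_cast]
  refine div_le_one_of_le₀ ?_ (Nat.cast_nonneg n)
  refine (Finset.abs_sum_le_sum_abs _ _).trans ?_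
  simp [abs_mul, cube_abs hx, cube_abs hy]

/-- feature vector -/
noncomputable def pv (p n : ℕ) (x : Fin n → ℝ) : (Fin p → Fin n) → ℝ :=
  fun j => (n : ℝ) ^ ((1 - (p : ℝ)) / 2) * ∏ l, x (j l)

lemma sum_prod_pow (p n : ℕ) (a : Fin n → ℝ) :
    ∑ j : Fin p → Fin n, ∏ l, a (j l) = (∑ i, a i) ^ p := by
  rw [Fintype.sum_pow]

lemma n_pow_sq {p n : ℕ} (hn : 0 < n) :
    (n : ℝ) ^ ((1 - (p : ℝ)) / 2) * (n : ℝ) ^ ((1 - (p : ℝ)) / 2) = n / (n : ℝ) ^ p := by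
  have h : (0 : ℝ) < n := by exact_mod_cast hn
  rw [← Real.rpow_add h, add_halves, Real.rpow_sub h, Real.rpow_one, Real.rpow_natCast]

lemma pv_inner {p n : ℕ} (hn : 0 < n) (x y : Fin n → ℝ) :
    lin (pv p n x) (pv p n y) = n * (ov n x y) ^ p := by
  have h : (0 : ℝ) < n := by exact_mod_cast hn
  have e : ∀ j : Fin p → Fin n, pv p n x j * pv p n y j =
      (n / (n : ℝ) ^ p) * ∏ l, (x (j l) * y (j l)) := by
    intro j
    rw [← n_pow_sq hn, Finset.prod_mul_distrib]
    unfold pv; ring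
  unfold lin
  simp_rw [e]
  rw [← Finset.mul_sum, sum_prod_pow p n (fun i => x i * y i), ov, div_pow]
  ring

lemma pv_H {p n : ℕ} (hn : 0 < n) (x : Fin n → ℝ) (Y : (Fin p → Fin n) → ℝ) :
    lin (pv p n x) Y = n * Hpspin p n Y x := by
  have h : (0 : ℝ) < n := by exact_mod_cast hn
  have e : (n : ℝ) * (n : ℝ) ^ (-(((p : ℝ) + 1) / 2)) = (n : ℝ) ^ ((1 - (p : ℝ)) / 2) := by
    nth_rw 1 [← Real.rpow_one (n : ℝ)]
    rw [← Real.rpow_add h]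
    congr 1; ring
  unfold lin pv Hpspin
  rw [← mul_assoc, e, Finset.mul_sum]
  exact Finset.sum_congr rfl fun j _ => by ring

lemma pv_abs {p n : ℕ} {x : Fin n → ℝ} (hx : x ∈ cubeF n) (j : Fin p → Fin n) :
    |pv p n x j| = (n : ℝ) ^ ((1 - (p : ℝ)) / 2) := by
  unfold pv
  rw [abs_mul, Finset.abs_prod]
  simp only [cube_abs hx, Finset.prod_const_one, mul_one]
  exact abs_of_nonneg (by positivity)

lemma pv_K_sum {p n : ℕ} (hn : 0 < n) (b : ℝ) :
    ∑ _j : Fin p → Fin n, (|b| * (n : ℝ) ^ ((1 - (p : ℝ)) / 2)) ^ 2 = b ^ 2 * n := by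
  have h : (0 : ℝ) < n := by exact_mod_cast hn
  simp only [mul_pow, sq_abs]
  rw [Finset.sum_const, pow_two ((n : ℝ) ^ _), n_pow_sq hn]
  simp
  field_simp

/-- LSE of the p-spin model at inverse temperature b -/
lemma pLSE_lip {p n : ℕ} (b : ℝ) (S : Finset (Fin n → ℝ)) (hS : S.Nonempty) (hSc : S ⊆ cubeF n)
    (c : (Fin n → ℝ) → ℝ) (hc : ∀ y, 0 < c y) :
    LipK (LSE S c (fun y => b • pv p n y)) (fun _ => |b| * (n : ℝ) ^ ((1 - (p : ℝ)) / 2)) := by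
  intro Y Y'
  refine LSE_lip S hS c hc _ _ (fun y hy j => ?_) Y Y'
  rw [Pi.smul_apply, smul_eq_mul, abs_mul, pv_abs (hSc hy)]

lemma maxCube_ge {p n : ℕ} (Y : (Fin p → Fin n) → ℝ) {x : Fin n → ℝ} (hx : x ∈ cubeF n) :
    Hpspin p n Y x ≤ maxCube p n Y := by
  refine le_csSup ?_ ⟨x, mem_cubeF_iff.1 hx, rfl⟩
  have : cubeSet n = (cubeF n : Set (Fin n → ℝ)) := by
    ext x; simp [mem_cubeF_iff]
  rw [this]
  exact ((cubeF n).finite_toSet.image _).bddAbove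

/-- if all energies are at most A then LSE is at most log card + A -/
lemma LSE_le {α ι : Type} [Fintype ι] (S : Finset α) (hS : S.Nonempty) (c : α → ℝ)
    (hc : ∀ y, 0 < c y) (v : α → ι → ℝ) (Y : ι → ℝ) (A : ℝ)
    (h : ∀ y ∈ S, c y * Real.exp (lin (v y) Y) ≤ Real.exp A) :
    LSE S c v Y ≤ Real.log S.card + A := by
  have hcard : (0 : ℝ) < S.card := by exact_mod_cast hS.card_pos
  unfold LSE
  rw [← Real.log_exp A, ← Real.log_mul hcard.ne' (Real.exp_pos _).ne']
  refine Real.log_le_log (Zf_pos S hS c hc v Y) ?_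
  rw [← nsmul_eq_mul]
  exact Finset.sum_le_card_nsmul _ _ _ h

lemma LSE_ge {α ι : Type} [Fintype ι] (S : Finset α) (c : α → ℝ)
    (hc : ∀ y, 0 < c y) (v : α → ι → ℝ) (Y : ι → ℝ) (y : α) (hy : y ∈ S) :
    Real.log (c y) + lin (v y) Y ≤ LSE S c v Y := by
  unfold LSE
  rw [← Real.log_exp (lin (v y) Y), ← Real.log_mul (hc y).ne' (Real.exp_pos _).ne']
  refine Real.log_le_log (mul_pos (hc y) (Real.exp_pos _)) ?_
  exact Finset.single_le_sum (f := fun y => c y * Real.exp (lin (v y) Y))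
    (fun z _ => (mul_pos (hc z) (Real.exp_pos _)).le) hy


/-- integral bound via an antiderivative -/
lemma int_Ioi_le (a : ℝ) (f P P' : ℝ → ℝ) (hd : ∀ x ∈ Set.Ici a, HasDerivAt P (-(P' x)) x)
    (hf0 : ∀ x ∈ Set.Ioi a, 0 ≤ f x) (hf : ∀ x ∈ Set.Ioi a, f x ≤ P' x)
    (hl : Filter.Tendsto P Filter.atTop (nhds 0)) :
    ∫ x in Set.Ioi a, f x ≤ P a := by
  have hd' : ∀ x ∈ Set.Ici a, HasDerivAt (fun y => -P y) (P' x) x := by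
    intro x hx
    exact (hd x hx).neg.congr_deriv (neg_neg _)
  have hpos : ∀ x ∈ Set.Ioi a, 0 ≤ P' x := fun x hx => (hf0 x hx).trans (hf x hx)
  have hl' : Filter.Tendsto (fun y => -P y) Filter.atTop (nhds 0) := by simpa using hl.neg
  have hi := integrableOn_Ioi_deriv_of_nonneg' hd' hpos hl'
  have he := integral_Ioi_of_hasDerivAt_of_nonneg' hd' hpos hl'
  have : ∫ x in Set.Ioi a, f x ≤ ∫ x in Set.Ioi a, P' x := by
    refine integral_mono_of_nonneg ?_ hi ?_
    · exact (ae_restrict_iff' measurableSet_Ioi).2 (ae_of_all _ hf0)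
    · exact (ae_restrict_iff' measurableSet_Ioi).2 (ae_of_all _ hf)
  rw [he] at this
  simpa using this

noncomputable def psiL (x : ℝ) : ℝ := x * (x^4 + 14*x^2 + 33) / (x^6 + 15*x^4 + 45*x^2 + 15)
noncomputable def psiU (x : ℝ) : ℝ := (x^2 + 2) / (x * (x^2 + 3))

noncomputable def dL (x : ℝ) : ℝ := (((5*x^4 + 42*x^2 + 33) * (x^6 + 15*x^4 + 45*x^2 + 15) -
      (x * (x^4 + 14*x^2 + 33)) * (6*x^5 + 60*x^3 + 90*x)) /
      (x^6 + 15*x^4 + 45*x^2 + 15)^2)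
noncomputable def dU (x : ℝ) : ℝ := (((2*x) * (x * (x^2+3)) - (x^2+2) * (3*x^2+3)) / (x * (x^2+3))^2)

lemma psiL_deriv (x : ℝ) : HasDerivAt psiL
    (dL x) x := by
  have h1 : HasDerivAt (fun x : ℝ => x * (x^4 + 14*x^2 + 33)) (5*x^4 + 42*x^2 + 33) x := by
    have := (hasDerivAt_id x).mul
      (((hasDerivAt_pow 4 x).add ((hasDerivAt_pow 2 x).const_mul 14)).add_const 33)
    refine this.congr_deriv ?_
    simp; ring
  have h2 : HasDerivAt (fun x : ℝ => x^6 + 15*x^4 + 45*x^2 + 15) (6*x^5 + 60*x^3 + 90*x) x := by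
    have := (((hasDerivAt_pow 6 x).add ((hasDerivAt_pow 4 x).const_mul 15)).add
      ((hasDerivAt_pow 2 x).const_mul 45)).add_const 15
    refine this.congr_deriv ?_
    simp; ring
  exact h1.div h2 (by positivity)

lemma psiL_ineq (x : ℝ) : x * psiL x - (dL x) ≤ 1 := by
  have hD : 0 < x^6 + 15*x^4 + 45*x^2 + 15 := by positivity
  unfold psiL dL
  rw [mul_div_assoc', div_sub_div _ _ hD.ne' (by positivity), div_le_one (by positivity)]
  have : 0 ≤ (x^6 + 15*x^4 + 45*x^2 + 15) := hD.le
  nlinarith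

lemma psiU_deriv {x : ℝ} (hx : 0 < x) : HasDerivAt psiU
    (dU x) x := by
  have h1 : HasDerivAt (fun x : ℝ => x^2+2) (2*x) x := by
    have := (hasDerivAt_pow 2 x).add_const 2
    refine this.congr_deriv ?_
    simp
  have h2 : HasDerivAt (fun x : ℝ => x * (x^2+3)) (3*x^2+3) x := by
    have := (hasDerivAt_id x).mul ((hasDerivAt_pow 2 x).add_const 3)
    refine this.congr_deriv ?_
    simp; ring
  exact h1.div h2 (by positivity)

lemma psiU_ineq {x : ℝ} (hx : 0 < x) :
    1 ≤ x * psiU x - (dU x) := by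
  have hD : 0 < x * (x^2+3) := by positivity
  unfold psiU dU
  rw [mul_div_assoc', div_sub_div _ _ hD.ne' (by positivity), one_le_div (by positivity)]
  nlinarith

/-- derivative of gaussian weight times psi -/
lemma gw_deriv (t : ℝ) (ψ : ℝ → ℝ) (d x : ℝ) (h : HasDerivAt ψ d (x + t)) :
    HasDerivAt (fun x => Real.exp (-x^2/2 - t*x) * ψ (x + t))
      (-(Real.exp (-x^2/2 - t*x) * ((x + t) * ψ (x + t) - d))) x := by
  have h1 : HasDerivAt (fun x : ℝ => -x^2/2 - t*x) (-(x + t)) x := by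
    have := (((hasDerivAt_pow 2 x).neg).div_const 2).sub ((hasDerivAt_id x).const_mul t)
    refine this.congr_deriv ?_
    simp; ring
  have h2 : HasDerivAt (fun x => ψ (x + t)) d x := h.comp_add_const x t
  refine (h1.exp.mul h2).congr_deriv ?_
  ring

lemma gw_tendsto (t : ℝ) (ht : 0 ≤ t) (ψ : ℝ → ℝ) (C : ℝ) (hψ : ∀ x, 1 ≤ x → |ψ (x + t)| ≤ C) :
    Filter.Tendsto (fun x => Real.exp (-x^2/2 - t*x) * ψ (x + t)) Filter.atTop (nhds 0) := by
  have h0 : Filter.Tendsto (fun x : ℝ => Real.exp (-(x/2)) * C) Filter.atTop (nhds 0) := by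
    have : Filter.Tendsto (fun x : ℝ => Real.exp (-(x/2))) Filter.atTop (nhds 0) :=
      Real.tendsto_exp_neg_atTop_nhds_zero.comp (Filter.tendsto_id.atTop_div_const (by norm_num))
    simpa using this.mul_const C
  refine squeeze_zero_norm' ?_ h0
  filter_upwards [Filter.eventually_ge_atTop 1] with x hx
  rw [Real.norm_eq_abs, abs_mul, abs_of_pos (Real.exp_pos _)]
  refine mul_le_mul (Real.exp_le_exp.2 ?_) (hψ x hx) (abs_nonneg _) (Real.exp_pos _).le
  nlinarith [mul_nonneg ht (by linarith : (0:ℝ) ≤ x)]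

lemma psiL_bd {x : ℝ} (hx : 1 ≤ x) : |psiL x| ≤ 1 := by
  have hD : 0 < x^6 + 15*x^4 + 45*x^2 + 15 := by positivity
  unfold psiL
  rw [abs_of_nonneg (by positivity), div_le_one hD]
  have h2 : x ≤ x^2 := by nlinarith
  have h3 : x^5 ≤ x^6 := pow_le_pow_right₀ hx (by norm_num)
  have h4 : x^3 ≤ x^4 := pow_le_pow_right₀ hx (by norm_num)
  have : 0 ≤ x^4 := by positivity
  nlinarith

lemma psiU_bd {x : ℝ} (hx : 1 ≤ x) : |psiU x| ≤ 1 := by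
  have hD : 0 < x * (x^2+3) := by positivity
  unfold psiU
  rw [abs_of_nonneg (by positivity), div_le_one hD]
  nlinarith

/-- tail bound -/
lemma tail_le {τ : ℝ} (hτ : 0 < τ) :
    ∫ x in Set.Ioi (0:ℝ), Real.exp (-x^2/2 - τ*x) ≤ psiU τ := by
  have := int_Ioi_le 0 (fun x => Real.exp (-x^2/2 - τ*x))
    (fun x => Real.exp (-x^2/2 - τ*x) * psiU (x + τ)) _
    (fun x hx => gw_deriv τ psiU _ x (psiU_deriv (by have := Set.mem_Ici.1 hx; linarith)))
    (fun x _ => (Real.exp_pos _).le)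
    (fun x hx => by
      have := psiU_ineq (x := x + τ) (by have := Set.mem_Ioi.1 hx; linarith)
      exact le_mul_of_one_le_right (Real.exp_pos _).le this)
    (gw_tendsto τ hτ.le psiU 1 fun x hx => psiU_bd (by linarith))
  simpa using this

lemma log_bd {s : ℝ} (hs : 0 ≤ s) : (1 + s) * Real.log (1 + s) ≤ s + s^2/2 := by
  have h := Real.self_le_sinh_iff.2 (Real.log_nonneg (by linarith : 1 ≤ 1 + s))
  rw [Real.sinh_log (by linarith)] at h
  have := mul_le_mul_of_nonneg_left h (by linarith : 0 ≤ 1 + s)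
  have e : (1 + s) * (1 + s)⁻¹ = 1 := mul_inv_cancel₀ (by linarith)
  nlinarith

noncomputable def JJ (γ : ℝ) : ℝ :=
  2*γ - (2*γ-1) * (γ*(γ^2+14*γ+33)/(γ^3+15*γ^2+45*γ+15)) + (9*γ+2)/(6*(9*γ+3))

/-- half-line bound -/
lemma half_bound {σ : ℝ} (hσ : 0 < σ) (h2 : 1 ≤ 2*σ^2) :
    ∫ w in Set.Ioi (0:ℝ), Real.exp (-w^2/2) *
      (Real.exp (σ*w) * Real.log (1 + Real.exp (-2*(σ*w))) +
       Real.exp (-(σ*w)) * Real.log (1 + Real.exp (2*(σ*w)))) ≤ JJ (σ^2) / σ := by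
  have key := int_Ioi_le 0 (fun w => Real.exp (-w^2/2) *
      (Real.exp (σ*w) * Real.log (1 + Real.exp (-2*(σ*w))) +
       Real.exp (-(σ*w)) * Real.log (1 + Real.exp (2*(σ*w)))))
    (fun x => (2*σ) * (Real.exp (-x^2/2 - σ*x) * (fun _ => (1:ℝ)) (x + σ))
      - (2*σ^2-1) * (Real.exp (-x^2/2 - σ*x) * psiL (x + σ))
      + (1/2) * (Real.exp (-x^2/2 - (3*σ)*x) * psiU (x + 3*σ)))
    (fun x => (2*σ) * (Real.exp (-x^2/2 - σ*x) * ((x + σ) * (fun _ => (1:ℝ)) (x + σ) - 0))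
      - (2*σ^2-1) * (Real.exp (-x^2/2 - σ*x) * ((x + σ) * psiL (x + σ) - dL (x + σ)))
      + (1/2) * (Real.exp (-x^2/2 - (3*σ)*x) * ((x + 3*σ) * psiU (x + 3*σ) - dU (x + 3*σ))))
    (fun x hx => by
      have hx' := Set.mem_Ici.1 hx
      have := (((gw_deriv σ (fun _ => (1:ℝ)) 0 x (hasDerivAt_const _ _)).const_mul (2*σ)).sub
        ((gw_deriv σ psiL _ x (psiL_deriv _)).const_mul (2*σ^2-1))).add
        ((gw_deriv (3*σ) psiU _ x (psiU_deriv (by positivity))).const_mul (1/2))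
      refine this.congr_deriv ?_
      simp only [dL, dU]
      ring)
    (fun x hx => by
      have h1 : 0 ≤ Real.log (1 + Real.exp (-2*(σ*x))) :=
        Real.log_nonneg (by linarith [Real.exp_pos (-2*(σ*x))])
      have h2 : 0 ≤ Real.log (1 + Real.exp (2*(σ*x))) :=
        Real.log_nonneg (by linarith [Real.exp_pos (2*(σ*x))])
      positivity)
    (fun x hx => by
      have hx' := Set.mem_Ioi.1 hx
      have hl := psiL_ineq (x + σ)
      have hu := psiU_ineq (x := x + 3*σ) (by positivity)
      set s := σ * x with hs
      have e0 : Real.exp (-x^2/2 - σ*x) = Real.exp (-x^2/2) * Real.exp (-s) := by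
        rw [← Real.exp_add]; congr 1
      have e1 : Real.exp (-x^2/2 - (3*σ)*x) = Real.exp (-x^2/2) * Real.exp (-3*s) := by
        rw [← Real.exp_add]; congr 1; rw [hs]; ring
      have e2 : Real.log (1 + Real.exp (2*s)) = 2*s + Real.log (1 + Real.exp (-2*s)) := by
        rw [← Real.log_exp (2*s), ← Real.log_mul (Real.exp_pos _).ne' (by positivity)]
        rw [Real.log_exp, mul_add, ← Real.exp_add]
        congr 1; ring_nf; simp [add_comm]
      have e3 : Real.exp (-2*s) = Real.exp (-s) * Real.exp (-s) := by
        rw [← Real.exp_add]; congr 1; ring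
      have e4 : Real.exp (-3*s) = Real.exp (-s) * Real.exp (-s) * Real.exp (-s) := by
        rw [← Real.exp_add, ← Real.exp_add]; congr 1; ring
      have e5 : Real.exp s * Real.exp (-s) = 1 := by rw [← Real.exp_add]; simp
      have hlog := log_bd (Real.exp_pos (-2*s)).le
      rw [e0, e1, e2]
      rw [e3] at hlog ⊢
      rw [e4]
      set A := Real.exp (-s)
      set B := Real.exp s
      set L := Real.log (1 + A * A)
      have hA : 0 < A := Real.exp_pos _
      have hB : 0 < B := Real.exp_pos _
      have hk : B * L + A * (2*s + L) ≤ (2*s+1)*A + 1/2*(A*A*A) := by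
        have := mul_le_mul_of_nonneg_left hlog hB.le
        have e6 : B * ((1 + A*A)*L) = B*L + A*L := by
          have : B*(A*A) = A := by rw [← mul_assoc, e5, one_mul]
          linear_combination L*this
        have e7 : B * (A*A + (A*A)^2/2) = A + A*A*A/2 := by
          have : B*(A*A) = A := by rw [← mul_assoc, e5, one_mul]
          linear_combination (1 + A*A/2)*this
        rw [e6, e7] at this
        nlinarith
      have hW : 0 < Real.exp (-x^2/2) := Real.exp_pos _
      have := mul_le_mul_of_nonneg_left hk hW.le
      refine this.trans ?_
      have m1 := mul_le_mul_of_nonneg_left hl (by positivity : 0 ≤ Real.exp (-x^2/2) * A)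
      have m2 := mul_le_mul_of_nonneg_left m1 (by linarith : 0 ≤ 2*σ^2-1)
      have m3 := mul_le_mul_of_nonneg_left hu (by positivity : 0 ≤ Real.exp (-x^2/2) * (A*A*A))
      have m4 : Real.exp (-x^2/2) * ((2*s+1)*A + 1/2*(A*A*A)) =
        2*σ*(Real.exp (-x^2/2) * A * ((x+σ)*1 - 0)) - (2*σ^2-1)*(Real.exp (-x^2/2) * A * 1) +
        1/2 * (Real.exp (-x^2/2) * (A*A*A) * 1) := by
        rw [hs]; ring
      rw [m4]
      linarith)
    (by
      have t1 := (gw_tendsto σ hσ.le (fun _ => (1:ℝ)) 1 (fun x _ => by simp)).const_mul (2*σ)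
      have t2 := (gw_tendsto σ hσ.le psiL 1 (fun x hx => psiL_bd (by linarith))).const_mul (2*σ^2-1)
      have t3 := (gw_tendsto (3*σ) (by positivity) psiU 1
        (fun x hx => psiU_bd (by linarith))).const_mul (1/2)
      simpa using (t1.sub t2).add t3)
  refine key.trans (le_of_eq ?_)
  unfold JJ psiL psiU
  have : 0 < (σ^6 + 15*σ^4 + 45*σ^2 + 15) := by positivity
  simp
  field_simp
  ring


lemma g1_int (f : ℝ → ℝ) : ∫ x, f x ∂(gaussianReal 0 1) =
    (√(2*Real.pi))⁻¹ * ∫ x, Real.exp (-x^2/2) * f x := by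
  rw [integral_gaussianReal_eq_integral_smul one_ne_zero, ← integral_const_mul]
  congr 1; ext x
  simp [gaussianPDFReal, mul_assoc]

lemma g1_id_integrable : Integrable (fun x : ℝ => x) (gaussianReal 0 1) :=
  (memLp_id_gaussianReal (μ := 0) (v := 1) 1).integrable (by simp)

lemma int_split (G : ℝ → ℝ) (hG : Integrable G) :
    ∫ x, G x = ∫ x in Set.Ioi (0:ℝ), (G x + G (-x)) := by
  rw [← integral_add_compl (measurableSet_Ioi (a := (0:ℝ))) hG, Set.compl_Ioi, integral_add]
  · congr 1
    rw [integral_comp_neg_Ioi (0:ℝ) G]; simp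
  · exact hG.integrableOn
  · exact hG.comp_neg.integrableOn

lemma T_raw {σ : ℝ} (hσ : 0 < σ) (h2 : 1 ≤ 2*σ^2) :
    ∫ z, Real.log (1 + Real.exp (-2*(σ^2 + σ*z))) ∂(gaussianReal 0 1) ≤
      (√(2*Real.pi))⁻¹ * (Real.exp (-σ^2/2) * (JJ (σ^2) / σ)) := by
  rw [g1_int]
  refine mul_le_mul_of_nonneg_left ?_ (by positivity)
  rw [← integral_sub_right_eq_self _ σ]
  have e : ∀ w : ℝ, Real.exp (-(w-σ)^2/2) * Real.log (1 + Real.exp (-2*(σ^2 + σ*(w-σ)))) =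
      Real.exp (-σ^2/2) * (Real.exp (-w^2/2) * (Real.exp (σ*w) *
        Real.log (1 + Real.exp (-2*(σ*w))))) := by
    intro w
    rw [← mul_assoc, ← mul_assoc, ← Real.exp_add, ← Real.exp_add]
    congr 2
    · ring
    · ring_nf
  simp_rw [e]
  rw [integral_const_mul]
  refine mul_le_mul_of_nonneg_left ?_ (Real.exp_pos _).le
  have hb := half_bound hσ h2
  by_cases hi : Integrable (fun w : ℝ => Real.exp (-w^2/2) * (Real.exp (σ*w) *
        Real.log (1 + Real.exp (-2*(σ*w)))))
  · rw [int_split _ hi]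
    refine le_trans (le_of_eq ?_) hb
    congr 1; ext w
    rw [mul_add]
    congr 1
    · ring_nf
  · rw [integral_undef hi]
    refine le_trans ?_ hb
    refine integral_nonneg fun x => ?_
    have h1 : 0 ≤ Real.log (1 + Real.exp (-2*(σ*x))) :=
        Real.log_nonneg (by linarith [Real.exp_pos (-2*(σ*x))])
    have h2 : 0 ≤ Real.log (1 + Real.exp (2*(σ*x))) :=
        Real.log_nonneg (by linarith [Real.exp_pos (2*(σ*x))])
    simp only [Pi.zero_apply]
    positivity

lemma log1p_exp_bd (u : ℝ) : |Real.log (1 + Real.exp (-2*u))| ≤ 1 + 2*|u| := by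
  have h0 : 0 ≤ Real.log (1 + Real.exp (-2*u)) :=
    Real.log_nonneg (by linarith [Real.exp_pos (-2*u)])
  rw [abs_of_nonneg h0]
  have : 1 + Real.exp (-2*u) ≤ Real.exp (1 + 2*|u|) := by
    have h1 : Real.exp (-2*u) ≤ Real.exp (2*|u|) :=
      Real.exp_le_exp.2 (by linarith [neg_abs_le u])
    have h2 : 1 ≤ Real.exp (2*|u|) := Real.one_le_exp (by positivity)
    rw [Real.exp_add]
    nlinarith [Real.add_one_le_exp (1:ℝ)]
  calc _ ≤ Real.log (Real.exp (1 + 2*|u|)) := Real.log_le_log (by positivity) this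
    _ = _ := Real.log_exp _

lemma log2cosh_eq (u : ℝ) : Real.log (Real.exp u + Real.exp (-u)) =
    u + Real.log (1 + Real.exp (-2*u)) := by
  nth_rw 3 [← Real.log_exp u]
  rw [← Real.log_mul (Real.exp_pos _).ne' (by positivity), mul_add, ← Real.exp_add]
  ring_nf

lemma log1p_integrable (a σ : ℝ) :
    Integrable (fun z => Real.log (1 + Real.exp (-2*(a + σ*z)))) (gaussianReal 0 1) := by
  refine Integrable.mono' (g := fun z => 1 + 2*|a + σ*z|) ?_ ?_ ?_
  · exact (integrable_const _).add
      (((integrable_const _).add (g1_id_integrable.const_mul σ)).abs.const_mul 2)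
  · refine Continuous.aestronglyMeasurable ?_
    refine Continuous.log (by fun_prop) fun z => by positivity
  · exact ae_of_all _ fun z => log1p_exp_bd _

lemma log2cosh_integrable (a σ : ℝ) :
    Integrable (fun z => Real.log (Real.exp (a + σ*z) + Real.exp (-(a + σ*z))))
      (gaussianReal 0 1) := by
  simp_rw [log2cosh_eq]
  exact ((integrable_const _).add (g1_id_integrable.const_mul σ)).add (log1p_integrable a σ)

lemma T_bound {σ : ℝ} (hσ : 0 < σ) (h2 : 1 ≤ 2*σ^2) :
    ∫ z, Real.log (Real.exp (σ^2 + σ*z) + Real.exp (-(σ^2 + σ*z))) ∂(gaussianReal 0 1) ≤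
      σ^2 + (√(2*Real.pi))⁻¹ * (Real.exp (-σ^2/2) * (JJ (σ^2) / σ)) := by
  simp_rw [log2cosh_eq]
  have hI : Integrable (fun z => σ^2 + σ*z) (gaussianReal 0 1) :=
    (integrable_const _).add (g1_id_integrable.const_mul σ)
  rw [integral_add hI (log1p_integrable _ σ)]
  refine add_le_add (le_of_eq ?_) (T_raw hσ h2)
  rw [integral_add (integrable_const _) (g1_id_integrable.const_mul σ), integral_const_mul]
  simp [integral_id_gaussianReal]

lemma tail_prob {τ : ℝ} (hτ : 0 < τ) :
    ∫ z, (Set.Ioi τ).indicator (fun _ => (1:ℝ)) z ∂(gaussianReal 0 1) ≤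
      (√(2*Real.pi))⁻¹ * (Real.exp (-τ^2/2) * psiU τ) := by
  rw [g1_int]
  refine mul_le_mul_of_nonneg_left ?_ (by positivity)
  rw [← integral_add_right_eq_self _ τ]
  have e : ∀ x : ℝ, Real.exp (-(x+τ)^2/2) * (Set.Ioi τ).indicator (fun _ => (1:ℝ)) (x + τ) =
      (Set.Ioi (0:ℝ)).indicator (fun x => Real.exp (-τ^2/2) * Real.exp (-x^2/2 - τ*x)) x := by
    intro x
    by_cases hx : 0 < x
    · rw [Set.indicator_of_mem (by simpa using hx), Set.indicator_of_mem (by simpa using hx),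
        mul_one, ← Real.exp_add]
      ring_nf
    · rw [Set.indicator_of_notMem (by simpa using hx), Set.indicator_of_notMem (by simpa using hx),
        mul_zero]
  simp_rw [e]
  rw [integral_indicator measurableSet_Ioi, integral_const_mul]
  exact mul_le_mul_of_nonneg_left (tail_le hτ) (Real.exp_pos _).le

lemma tail_mean {τ : ℝ} (hτ : 0 < τ) :
    ∫ z, (Set.Ioi τ).indicator (fun z => z) z ∂(gaussianReal 0 1) =
      (√(2*Real.pi))⁻¹ * Real.exp (-τ^2/2) := by
  rw [g1_int]
  congr 1
  have e : ∀ x : ℝ, Real.exp (-x^2/2) * (Set.Ioi τ).indicator (fun z => z) x =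
      (Set.Ioi τ).indicator (fun x => Real.exp (-x^2/2) * x) x := by
    intro x
    by_cases hx : τ < x
    · rw [Set.indicator_of_mem (by simpa using hx), Set.indicator_of_mem (by simpa using hx)]
    · rw [Set.indicator_of_notMem (by simpa using hx), Set.indicator_of_notMem (by simpa using hx),
        mul_zero]
  simp_rw [e]
  rw [integral_indicator measurableSet_Ioi]
  have hd : ∀ x ∈ Set.Ici τ, HasDerivAt (fun x : ℝ => -Real.exp (-x^2/2)) (Real.exp (-x^2/2) * x) x := by
    intro x _
    have h1 : HasDerivAt (fun x : ℝ => -x^2/2) (-x) x := by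
      refine (((hasDerivAt_pow 2 x).neg).div_const 2).congr_deriv ?_
      simp; ring
    refine h1.exp.neg.congr_deriv ?_
    ring
  have hl : Filter.Tendsto (fun x : ℝ => -Real.exp (-x^2/2)) Filter.atTop (nhds 0) := by
    have := gw_tendsto 0 le_rfl (fun _ => 1) 1 (by simp)
    simpa using this.neg
  rw [integral_Ioi_of_hasDerivAt_of_nonneg' hd
    (fun x hx => mul_nonneg (Real.exp_pos _).le (hτ.trans hx).le) hl]
  simp


noncomputable def plW (β : ℝ) (n : ℕ) (x : Fin n → ℝ) (y : Fin n → ℝ) : ℝ :=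
  Real.exp (β^2 * n * (ov n x y)^4)

open Classical in
noncomputable def binS (n : ℕ) (x : Fin n → ℝ) (a b : ℝ) : Finset (Fin n → ℝ) :=
  (cubeF n).filter fun y => a ≤ ov n x y ∧ ov n x y ≤ b

lemma mem_binS {n : ℕ} {x y : Fin n → ℝ} {a b : ℝ} :
    y ∈ binS n x a b ↔ y ∈ cubeF n ∧ a ≤ ov n x y ∧ ov n x y ≤ b := by
  simp [binS]

lemma binS_sub {n : ℕ} {x : Fin n → ℝ} {a b : ℝ} : binS n x a b ⊆ cubeF n :=
  fun _ h => (mem_binS.1 h).1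

lemma quart_chord {B s a b m D : ℝ} (hB : 0 ≤ B) (ham : a ≤ m) (hmb : m ≤ b)
    (ha : B*a^4 - s*a ≤ D) (hb : B*b^4 - s*b ≤ D) : B*m^4 - s*m ≤ D := by
  have hc : ConvexOn ℝ Set.univ (fun m : ℝ => B*m^4 + (-s)*m) := by
    have h1 : ConvexOn ℝ Set.univ (fun m : ℝ => m^4) := Even.convexOn_pow (by decide)
    have h2 : ConvexOn ℝ Set.univ (fun m : ℝ => (-s)*m) :=
      ((LinearMap.mul ℝ ℝ (-s)).convexOn convex_univ)
    exact (h1.smul hB).add h2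
  have := hc.le_max_of_mem_Icc (Set.mem_univ a) (Set.mem_univ b) ⟨ham, hmb⟩
  have h3 : max (B*a^4 + (-s)*a) (B*b^4 + (-s)*b) ≤ D := max_le (by linarith) (by linarith)
  have h4 := this.trans h3
  linarith

lemma gauge_inner {n : ℕ} (hn : 0 < n) {x : Fin n → ℝ} (hx : x ∈ cubeF n) (s : ℝ)
    (y z : Fin n → ℝ) : lin (s • (x * y)) (s • (x * z)) = s^2 * (n * ov n y z) := by
  have hn' : (n:ℝ) ≠ 0 := by positivity
  rw [lin_smul_left, lin_smul_right, ov, mul_div_cancel₀ _ hn']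
  have : lin (x * y) (x * z) = ∑ i, y i * z i := by
    refine Finset.sum_congr rfl fun i _ => ?_
    have := cube_sq hx i
    simp only [Pi.mul_apply]
    linear_combination (y i * z i) * this
  rw [this]; ring

lemma sv_inner {p n : ℕ} (hn : 0 < n) (b : ℝ) (y z : Fin n → ℝ) :
    lin (b • pv p n y) (b • pv p n z) = b^2 * (n * (ov n y z)^p) := by
  rw [lin_smul_left, lin_smul_right, pv_inner hn]; ring

lemma bin_mean {n : ℕ} (hn : 0 < n) {x : Fin n → ℝ} (hx : x ∈ cubeF n)
    {β a b σ κ T D : ℝ} (H1 : ∀ R : ℝ, 0 ≤ β^2*R^4 - σ^2*R + κ)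
    (hT : ∫ z, Real.log (Real.exp (σ^2 + σ*z) + Real.exp (-(σ^2 + σ*z))) ∂(gaussianReal 0 1)
      ≤ σ^2 + T)
    (ha : β^2*a^4 - σ^2*a ≤ D) (hb : β^2*b^4 - σ^2*b ≤ D) (hS : (binS n x a b).Nonempty) :
    ∫ Y, LSE (binS n x a b) (plW β n x) (fun y => β • pv 4 n y) Y ∂(gG (Fin 4 → Fin n)) ≤
      n * (D + σ^2 + T + (β^2 - σ^2 + κ)/2) := by
  have hn' : (0:ℝ) < n := by exact_mod_cast hn
  have hc : ∀ y, 0 < plW β n x y := fun y => Real.exp_pos _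
  have hcmp := gauss_compare (binS n x a b) hS (plW β n x) hc (fun y => β • pv 4 n y)
    (fun y => σ • (x * y)) (n * ((β^2 - σ^2 + κ)/2)) (by
      intro y hy z hz
      simp only [sv_inner hn, gauge_inner hn hx, ov_self hn (binS_sub hy)]
      nlinarith [mul_nonneg hn'.le (H1 (ov n y z))])
  refine hcmp.trans ?_
  set f : ℝ → ℝ := fun z => Real.log (Real.exp (σ^2 + σ*z) + Real.exp (-(σ^2 + σ*z))) with hf
  have hfi := log2cosh_integrable (σ^2) σ
  have hfm : Measurable f := by
    refine Continuous.measurable ?_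
    exact Continuous.log (by fun_prop) fun z => by positivity
  have hsum : ∫ Y : Fin n → ℝ, (n * D + ∑ i, f (Y i)) ∂(gG (Fin n)) =
      n * D + n * ∫ z, f z ∂(gaussianReal 0 1) := by
    rw [integral_add (integrable_const _)
      (integrable_finsetSum _ fun i _ => gG_coord_integrable i f hfi),
      integral_finsetSum _ fun i _ => gG_coord_integrable i f hfi]
    simp [gG_coord_integral _ f hfm]
  have hle : ∫ Y, LSE (binS n x a b) (plW β n x) (fun y => σ • (x * y)) Y ∂(gG (Fin n)) ≤
      ∫ Y : Fin n → ℝ, (n * D + ∑ i, f (Y i)) ∂(gG (Fin n)) := by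
    refine integral_mono (LSE_integrable _ hS _ hc _) ((integrable_const _).add
      (integrable_finsetSum _ fun i _ => gG_coord_integrable i f hfi)) fun Y => ?_
    have hZ : Zf (binS n x a b) (plW β n x) (fun y => σ • (x * y)) Y ≤
        Real.exp (n * D) * ∏ i, (Real.exp (σ^2 + σ*Y i) + Real.exp (-(σ^2 + σ*Y i))) := by
      have e1 : ∏ i, (Real.exp (σ^2 + σ*Y i) + Real.exp (-(σ^2 + σ*Y i))) =
          ∏ i, (Real.exp ((σ^2 + σ*Y i) * x i) + Real.exp (-((σ^2 + σ*Y i) * x i))) := by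
        refine Finset.prod_congr rfl fun i _ => ?_
        rcases mem_cubeF.1 hx i with h | h <;> rw [h]
        · simp
        · simp [add_comm]
      rw [e1, ← cubeF_sum_exp, Finset.mul_sum]
      refine le_trans ?_ (Finset.sum_le_sum_of_subset_of_nonneg
        (binS_sub (x := x) (a := a) (b := b))
        fun _ _ _ => by positivity)
      refine Finset.sum_le_sum fun y hy => ?_
      obtain ⟨hy0, hya, hyb⟩ := mem_binS.1 hy
      rw [plW, ← Real.exp_add, ← Real.exp_add]
      refine Real.exp_le_exp.2 ?_
      have hq := quart_chord (sq_nonneg β) hya hyb ha hb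
      have e2 : ∑ i, (σ^2 + σ*Y i) * x i * y i = σ^2 * (n * ov n x y) + lin (σ • (x * y)) Y := by
        have : (n:ℝ) * ov n x y = ∑ i, x i * y i := by
          rw [ov, mul_div_cancel₀ _ hn'.ne']
        rw [this, lin, Finset.mul_sum, ← Finset.sum_add_distrib]
        refine Finset.sum_congr rfl fun i _ => ?_
        simp only [Pi.smul_apply, Pi.mul_apply, smul_eq_mul]
        ring
      rw [e2]
      nlinarith [mul_le_mul_of_nonneg_left hq hn'.le]
    have := Real.log_le_log (Zf_pos _ hS _ hc _ Y) hZ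
    rw [Real.log_mul (Real.exp_pos _).ne' (Finset.prod_ne_zero_iff.2 fun i _ => by positivity),
      Real.log_exp, Real.log_prod fun i _ => by positivity] at this
    exact this
  rw [hsum] at hle
  have := mul_le_mul_of_nonneg_left hT hn'.le
  linarith

lemma bin_prob {n : ℕ} (hn : 0 < n) {x : Fin n → ℝ} (hx : x ∈ cubeF n)
    {β a b σ κ T D δ : ℝ} (H1 : ∀ R : ℝ, 0 ≤ β^2*R^4 - σ^2*R + κ)
    (hT : ∫ z, Real.log (Real.exp (σ^2 + σ*z) + Real.exp (-(σ^2 + σ*z))) ∂(gaussianReal 0 1)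
      ≤ σ^2 + T)
    (ha : β^2*a^4 - σ^2*a ≤ D) (hb : β^2*b^4 - σ^2*b ≤ D) (hδ : 0 < δ)
    (hD : D + T + (κ + σ^2)/2 + 2*δ ≤ Real.log 2) :
    (gG (Fin 4 → Fin n)).real {Y | Real.exp (n * (Real.log 2 + β^2/2 - δ)) ≤
      Zf (binS n x a b) (plW β n x) (fun y => β • pv 4 n y) Y} ≤ β^2 / (δ^2 * n) := by
  have hn' : (0:ℝ) < n := by exact_mod_cast hn
  have hc : ∀ y, 0 < plW β n x y := fun y => Real.exp_pos _
  by_cases hS : (binS n x a b).Nonempty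
  · have hm := bin_mean hn hx H1 hT ha hb hS
    have h := prob_ge_le _ _ (pLSE_lip (p := 4) β (binS n x a b) hS binS_sub (plW β n x) hc)
      (β^2 * n) (n * (Real.log 2 + β^2/2 - δ)) (n * δ) (pv_K_sum hn β).le (by positivity)
      (by nlinarith [mul_le_mul_of_nonneg_left hD hn'.le])
    have e : β^2 * n / (n * δ)^2 = β^2 / (δ^2 * n) := by
      field_simp
    rw [e] at h
    refine le_trans (measureReal_mono fun Y hY => ?_) h
    have hY' : Real.exp (n * (Real.log 2 + β^2/2 - δ)) ≤ _ := hY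
    exact (Real.le_log_iff_exp_le (Zf_pos _ hS _ hc _ Y)).2 hY'
  · rw [Finset.not_nonempty_iff_eq_empty.1 hS]
    have : {Y : (Fin 4 → Fin n) → ℝ | Real.exp (n * (Real.log 2 + β^2/2 - δ)) ≤
      Zf ∅ (plW β n x) (fun y => β • pv 4 n y) Y} = ∅ := by
      ext Y
      simp [Zf, Real.exp_pos]
    rw [this]
    simp
    positivity


noncomputable def bet : ℝ := 571/500

lemma exp_neg_le {x E : ℝ} (hx : 0 ≤ x) (hE : 0 < E) (k : ℕ)
    (h : E⁻¹ ≤ ∑ i ∈ Finset.range k, x ^ i / (i.factorial : ℝ)) : Real.exp (-x) ≤ E := by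
  rw [Real.exp_neg]
  exact inv_le_of_inv_le₀ hE (h.trans (Real.sum_le_exp_of_nonneg hx k))

lemma inv_sqrt_2pi_le : (√(2*Real.pi))⁻¹ ≤ 1/2.5066 := by
  rw [one_div]
  refine inv_anti₀ (by norm_num) ?_
  refine Real.le_sqrt_of_sq_le ?_
  nlinarith [Real.pi_gt_d6]

lemma T_num {σ E T : ℝ} (hσ : 0 < σ) (h2 : 1 ≤ 2*σ^2) (hJ : 0 ≤ JJ (σ^2)) (hE : 0 < E)
    (h : E⁻¹ ≤ ∑ i ∈ Finset.range 16, (σ^2/2) ^ i / (i.factorial : ℝ))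
    (hT : 1/2.5066 * (E * (JJ (σ^2)/σ)) ≤ T) :
    ∫ z, Real.log (Real.exp (σ^2 + σ*z) + Real.exp (-(σ^2 + σ*z))) ∂(gaussianReal 0 1) ≤
      σ^2 + T := by
  refine (T_bound hσ h2).trans ?_
  have h1 : Real.exp (-σ^2/2) ≤ E := by
    rw [neg_div]
    exact exp_neg_le (by positivity) hE 16 h
  have : 0 ≤ JJ (σ^2)/σ := by positivity
  have : (√(2*Real.pi))⁻¹ * (Real.exp (-σ^2/2) * (JJ (σ^2) / σ)) ≤
      1/2.5066 * (E * (JJ (σ^2)/σ)) := by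
    gcongr
    exact inv_sqrt_2pi_le
  linarith

lemma H1_num {σ q r κ : ℝ} (hr : bet^2 * (4*q^2*r) = σ^2) (hk : bet^2*(q^4 + 2*q^2*r^2) ≤ κ) (R : ℝ) :
    0 ≤ bet^2*R^4 - σ^2*R + κ := by
  have h1 : 0 ≤ bet^2*((R^2-q^2)^2 + 2*q^2*(R-r)^2) := by positivity
  rw [← hr]
  nlinarith

/-- bins -/
noncomputable def binEnd : Fin 6 → ℝ := ![0.6, 0.78, 0.88, 0.93, 0.965, 1]

lemma bins_ok {n : ℕ} (hn : 0 < n) {x : Fin n → ℝ} (hx : x ∈ cubeF n) (k : Fin 5) :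
    (gG (Fin 4 → Fin n)).real {Y | Real.exp (n * (Real.log 2 + bet^2/2 - 1/5000)) ≤
      Zf (binS n x (binEnd k.castSucc) (binEnd k.succ)) (plW bet n x)
        (fun y => bet • pv 4 n y) Y} ≤ bet^2 / ((1/5000)^2 * n) := by
  have hlog := Real.log_two_gt_d9
  have e2 : (![3/5, 39/50, 22/25, 93/100, 193/200, 1] : Fin 6 → ℝ) 2 = 22/25 := rfl
  fin_cases k
  · refine bin_prob hn hx (σ := 1.32) (κ := 0.90672) (T := 0.23132) (D := -0.87633)
      (H1_num (q := 0.6938) (r := 1.32^2/(bet^2*(4*0.6938^2))) ?_ ?_)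
      (T_num (E := 0.41845) ?_ ?_ ?_ ?_ ?_ ?_) ?_ ?_ ?_ ?_ <;>
    norm_num [bet, JJ, binEnd, e2, Finset.sum_range_succ, Nat.factorial] at hlog ⊢ <;> linarith
  · refine bin_prob hn hx (σ := 1.73) (κ := 1.86520) (T := 0.10956) (D := -1.8516)
      (H1_num (q := 0.8309) (r := 1.73^2/(bet^2*(4*0.8309^2))) ?_ ?_)
      (T_num (E := 0.22393) ?_ ?_ ?_ ?_ ?_ ?_) ?_ ?_ ?_ ?_ <;>
    norm_num [bet, JJ, binEnd, e2, Finset.sum_range_succ, Nat.factorial] at hlog ⊢ <;> linarith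
  · refine bin_prob hn hx (σ := 1.97) (κ := 2.63740) (T := 0.06562) (D := -2.63309)
      (H1_num (q := 0.9061) (r := 1.97^2/(bet^2*(4*0.9061^2))) ?_ ?_)
      (T_num (E := 0.14364) ?_ ?_ ?_ ?_ ?_ ?_) ?_ ?_ ?_ ?_ <;>
    norm_num [bet, JJ, binEnd, e2, Finset.sum_range_succ, Nat.factorial] at hlog ⊢ <;> linarith
  · refine bin_prob hn hx (σ := 2.11) (κ := 3.16728) (T := 0.04744) (D := -3.16487)
      (H1_num (q := 0.9485) (r := 2.11^2/(bet^2*(4*0.9485^2))) ?_ ?_)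
      (T_num (E := 0.10796) ?_ ?_ ?_ ?_ ?_ ?_) ?_ ?_ ?_ ?_ <;>
    norm_num [bet, JJ, binEnd, e2, Finset.sum_range_succ, Nat.factorial] at hlog ⊢ <;> linarith
  · refine bin_prob hn hx (σ := 2.23) (κ := 3.67067) (T := 0.03539) (D := -3.66790)
      (H1_num (q := 0.9842) (r := 2.23^2/(bet^2*(4*0.9842^2))) ?_ ?_)
      (T_num (E := 0.08321) ?_ ?_ ?_ ?_ ?_ ?_) ?_ ?_ ?_ ?_ <;>
    norm_num [bet, JJ, binEnd, e2, Finset.sum_range_succ, Nat.factorial] at hlog ⊢ <;> linarith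


lemma exp_sq_integrable {l : ℝ} (hl : l < 1/2) :
    Integrable (fun z : ℝ => Real.exp (l * z^2)) (gaussianReal 0 1) := by
  rw [gaussianReal_of_var_ne_zero _ one_ne_zero]
  rw [integrable_withDensity_iff_integrable_smul' (measurable_gaussianPDF 0 1)
    (ae_of_all _ fun _ => gaussianPDF_lt_top)]
  have h := (integrable_exp_neg_mul_sq (b := 1/2 - l) (by linarith)).const_mul ((√(2*Real.pi))⁻¹)
  refine h.congr (ae_of_all _ fun z => ?_)
  simp only [toReal_gaussianPDF, gaussianPDFReal, smul_eq_mul]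
  rw [mul_assoc, ← Real.exp_add]
  simp
  left; ring

lemma g1_mgf (t : ℝ) : ∫ z, Real.exp (t * z) ∂(gaussianReal 0 1) = Real.exp (t^2/2) := by
  have := mgf_gaussianReal (p := gaussianReal 0 1) (X := id) (μ := 0) (v := 1)
    (by simp) t
  simpa [mgf] using this

lemma g1_exp_integrable (t : ℝ) : Integrable (fun z => Real.exp (t * z)) (gaussianReal 0 1) :=
  integrable_exp_mul_gaussianReal t

lemma HS {n : ℕ} (hn : 0 < n) {x : Fin n → ℝ} (hx : x ∈ cubeF n) {l : ℝ} (hl0 : 0 ≤ l)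
    (hl : l < 1/2) : ∑ y ∈ cubeF n, Real.exp (l * n * (ov n x y)^2) ≤
      2^n * ∫ z, Real.exp (l * z^2) ∂(gaussianReal 0 1) := by
  have hn' : (0:ℝ) < n := by exact_mod_cast hn
  set r := √(2*l/n) with hr
  have hr2 : r^2 = 2*l/n := Real.sq_sqrt (by positivity)
  have e1 : ∀ y, Real.exp (l * n * (ov n x y)^2) =
      ∫ z, Real.exp ((r * ∑ i, x i * y i) * z) ∂(gaussianReal 0 1) := by
    intro y
    rw [g1_mgf, mul_pow, hr2, ov]
    congr 1; field_simp
  simp_rw [e1]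
  rw [← integral_finsetSum _ fun y _ => g1_exp_integrable _, ← integral_const_mul]
  refine integral_mono (integrable_finsetSum _ fun y _ => g1_exp_integrable _)
    ((exp_sq_integrable hl).const_mul _) fun z => ?_
  have e2 : ∀ y : Fin n → ℝ, (r * ∑ i, x i * y i) * z = ∑ i, (r * z * x i) * y i := by
    intro y
    rw [Finset.mul_sum, Finset.sum_mul]
    exact Finset.sum_congr rfl fun i _ => by ring
  simp only [e2]
  rw [cubeF_sum_exp]
  have e3 : ∀ i ∈ Finset.univ, Real.exp (r * z * x i) + Real.exp (-(r * z * x i)) ≤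
      2 * Real.exp ((r*z)^2/2) := by
    intro i _
    have h := Real.cosh_le_exp_half_sq (r * z * x i)
    rw [Real.cosh_eq, mul_pow (r*z), pow_two (x i), cube_sq hx, mul_one] at h
    linarith
  refine (Finset.prod_le_prod (fun i _ => by positivity) e3).trans (le_of_eq ?_)
  rw [Finset.prod_const, Finset.card_univ, Fintype.card_fin, mul_pow, ← Real.exp_nat_mul,
    mul_pow, hr2]
  congr 2; field_simp

lemma Zf_integral {n : ℕ} (hn : 0 < n) (p : ℕ) (β : ℝ) (S : Finset (Fin n → ℝ)) (hS : S ⊆ cubeF n)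
    (c : (Fin n → ℝ) → ℝ) :
    Integrable (Zf S c (fun y => β • pv p n y)) (gG (Fin p → Fin n)) ∧
    ∫ Y, Zf S c (fun y => β • pv p n y) Y ∂(gG (Fin p → Fin n)) =
      (∑ y ∈ S, c y) * Real.exp (n * β^2/2) := by
  unfold Zf
  refine ⟨integrable_finsetSum _ fun y _ => (gG_exp_integrable _).const_mul _, ?_⟩
  rw [integral_finsetSum _ fun y _ => (gG_exp_integrable _).const_mul _, Finset.sum_mul]
  refine Finset.sum_congr rfl fun y hy => ?_
  rw [integral_const_mul, gG_mgf, sv_inner hn, ov_self hn (hS hy)]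
  congr 2; ring

lemma low_prob {n : ℕ} (hn : 0 < n) {x : Fin n → ℝ} (hx : x ∈ cubeF n) {C : ℝ} (hC : 0 < C) :
    (gG (Fin 4 → Fin n)).real {Y | C * Real.exp (n * (Real.log 2 + bet^2/2)) ≤
      Zf (binS n x (-0.6) 0.6) (plW bet n x) (fun y => bet • pv 4 n y) Y} ≤
      (∫ z, Real.exp (0.47 * z^2) ∂(gaussianReal 0 1)) / C := by
  have hn' : (0:ℝ) < n := by exact_mod_cast hn
  obtain ⟨hi, he⟩ := Zf_integral hn 4 bet (binS n x (-0.6) 0.6) binS_sub (plW bet n x)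
  have hm := mul_meas_ge_le_integral_of_nonneg (μ := gG (Fin 4 → Fin n))
    (f := Zf (binS n x (-0.6) 0.6) (plW bet n x) (fun y => bet • pv 4 n y))
    (ae_of_all _ fun Y => Finset.sum_nonneg fun y _ =>
      mul_nonneg (Real.exp_pos (bet^2 * n * (ov n x y)^4)).le (Real.exp_pos _).le) hi
      (C * Real.exp (n * (Real.log 2 + bet^2/2)))
  have hE : Real.exp (n * (Real.log 2 + bet^2/2)) = 2^n * Real.exp (n * bet^2/2) := by
    rw [mul_add, Real.exp_add, ← Real.log_pow, Real.exp_log (by positivity)]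
    congr 2; ring
  have hsum : ∑ y ∈ binS n x (-0.6) 0.6, plW bet n x y ≤
      2^n * ∫ z, Real.exp (0.47 * z^2) ∂(gaussianReal 0 1) := by
    refine le_trans ?_ (HS hn hx (by norm_num) (by norm_num))
    refine le_trans ?_ (Finset.sum_le_sum_of_subset_of_nonneg
      (binS_sub (x := x) (a := -0.6) (b := 0.6)) fun _ _ _ => by positivity)
    refine Finset.sum_le_sum fun y hy => Real.exp_le_exp.2 ?_
    obtain ⟨_, h1, h2⟩ := mem_binS.1 hy
    have hm2 : (ov n x y)^2 ≤ 0.36 := by nlinarith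
    have : bet^2 * (ov n x y)^4 ≤ 0.47 * (ov n x y)^2 := by
      unfold bet; nlinarith [sq_nonneg (ov n x y)]
    nlinarith
  rw [he, hE] at hm
  rw [le_div_iff₀ hC, hE]
  have hP : 0 < 2^n * Real.exp (n * bet^2/2) := by positivity
  have h3 : (∑ y ∈ binS n x (-0.6) 0.6, plW bet n x y) * Real.exp (n * bet^2/2) ≤
      (2^n * ∫ z, Real.exp (0.47 * z^2) ∂(gaussianReal 0 1)) * Real.exp (n * bet^2/2) := by
    gcongr
  rw [← mul_le_mul_iff_right₀ hP]
  have h4 := hm.trans h3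
  nlinarith [h4]

lemma ov_neg (n : ℕ) (x y : Fin n → ℝ) : ov n (-x) y = - ov n x y := by
  simp [ov, neg_div]

lemma neg_mem_cubeF {n : ℕ} {x : Fin n → ℝ} (hx : x ∈ cubeF n) : -x ∈ cubeF n := by
  rw [mem_cubeF] at *
  intro i
  rcases hx i with h | h <;> simp [h]

lemma plW_neg (β : ℝ) (n : ℕ) (x : Fin n → ℝ) : plW β n (-x) = plW β n x := by
  ext y
  rw [plW, plW, ov_neg, Even.neg_pow (by decide)]

lemma sum_cover {α K : Type*} (S : Finset α) (I : Finset K) (T : K → Finset α) (f : α → ℝ)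
    (hf : ∀ y, 0 ≤ f y) (h : ∀ y ∈ S, ∃ k ∈ I, y ∈ T k) :
    ∑ y ∈ S, f y ≤ ∑ k ∈ I, ∑ y ∈ T k, f y := by
  classical
  have h1 : ∀ k ∈ I, ∑ y ∈ S, (if y ∈ T k then f y else 0) ≤ ∑ y ∈ T k, f y := by
    intro k _
    rw [← Finset.sum_filter]
    exact Finset.sum_le_sum_of_subset_of_nonneg (fun y hy => (Finset.mem_filter.1 hy).2)
      fun _ _ _ => hf _
  refine le_trans ?_ (Finset.sum_le_sum h1)
  rw [Finset.sum_comm]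
  refine Finset.sum_le_sum fun y hy => ?_
  obtain ⟨k, hk, hky⟩ := h y hy
  refine le_trans (le_of_eq ?_) (Finset.single_le_sum (f := fun k => if y ∈ T k then f y else 0)
    (fun k _ => by split_ifs <;> simp [hf]) hk)
  simp [hky]

lemma bin_cover {m : ℝ} (h1 : 0.6 ≤ m) (h2 : m ≤ 1) :
    ∃ k : Fin 5, binEnd k.castSucc ≤ m ∧ m ≤ binEnd k.succ := by
  by_cases a : m ≤ 0.78
  · exact ⟨0, h1, a⟩
  by_cases b : m ≤ 0.88
  · exact ⟨1, (not_le.1 a).le, b⟩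
  by_cases c : m ≤ 0.93
  · exact ⟨2, (not_le.1 b).le, c⟩
  by_cases d : m ≤ 0.965
  · exact ⟨3, (not_le.1 c).le, d⟩
  exact ⟨4, (not_le.1 d).le, h2⟩

/-- the planted partition function is not too large -/
lemma planted_Z : ∃ C > (0:ℝ), ∃ N : ℕ, ∀ n ≥ N, 0 < n → ∀ x ∈ cubeF n,
    (gG (Fin 4 → Fin n)).real {Y | C * Real.exp (n * (Real.log 2 + bet^2/2)) <
      Zf (cubeF n) (plW bet n x) (fun y => bet • pv 4 n y) Y} ≤ 1/4 := by
  set I0 := ∫ z, Real.exp (0.47 * z^2) ∂(gaussianReal 0 1) with hI0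
  have hI0p : 0 ≤ I0 := integral_nonneg fun _ => (Real.exp_pos _).le
  refine ⟨8 * (I0 + 1) + 10, by positivity, ⌈8 * 10 * (bet^2 / (1/5000)^2)⌉₊, ?_⟩
  intro n hN hn x hx
  have hn' : (0:ℝ) < n := by exact_mod_cast hn
  set U := Real.exp (n * (Real.log 2 + bet^2/2)) with hU
  have hUp : 0 < U := Real.exp_pos _
  set T : Option (Fin 5 × Bool) → Finset (Fin n → ℝ) := fun o => match o with
    | none => binS n x (-0.6) 0.6
    | some (k, true) => binS n x (binEnd k.castSucc) (binEnd k.succ)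
    | some (k, false) => binS n (-x) (binEnd k.castSucc) (binEnd k.succ) with hT
  set th : Option (Fin 5 × Bool) → ℝ := fun o => match o with
    | none => 8 * (I0 + 1) * U
    | some _ => U with hth
  set v := (fun y : Fin n → ℝ => bet • pv 4 n y)
  set B : Option (Fin 5 × Bool) → Set ((Fin 4 → Fin n) → ℝ) :=
    fun o => {Y | th o ≤ Zf (T o) (plW bet n x) v Y} with hB
  have hsub : {Y | (8 * (I0 + 1) + 10) * U < Zf (cubeF n) (plW bet n x) v Y} ⊆
      ⋃ o, B o := by
    intro Y hY
    by_contra hcon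
    simp only [Set.mem_iUnion, not_exists, hB, Set.mem_ofPred_eq, not_le] at hcon
    have h1 := sum_cover (cubeF n) Finset.univ T (fun y => plW bet n x y * Real.exp (lin (v y) Y))
      (fun y => mul_nonneg (Real.exp_pos _).le (Real.exp_pos _).le) (by
        intro y hy
        have hab := abs_le.1 (ov_abs_le hx hy)
        by_cases h1 : 0.6 ≤ ov n x y
        · obtain ⟨k, hk1, hk2⟩ := bin_cover h1 hab.2
          exact ⟨some (k, true), Finset.mem_univ _, mem_binS.2 ⟨hy, hk1, hk2⟩⟩
        · by_cases h2 : 0.6 ≤ ov n (-x) y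
          · obtain ⟨k, hk1, hk2⟩ := bin_cover h2 (by rw [ov_neg]; linarith)
            exact ⟨some (k, false), Finset.mem_univ _, mem_binS.2 ⟨hy, hk1, hk2⟩⟩
          · rw [ov_neg] at h2
            exact ⟨none, Finset.mem_univ _, mem_binS.2 ⟨hy, by linarith, by linarith⟩⟩)
    have h2 : ∑ o, Zf (T o) (plW bet n x) v Y ≤ ∑ o, th o :=
      Finset.sum_le_sum fun o _ => (hcon o).le
    have h3 : ∑ o, th o = (8 * (I0 + 1) + 10) * U := by
      rw [Fintype.sum_option]
      simp only [hth]
      simp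
      ring
    have h4 : (8 * (I0 + 1) + 10) * U < Zf (cubeF n) (plW bet n x) v Y := hY
    have h5 : Zf (cubeF n) (plW bet n x) v Y ≤ ∑ o, Zf (T o) (plW bet n x) v Y := h1
    linarith
  have hlow : (gG (Fin 4 → Fin n)).real (B none) ≤ 1/8 := by
    have := low_prob hn hx (C := 8 * (I0 + 1)) (by positivity)
    refine this.trans ?_
    rw [← hI0, div_le_div_iff₀ (by positivity) (by norm_num)]
    linarith
  have hbin : ∀ kb, (gG (Fin 4 → Fin n)).real (B (some kb)) ≤ 1/80 := by
    have hle : Real.exp (n * (Real.log 2 + bet^2/2 - 1/5000)) ≤ U := by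
      refine Real.exp_le_exp.2 ?_
      nlinarith
    have hfin : bet^2 / ((1/5000)^2 * n) ≤ 1/80 := by
      have h1 : 8 * 10 * (bet^2 / (1/5000)^2) ≤ (n:ℝ) :=
        (Nat.le_ceil _).trans (by exact_mod_cast hN)
      rw [← div_div, div_le_iff₀ hn']
      linarith
    rintro ⟨k, b⟩
    cases b
    · refine le_trans (measureReal_mono fun Y hY => ?_)
        ((bins_ok hn (neg_mem_cubeF hx) k).trans hfin)
      rw [plW_neg]
      exact hle.trans hY
    · refine le_trans (measureReal_mono fun Y hY => ?_) ((bins_ok hn hx k).trans hfin)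
      exact hle.trans hY
  refine (measureReal_mono hsub).trans ((measureReal_iUnion_fintype_le _).trans ?_)
  rw [Fintype.sum_option]
  have : ∑ kb, (gG (Fin 4 → Fin n)).real (B (some kb)) ≤ ∑ _kb : Fin 5 × Bool, (1/80 : ℝ) :=
    Finset.sum_le_sum fun kb _ => hbin kb
  simp at this
  linarith


lemma iid_cheb (f : ℝ → ℝ) (hm : Measurable f) (hf : MemLp f 2 (gaussianReal 0 1)) (n : ℕ) (hn : 0 < n) (t : ℝ)
    (ht : 0 < t) :
    (gG (Fin n)).real {z | t * n ≤ |∑ i, f (z i) - n * ∫ s, f s ∂(gaussianReal 0 1)|} ≤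
      Var[f; gaussianReal 0 1] / (t^2 * n) := by
  have hn' : (0:ℝ) < n := by exact_mod_cast hn
  have hmem : ∀ i : Fin n, MemLp (fun z : Fin n → ℝ => f (z i)) 2 (gG (Fin n)) := fun i =>
    hf.comp_measurePreserving (measurePreserving_eval (μ := fun _ : Fin n => gaussianReal 0 1) i)
  have hsum : MemLp (fun z : Fin n → ℝ => ∑ i, f (z i)) 2 (gG (Fin n)) :=
    memLp_finsetSum Finset.univ fun i _ => hmem i
  have h1 := meas_ge_le_variance_div_sq hsum (mul_pos ht hn')
  have e1 : ∫ z, ∑ i, f (z i) ∂(gG (Fin n)) = n * ∫ s, f s ∂(gaussianReal 0 1) := by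
    rw [integral_finsetSum _ fun i _ => (hmem i).integrable (by norm_num)]
    simp [gG_coord_integral _ f hm]
  have e2 : Var[fun z : Fin n → ℝ => ∑ i, f (z i); gG (Fin n)] = n * Var[f; gaussianReal 0 1] := by
    have := variance_sum_pi (μ := fun _ : Fin n => gaussianReal 0 1) (X := fun _ => f) (fun _ => hf)
    simp at this
    rw [← this]
    congr 1
    ext z; simp
  rw [e1, e2] at h1
  rw [Measure.real]
  refine ENNReal.toReal_le_of_le_ofReal ?_ (h1.trans (ENNReal.ofReal_le_ofReal ?_))
  · have := variance_nonneg f (gaussianReal 0 1)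
    positivity
  · apply le_of_eq; field_simp

lemma sqrt_2pi_ge : 1/2.50663 ≤ (√(2*Real.pi))⁻¹ := by
  rw [one_div]
  refine inv_anti₀ (by positivity) ?_
  refine Real.sqrt_le_iff.2 ⟨by norm_num, ?_⟩
  nlinarith [Real.pi_lt_d6]

lemma phi_lb : 0.02832 ≤ (√(2*Real.pi))⁻¹ * Real.exp (-2.3^2/2) := by
  have h1 : Real.exp 0.529 ≤ 1.69724 := by
    refine (Real.exp_bound' (x := 0.529) (by norm_num) (by norm_num) (n := 8) (by norm_num)).trans ?_
    norm_num [Finset.sum_range_succ, Nat.factorial]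
  have h2 : Real.exp 2.645 ≤ 14.085 := by
    have : (2.645:ℝ) = (5:ℕ) * 0.529 := by norm_num
    rw [this, Real.exp_nat_mul]
    calc Real.exp 0.529 ^ 5 ≤ 1.69724 ^ 5 := by gcongr
      _ ≤ _ := by norm_num
  have h3 : 1/14.085 ≤ Real.exp (-2.3^2/2) := by
    have : (-2.3^2/2:ℝ) = -2.645 := by norm_num
    rw [this, Real.exp_neg, one_div]
    exact inv_anti₀ (Real.exp_pos _) h2
  calc (0.02832:ℝ) ≤ 1/2.50663 * (1/14.085) := by norm_num
    _ ≤ _ := mul_le_mul sqrt_2pi_ge h3 (by norm_num) (by positivity)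

lemma tp_ub : ∫ z, (Set.Ioi (2.3:ℝ)).indicator (fun _ => (1:ℝ)) z ∂(gaussianReal 0 1) ≤ 0.01084 := by
  refine (tail_prob (by norm_num)).trans ?_
  have h3 : Real.exp (-2.3^2/2) ≤ 0.07101 := by
    have : (-2.3^2/2:ℝ) = -2.645 := by norm_num
    rw [this]
    refine exp_neg_le (by norm_num) (by norm_num) 16 ?_
    norm_num [Finset.sum_range_succ, Nat.factorial]
  have h4 : psiU 2.3 ≤ 0.38235 := by unfold psiU; norm_num
  have h5 : 0 ≤ psiU 2.3 := by unfold psiU; norm_num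
  refine le_trans (b := 1/2.5066 * (0.07101 * 0.38235)) ?_ (by norm_num)
  refine mul_le_mul inv_sqrt_2pi_le (mul_le_mul h3 h4 h5 (by norm_num)) ?_ (by norm_num)
  positivity

noncomputable def fN (z : ℝ) : ℝ := (Set.Ioi (2.3:ℝ)).indicator (fun _ => (1:ℝ)) z
noncomputable def fW (z : ℝ) : ℝ := -z + 2 * (Set.Ioi (2.3:ℝ)).indicator (fun z => z) z

lemma fN_meas : Measurable fN := measurable_const.indicator measurableSet_Ioi
lemma fN_memLp : MemLp fN 2 (gaussianReal 0 1) := (memLp_const (1:ℝ)).indicator measurableSet_Ioi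
lemma id_memLp2 : MemLp (fun z : ℝ => z) 2 (gaussianReal 0 1) := memLp_id_gaussianReal' 2 (by simp)
lemma fW_meas : Measurable fW :=
  measurable_id.neg.add ((measurable_id.indicator measurableSet_Ioi).const_mul 2)
lemma fW_memLp : MemLp fW 2 (gaussianReal 0 1) :=
  id_memLp2.neg.add ((id_memLp2.indicator measurableSet_Ioi).const_mul 2)

lemma fW_mean : 0.05664 ≤ ∫ z, fW z ∂(gaussianReal 0 1) := by
  unfold fW
  have hi := id_memLp2.integrable (by norm_num)
  rw [integral_add (f := fun z : ℝ => -z) hi.neg ((hi.indicator measurableSet_Ioi).const_mul 2),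
    integral_neg, integral_const_mul, tail_mean (by norm_num)]
  have := phi_lb
  have e : ∫ z : ℝ, z ∂(gaussianReal 0 1) = 0 := integral_id_gaussianReal
  rw [e]; linarith

lemma fNW_prob : ∃ N : ℕ, ∀ n ≥ N, 0 < n → 1/2 ≤ (gG (Fin n)).real
    {z | ∑ i, fN (z i) ≤ 0.01085 * n ∧ 0.05662 * n ≤ ∑ i, fW (z i)} := by
  obtain ⟨N, hN⟩ := exists_nat_ge (4 * Var[fN; gaussianReal 0 1] / 0.00001^2 + 4 * Var[fW; gaussianReal 0 1] / 0.00002^2)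
  refine ⟨N, fun n hnN hn => ?_⟩
  have hn' : (0:ℝ) < n := by exact_mod_cast hn
  have hv1 := variance_nonneg fN (gaussianReal 0 1)
  have hv2 := variance_nonneg fW (gaussianReal 0 1)
  have hNn : (N:ℝ) ≤ n := by exact_mod_cast hnN
  have h1 := iid_cheb fN fN_meas fN_memLp n hn 0.00001 (by norm_num)
  have h2 := iid_cheb fW fW_meas fW_memLp n hn 0.00002 (by norm_num)
  have h1' : Var[fN; gaussianReal 0 1] / (0.00001^2 * n) ≤ 1/4 := by
    rw [div_le_iff₀ (by positivity)]
    have : 4 * Var[fN; gaussianReal 0 1] / 0.00001^2 ≤ n := by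
      have : 0 ≤ 4 * Var[fW; gaussianReal 0 1] / 0.00002^2 := by positivity
      linarith
    rw [div_le_iff₀ (by norm_num)] at this
    linarith
  have h2' : Var[fW; gaussianReal 0 1] / (0.00002^2 * n) ≤ 1/4 := by
    rw [div_le_iff₀ (by positivity)]
    have : 4 * Var[fW; gaussianReal 0 1] / 0.00002^2 ≤ n := by
      have : 0 ≤ 4 * Var[fN; gaussianReal 0 1] / 0.00001^2 := by positivity
      linarith
    rw [div_le_iff₀ (by norm_num)] at this
    linarith
  set G := {z : Fin n → ℝ | ∑ i, fN (z i) ≤ 0.01085 * n ∧ 0.05662 * n ≤ ∑ i, fW (z i)}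
  set B1 := {z : Fin n → ℝ | 0.00001 * n ≤ |∑ i, fN (z i) - n * ∫ s, fN s ∂(gaussianReal 0 1)|}
  set B2 := {z : Fin n → ℝ | 0.00002 * n ≤ |∑ i, fW (z i) - n * ∫ s, fW s ∂(gaussianReal 0 1)|}
  have hcov : (Set.univ : Set (Fin n → ℝ)) ⊆ G ∪ (B1 ∪ B2) := by
    intro z _
    by_cases hb1 : z ∈ B1
    · exact Or.inr (Or.inl hb1)
    by_cases hb2 : z ∈ B2
    · exact Or.inr (Or.inr hb2)
    left
    simp only [B1, B2, Set.mem_ofPred_eq, not_le] at hb1 hb2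
    have q1 := (abs_lt.1 hb1).2
    have q2 := (abs_lt.1 hb2).1
    have m1 := mul_le_mul_of_nonneg_left tp_ub hn'.le
    have m2 := mul_le_mul_of_nonneg_left fW_mean hn'.le
    have m1' : n * ∫ s, fN s ∂(gaussianReal 0 1) ≤ n * 0.01084 := m1
    constructor <;> linarith
  have h3 : (1:ℝ) ≤ (gG (Fin n)).real G + ((gG (Fin n)).real B1 + (gG (Fin n)).real B2) := by
    calc (1:ℝ) = (gG (Fin n)).real Set.univ := by simp
      _ ≤ _ := measureReal_mono hcov
      _ ≤ _ := (measureReal_union_le _ _).trans (by gcongr; exact measureReal_union_le _ _)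
  linarith


lemma ov_tri {n : ℕ} (hn : 0 < n) {x y z : Fin n → ℝ} (hx : x ∈ cubeF n) (hy : y ∈ cubeF n)
    (hz : z ∈ cubeF n) : ov n x y + ov n x z - 1 ≤ ov n y z := by
  have hn' : (0:ℝ) < n := by exact_mod_cast hn
  have h : ∑ i, (x i * y i + x i * z i - 1) ≤ ∑ i, y i * z i := by
    refine Finset.sum_le_sum fun i _ => ?_
    rcases mem_cubeF.1 hx i with h1 | h1 <;> rcases mem_cubeF.1 hy i with h2 | h2 <;>
      rcases mem_cubeF.1 hz i with h3 | h3 <;> rw [h1, h2, h3] <;> norm_num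
  rw [Finset.sum_sub_distrib, Finset.sum_add_distrib] at h
  simp only [Finset.sum_const, Finset.card_univ, Fintype.card_fin, nsmul_eq_mul, mul_one] at h
  unfold ov
  rw [← add_div, div_sub_one hn'.ne']
  gcongr

/-- flipped configuration -/
noncomputable def flipx {n : ℕ} (x z : Fin n → ℝ) : Fin n → ℝ := fun i => x i * (1 - 2 * fN (z i))

lemma fN_cases (t : ℝ) : fN t = 0 ∨ fN t = 1 := by
  unfold fN Set.indicator; split_ifs <;> simp

lemma fW_eq (t : ℝ) : fW t = -(1 - 2 * fN t) * t := by
  unfold fN fW Set.indicator; split_ifs <;> ring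

lemma flipx_mem {n : ℕ} {x : Fin n → ℝ} (hx : x ∈ cubeF n) (z : Fin n → ℝ) :
    flipx x z ∈ cubeF n := by
  refine mem_cubeF.2 fun i => ?_
  unfold flipx
  rcases mem_cubeF.1 hx i with h1 | h1 <;> rcases fN_cases (z i) with h2 | h2 <;> rw [h1, h2] <;>
    norm_num

lemma flipx_ov {n : ℕ} (hn : 0 < n) {x : Fin n → ℝ} (hx : x ∈ cubeF n) (z : Fin n → ℝ) :
    ov n x (flipx x z) = 1 - 2 * (∑ i, fN (z i)) / n := by
  have hn' : (0:ℝ) < n := by exact_mod_cast hn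
  unfold ov flipx
  have : ∀ i, x i * (x i * (1 - 2 * fN (z i))) = 1 - 2 * fN (z i) := fun i => by
    rw [← mul_assoc, cube_sq hx, one_mul]
  simp only [this]
  rw [Finset.sum_sub_distrib, ← Finset.mul_sum]
  simp
  field_simp

lemma flipx_lin {n : ℕ} {x : Fin n → ℝ} (hx : x ∈ cubeF n) (s : ℝ) (z : Fin n → ℝ) :
    lin ((-s) • (x * flipx x z)) z = s * ∑ i, fW (z i) := by
  rw [lin, Finset.mul_sum]
  refine Finset.sum_congr rfl fun i _ => ?_
  simp only [Pi.smul_apply, Pi.mul_apply, smul_eq_mul, flipx, fW_eq]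
  linear_combination (-s * (1 - 2 * fN (z i)) * z i) * cube_sq hx i

noncomputable def cW (b : ℝ) (n : ℕ) (x y : Fin n → ℝ) : ℝ :=
  Real.exp (b * (bet * (n * (ov n x y)^4)))

lemma planted_mean (b : ℝ) (hb : 0 < b) : ∃ N : ℕ, ∀ n ≥ N, 0 < n → ∀ x ∈ cubeF n,
    (binS n x 0.9783 1).Nonempty ∧
    b * (1.15564 * n) ≤ ∫ Y, LSE (binS n x 0.9783 1) (cW b n x) (fun y => b • pv 4 n y) Y
      ∂(gG (Fin 4 → Fin n)) := by
  obtain ⟨N, hN⟩ := fNW_prob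
  obtain ⟨N2, hN2⟩ := exists_nat_ge ((4 * 1.9357/0.00001:ℝ)^2)
  refine ⟨max N N2, fun n hnn hn x hx => ?_⟩
  have hn' : (0:ℝ) < n := by exact_mod_cast hn
  have hp := hN n ((le_max_left _ _).trans hnn) hn
  have hN2' : (4 * 1.9357/0.00001:ℝ)^2 ≤ n := hN2.trans (by exact_mod_cast (le_max_right _ _).trans hnn)
  set S := binS n x 0.9783 1 with hSdef
  have hS : S.Nonempty := ⟨x, mem_binS.2 ⟨hx, by rw [ov_self hn hx]; norm_num⟩⟩
  refine ⟨hS, ?_⟩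
  have hc : ∀ y, 0 < cW b n x y := fun y => Real.exp_pos _
  have hcmp := gauss_compare S hS (cW b n x) hc (fun y => (-(b * 1.9357)) • (x * y))
    (fun y => b • pv 4 n y) 0 (by
      intro y hy z hz
      simp only [sv_inner hn, gauge_inner hn hx, ov_self hn (binS_sub hy)]
      obtain ⟨hy0, hy1, -⟩ := mem_binS.1 hy
      obtain ⟨hz0, hz1, -⟩ := mem_binS.1 hz
      have ht := ov_tri hn hx hy0 hz0
      have hle := (abs_le.1 (ov_abs_le hy0 hz0)).2
      set R := ov n y z
      have hR : 0.9566 ≤ R := by linarith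
      have h1 : 0 ≤ (1 - R) * (1 + R + R^2 + R^3 - 1.9357^2) := by
        refine mul_nonneg (by linarith) ?_
        have h2 : (0.9566:ℝ)^2 ≤ R^2 := by gcongr
        have h3 : (0.9566:ℝ)^3 ≤ R^3 := by gcongr
        norm_num at h2 h3 ⊢
        linarith
      have h2 := mul_nonneg (mul_nonneg (sq_nonneg b) hn'.le) h1
      nlinarith [h2])
  rw [add_zero] at hcmp
  refine le_trans ?_ hcmp
  have hlip : LipK (LSE S (cW b n x) (fun y => (-(b * 1.9357)) • (x * y))) (fun _ => b * 1.9357) := by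
    intro Y Y'
    refine LSE_lip S hS _ hc _ _ (fun y hy j => ?_) Y Y'
    rw [Pi.smul_apply, smul_eq_mul, abs_mul, Pi.mul_apply, abs_mul, cube_abs hx,
      cube_abs (binS_sub hy), abs_neg, abs_of_pos (by positivity)]
    simp
  have hm := mean_ge_of_prob _ _ hlip ((b*1.9357)^2 * n) (b * (1.15565 * n)) (1/2)
    (by simp [mul_comm]) (by positivity) (by norm_num) (by
      refine hp.trans (measureReal_mono fun z hz => ?_)
      obtain ⟨h1, h2⟩ := hz
      have hov := flipx_ov hn hx z
      have hov1 : 0.9783 ≤ ov n x (flipx x z) := by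
        rw [hov, mul_div_assoc]
        have : (∑ i, fN (z i)) / n ≤ 0.01085 := (div_le_iff₀ hn').2 h1
        linarith
      have hmem : flipx x z ∈ S := mem_binS.2 ⟨flipx_mem hx z, hov1,
        (abs_le.1 (ov_abs_le hx (flipx_mem hx z))).2⟩
      have hge := LSE_ge S (cW b n x) hc (fun y => (-(b * 1.9357)) • (x * y)) z _ hmem
      refine le_trans ?_ hge
      rw [flipx_lin hx, cW, Real.log_exp]
      have h4 : (0.9783:ℝ)^4 ≤ (ov n x (flipx x z))^4 := by gcongr
      have h5 : b * (bet * (n * 0.9783^4)) ≤ b * (bet * (n * (ov n x (flipx x z))^4)) := by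
        have : (0:ℝ) ≤ bet := by unfold bet; norm_num
        gcongr
      have h6 := mul_le_mul_of_nonneg_left h2 (show 0 ≤ b * 1.9357 by positivity)
      have hbn := mul_pos hb hn'
      unfold bet at h5 ⊢
      nlinarith [h5, h6, hbn])
  refine le_trans ?_ hm
  have e : √(2 * ((b*1.9357)^2 * n) / (1/2)) = 2 * (b * 1.9357) * √n := by
    rw [show 2 * ((b*1.9357)^2 * n) / (1/2) = (2*(b*1.9357))^2 * n by ring,
      Real.sqrt_mul (by positivity), Real.sqrt_sq (by positivity)]
  rw [e]
  have hs : 4 * 1.9357/0.00001 ≤ √n := Real.le_sqrt_of_sq_le hN2'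
  have hsq : √(n:ℝ) * √n = n := Real.mul_self_sqrt hn'.le
  have h7 : 4 * 1.9357/0.00001 * √n ≤ n := by nlinarith [Real.sqrt_nonneg (n:ℝ)]
  have h8 : 2 * 1.9357 * √n ≤ 0.00001 * n := by
    have : 0 ≤ √(n:ℝ) := Real.sqrt_nonneg _
    linarith
  nlinarith [mul_le_mul_of_nonneg_left h8 hb.le]

/-- b large, probability of large LSE from mean of LSE -/
lemma LSE_prob_max {p n : ℕ} (hn : 0 < n) (S : Finset (Fin n → ℝ)) (hS : S.Nonempty) (hSc : S ⊆ cubeF n)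
    (g : (Fin n → ℝ) → ℝ) (b M M' : ℝ) (hb : 0 < b) (hbl : Real.log 2 / b + 0.00001 ≤ M - M')
    (hmean : b * (M * n) ≤ ∫ Y, LSE S (fun y => Real.exp (b * g y)) (fun y => b • pv p n y) Y
      ∂(gG (Fin p → Fin n))) :
    (gG (Fin p → Fin n)).real {Y | ∀ y ∈ S, lin (pv p n y) Y + g y < M' * n} ≤ 1 / (0.00001^2 * n) := by
  have hn' : (0:ℝ) < n := by exact_mod_cast hn
  have hc : ∀ y, 0 < Real.exp (b * g y) := fun y => Real.exp_pos _
  have h := prob_le_le _ _ (pLSE_lip (p := p) b S hS hSc _ hc) (b^2 * n)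
    (b * (M * n) - b * (0.00001 * n)) (b * (0.00001 * n)) (pv_K_sum hn b).le (by positivity)
    (by linarith)
  have e : b^2 * n / (b * (0.00001 * n))^2 = 1 / (0.00001^2 * n) := by field_simp
  rw [e] at h
  refine le_trans (measureReal_mono fun Y hY => ?_) h
  show LSE _ _ _ _ ≤ _
  refine (LSE_le S hS _ hc _ Y (b * (M' * n)) fun y hy => ?_).trans ?_
  · have := hY y hy
    rw [← Real.exp_add, lin_smul_left, ← mul_add]
    refine Real.exp_le_exp.2 (mul_le_mul_of_nonneg_left ?_ hb.le)
    linarith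
  · have hcard : Real.log (S.card) ≤ n * Real.log 2 := by
      rw [← Real.log_pow, ← cubeF_card]
      exact Real.log_le_log (by exact_mod_cast hS.card_pos) (by exact_mod_cast Finset.card_le_card hSc)
    have h1 : Real.log 2 + 0.00001 * b ≤ (M - M') * b := by
      have := mul_le_mul_of_nonneg_right hbl hb.le
      rwa [add_mul, div_mul_cancel₀ _ hb.ne'] at this
    nlinarith [mul_le_mul_of_nonneg_left h1 hn'.le]

lemma log2_small : Real.log 2 / 100000 + 0.00001 ≤ 0.00004 := by
  have := Real.log_two_lt_d9; linarith

lemma planted_max : ∃ N : ℕ, ∀ n ≥ N, 0 < n → ∀ x ∈ cubeF n,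
    (gG (Fin 4 → Fin n)).real {Y | ∀ y ∈ cubeF n, lin (pv 4 n y) (Y + bet • pv 4 n x) < 1.1556 * n}
      ≤ 1/4 := by
  obtain ⟨N, hN⟩ := planted_mean 100000 (by norm_num)
  obtain ⟨N2, hN2⟩ := exists_nat_ge (4/0.00001^2:ℝ)
  refine ⟨max N N2, fun n hnn hn x hx => ?_⟩
  have hn' : (0:ℝ) < n := by exact_mod_cast hn
  obtain ⟨hS, hm⟩ := hN n ((le_max_left _ _).trans hnn) hn x hx
  have hN2' : (4/0.00001^2:ℝ) ≤ n := hN2.trans (by exact_mod_cast (le_max_right _ _).trans hnn)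
  have h := LSE_prob_max (p := 4) hn _ hS binS_sub (fun y => bet * (n * (ov n x y)^4)) 100000 1.15564
    1.1556 (by norm_num) (log2_small.trans (by norm_num)) hm
  refine le_trans (measureReal_mono ?_) (h.trans ?_)
  · intro Y hY y hy
    have := hY y (binS_sub hy)
    rw [lin_comm, lin_add_left, lin_comm, lin_smul_left, pv_inner hn] at this
    exact this
  · rw [div_le_iff₀ (by positivity)]
    rw [div_le_iff₀ (by norm_num)] at hN2'
    linarith


lemma Zf_shift {n : ℕ} (hn : 0 < n) (x : Fin n → ℝ) (Y : (Fin 4 → Fin n) → ℝ) :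
    Zf (cubeF n) (fun _ => 1) (fun y => bet • pv 4 n y) (Y + bet • pv 4 n x) =
      Zf (cubeF n) (plW bet n x) (fun y => bet • pv 4 n y) Y := by
  unfold Zf plW
  refine Finset.sum_congr rfl fun y _ => ?_
  rw [one_mul, ← Real.exp_add, lin_add, sv_inner hn, ov_comm n y x]
  congr 1; ring

lemma unplant : ∃ c0 > (0:ℝ), ∃ N : ℕ, ∀ n ≥ N, 0 < n →
    c0 ≤ (gG (Fin 4 → Fin n)).real {Y | ∃ y ∈ cubeF n, 1.1556 * n ≤ lin (pv 4 n y) Y} := by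
  obtain ⟨C, hC, N1, hN1⟩ := planted_Z
  obtain ⟨N2, hN2⟩ := planted_max
  refine ⟨1/(2*C), by positivity, max N1 N2, fun n hnn hn => ?_⟩
  have hn' : (0:ℝ) < n := by exact_mod_cast hn
  set μ := gG (Fin 4 → Fin n)
  set Z := Zf (cubeF n) (fun _ => 1) (fun y => bet • pv 4 n y) with hZ
  set A := {Y | ∃ y ∈ cubeF n, 1.1556 * n ≤ lin (pv 4 n y) Y} with hA
  set B := {Y | Z Y ≤ C * Real.exp (n * (Real.log 2 + bet^2/2))} ∩ A with hB
  have hAm : MeasurableSet A := by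
    have : A = ⋃ y ∈ cubeF n, {Y | 1.1556 * n ≤ lin (pv 4 n y) Y} := by
      ext Y; simp [hA]
    rw [this]
    exact Finset.measurableSet_biUnion _ fun y _ => measurableSet_le measurable_const (lin_measurable _)
  have hBm : MeasurableSet B :=
    (measurableSet_le (Zf_cont _ _ _).measurable measurable_const).inter hAm
  have hx : ∀ x ∈ cubeF n, 1/2 ≤ ∫ Y, Real.exp (bet * lin (pv 4 n x) Y - bet^2*n/2) * B.indicator (fun _ => 1) Y ∂μ := by
    intro x hx
    have h1 := gG_shift_integral (bet • pv 4 n x) (B.indicator (fun _ => (1:ℝ)))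
      (measurable_const.indicator hBm)
    simp only [sv_inner hn, ov_self hn hx, lin_smul_left, one_pow, mul_one] at h1
    rw [← h1]
    have h2 : ∫ Y, B.indicator (fun _ => (1:ℝ)) (Y + bet • pv 4 n x) ∂μ =
        μ.real {Y | Y + bet • pv 4 n x ∈ B} := by
      have : (fun Y => B.indicator (fun _ => (1:ℝ)) (Y + bet • pv 4 n x)) =
          ((fun Y => Y + bet • pv 4 n x) ⁻¹' B).indicator 1 := by
        ext Y; simp [Set.indicator]
      rw [this, integral_indicator_one (hBm.preimage (by fun_prop))]
      rfl
    rw [h2]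
    have p1 := hN1 n ((le_max_left _ _).trans hnn) hn x hx
    have p2 := hN2 n ((le_max_right _ _).trans hnn) hn x hx
    set B1 := {Y | C * Real.exp (n * (Real.log 2 + bet^2/2)) <
      Zf (cubeF n) (plW bet n x) (fun y => bet • pv 4 n y) Y}
    set B2 := {Y : (Fin 4 → Fin n) → ℝ | ∀ y ∈ cubeF n, lin (pv 4 n y) (Y + bet • pv 4 n x) < 1.1556 * n}
    have hcov : (Set.univ : Set ((Fin 4 → Fin n) → ℝ)) ⊆ {Y | Y + bet • pv 4 n x ∈ B} ∪ (B1 ∪ B2) := by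
      intro Y _
      by_cases hb1 : Y ∈ B1
      · exact Or.inr (Or.inl hb1)
      by_cases hb2 : Y ∈ B2
      · exact Or.inr (Or.inr hb2)
      left
      constructor
      · show Z (Y + bet • pv 4 n x) ≤ _
        rw [hZ, Zf_shift hn]
        exact not_lt.1 hb1
      · simp only [B2, Set.mem_ofPred_eq] at hb2
        push Not at hb2
        exact hb2
    have h3 : (1:ℝ) ≤ μ.real {Y | Y + bet • pv 4 n x ∈ B} + (μ.real B1 + μ.real B2) := by
      calc (1:ℝ) = μ.real Set.univ := by simp [μ]
        _ ≤ _ := measureReal_mono hcov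
        _ ≤ _ := (measureReal_union_le _ _).trans (by gcongr; exact measureReal_union_le _ _)
    linarith
  have hint : ∀ x ∈ cubeF n, Integrable (fun Y => Real.exp (bet * lin (pv 4 n x) Y - bet^2*n/2) * B.indicator (fun _ => 1) Y) μ := by
    intro x _
    have : Integrable (fun Y => Real.exp (bet * lin (pv 4 n x) Y - bet^2*n/2)) μ := by
      simp only [Real.exp_sub, ← lin_smul_left]
      exact (gG_exp_integrable _).div_const _
    have h2 := this.indicator hBm
    refine h2.congr (ae_of_all _ fun Y => ?_)
    by_cases h : Y ∈ B <;> simp [h]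
  have hsum : (2:ℝ)^n * (1/2) ≤ ∫ Y, ∑ x ∈ cubeF n, Real.exp (bet * lin (pv 4 n x) Y - bet^2*n/2) * B.indicator (fun _ => 1) Y ∂μ := by
    rw [integral_finsetSum _ hint, ← cubeF_card, ← nsmul_eq_mul]
    exact Finset.card_nsmul_le_sum _ _ _ hx
  have hup : ∫ Y, ∑ x ∈ cubeF n, Real.exp (bet * lin (pv 4 n x) Y - bet^2*n/2) * B.indicator (fun _ => 1) Y ∂μ ≤ ∫ Y, C * 2^n * B.indicator 1 Y ∂μ := by
    refine integral_mono (integrable_finsetSum _ hint)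
      (((integrable_const (1:ℝ)).indicator hBm).const_mul _) fun Y => ?_
    simp only
    by_cases h : Y ∈ B
    · have h1 : Z Y ≤ C * Real.exp (n * (Real.log 2 + bet^2/2)) := h.1
      have e : Real.exp (n * (Real.log 2 + bet^2/2)) = 2^n * Real.exp (bet^2*n/2) := by
        rw [mul_add, Real.exp_add, Real.exp_nat_mul, Real.exp_log (by norm_num)]
        congr 2; ring
      rw [e] at h1
      have e2 : ∑ x ∈ cubeF n, Real.exp (bet * lin (pv 4 n x) Y - bet^2*n/2) = Z Y / Real.exp (bet^2*n/2) := by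
        rw [hZ, Zf, Finset.sum_div]
        refine Finset.sum_congr rfl fun x _ => ?_
        rw [Real.exp_sub, one_mul, lin_smul_left]
      simp only [h, Set.indicator_of_mem, mul_one, Pi.one_apply]
      rw [e2, div_le_iff₀ (Real.exp_pos _)]
      linarith
    · simp [h]
  rw [integral_const_mul, integral_indicator_one hBm] at hup
  have h5 : 1/(2*C) ≤ μ.real B := by
    rw [div_le_iff₀ (by positivity)]
    have h2n : (0:ℝ) < 2^n := by positivity
    have h6 : (2:ℝ)^n * 1 ≤ 2^n * (μ.real B * (2*C)) := by linarith
    exact le_of_mul_le_mul_left h6 h2n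
  exact h5.trans (measureReal_mono Set.inter_subset_right)

lemma p4_mean : ∃ N : ℕ, ∀ n ≥ N, 0 < n →
    100000 * (1.15559 * n) ≤ ∫ Y, LSE (cubeF n) (fun _ => Real.exp (100000 * 0)) (fun y => (100000:ℝ) • pv 4 n y) Y
      ∂(gG (Fin 4 → Fin n)) := by
  obtain ⟨c0, hc0, N, hN⟩ := unplant
  obtain ⟨N2, hN2⟩ := exists_nat_ge (2 / c0 / 0.00001^2)
  refine ⟨max N N2, fun n hnn hn => ?_⟩
  have hn' : (0:ℝ) < n := by exact_mod_cast hn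
  have hp := hN n ((le_max_left _ _).trans hnn) hn
  have hN2' : 2 / c0 / 0.00001^2 ≤ n := hN2.trans (by exact_mod_cast (le_max_right _ _).trans hnn)
  have hm := mean_ge_of_prob _ _ (pLSE_lip (p := 4) (n := n) 100000 (cubeF n) (cubeF_nonempty n) subset_rfl
    (fun _ => Real.exp (100000 * 0)) (fun _ => Real.exp_pos _)) (100000^2 * n) (100000 * (1.1556 * n)) c0
    (pv_K_sum hn 100000).le (by positivity) hc0 (by
      refine hp.trans (measureReal_mono fun Y hY => ?_)
      obtain ⟨y, hy, h⟩ := hY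
      refine le_trans ?_ (LSE_ge _ _ (fun _ => Real.exp_pos _) _ Y y hy)
      rw [Real.log_exp, lin_smul_left]
      linarith)
  refine le_trans ?_ hm
  have h1 : √(2 * (100000^2 * n) / c0) ≤ 100000 * (0.00001 * n) := by
    refine Real.sqrt_le_iff.2 ⟨by positivity, ?_⟩
    rw [div_le_iff₀ hc0]
    rw [div_div, div_le_iff₀ (by positivity)] at hN2'
    nlinarith [mul_le_mul_of_nonneg_left hN2' hn'.le]
  linarith

lemma pow_even_le {p : ℕ} (hp : 4 ≤ p) (hpe : Even p) {R : ℝ} (hR : |R| ≤ 1) : R^p ≤ R^4 := by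
  rw [← hpe.pow_abs, ← (show Even 4 by decide).pow_abs R]
  exact pow_le_pow_of_le_one (abs_nonneg _) hR hp

lemma p_max {p : ℕ} (hp : 4 ≤ p) (hpe : Even p) : ∃ N : ℕ, ∀ n ≥ N, 0 < n →
    (gG (Fin p → Fin n)).real {Y | ∀ y ∈ cubeF n, lin (pv p n y) Y < 1.1555 * n} ≤ 1/4 := by
  obtain ⟨N, hN⟩ := p4_mean
  obtain ⟨N2, hN2⟩ := exists_nat_ge (4/0.00001^2:ℝ)
  refine ⟨max N N2, fun n hnn hn => ?_⟩
  have hn' : (0:ℝ) < n := by exact_mod_cast hn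
  have hm := hN n ((le_max_left _ _).trans hnn) hn
  have hN2' : (4/0.00001^2:ℝ) ≤ n := hN2.trans (by exact_mod_cast (le_max_right _ _).trans hnn)
  have hcmp := gauss_compare (cubeF n) (cubeF_nonempty n) (fun _ => Real.exp (100000 * 0))
    (fun _ => Real.exp_pos _) (fun y => (100000:ℝ) • pv 4 n y) (fun y => (100000:ℝ) • pv p n y) 0 (by
      intro y hy z hz
      simp only [sv_inner hn, ov_self hn hy]
      have := mul_le_mul_of_nonneg_left (pow_even_le hp hpe (ov_abs_le hy hz)) hn'.le
      simp only [one_pow]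
      nlinarith)
  have h := LSE_prob_max (p := p) hn _ (cubeF_nonempty n) subset_rfl (fun _ => 0) 100000 1.15559
    1.1555 (by norm_num) (log2_small.trans (by norm_num)) (hm.trans (by simpa using hcmp))
  simp only [add_zero] at h
  refine h.trans ?_
  rw [div_le_iff₀ (by positivity)]
  rw [div_le_iff₀ (by norm_num)] at hN2'
  linarith

lemma E_lb {p : ℕ} (hp : 4 ≤ p) (hpe : Even p) (E : ℝ)
    (hE : ∀ ε > (0 : ℝ),
      Filter.Tendsto (fun n => (tensorGaussian p n) {Y | ε ≤ |maxCube p n Y - E|})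
        Filter.atTop (nhds 0)) : 1.1555 ≤ E := by
  by_contra hcon
  push Not at hcon
  obtain ⟨N, hN⟩ := p_max hp hpe
  have h1 := hE (1.1555 - E) (by linarith)
  have h2 := (h1.eventually (gt_mem_nhds (show (0:ENNReal) < ENNReal.ofReal (1/2) by simp))).and
    (Filter.eventually_ge_atTop (max N 1))
  obtain ⟨n, hlt, hn1⟩ := h2.exists
  have hn : 0 < n := lt_of_lt_of_le one_pos ((le_max_right _ _).trans hn1)
  have hn' : (0:ℝ) < n := by exact_mod_cast hn
  have h3 := hN n ((le_max_left _ _).trans hn1) hn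
  have h4 : (gG (Fin p → Fin n)).real {Y | 1.1555 - E ≤ |maxCube p n Y - E|} < 1/2 := by
    have := (ENNReal.lt_ofReal_iff_toReal_lt (measure_ne_top (gG (Fin p → Fin n)) _)).1 hlt
    exact this
  have hcov : (Set.univ : Set ((Fin p → Fin n) → ℝ)) ⊆ {Y | 1.1555 - E ≤ |maxCube p n Y - E|} ∪
      {Y | ∀ y ∈ cubeF n, lin (pv p n y) Y < 1.1555 * n} := by
    intro Y _
    by_cases hb : ∀ y ∈ cubeF n, lin (pv p n y) Y < 1.1555 * n
    · exact Or.inr hb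
    left
    push Not at hb
    obtain ⟨y, hy, h⟩ := hb
    rw [pv_H hn] at h
    have h5 := maxCube_ge Y hy
    have h6 : 1.1555 ≤ Hpspin p n Y y := by
      rw [mul_comm] at h; exact le_of_mul_le_mul_left h hn'
    show 1.1555 - E ≤ |maxCube p n Y - E|
    exact le_trans (by linarith) (le_abs_self _)
  have h5 : (1:ℝ) ≤ (gG (Fin p → Fin n)).real {Y | 1.1555 - E ≤ |maxCube p n Y - E|} + (gG (Fin p → Fin n)).real
      {Y | ∀ y ∈ cubeF n, lin (pv p n y) Y < 1.1555 * n} := by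
    calc (1:ℝ) = (gG (Fin p → Fin n)).real Set.univ := by simp
      _ ≤ _ := measureReal_mono hcov
      _ ≤ _ := measureReal_union_le _ _
  linarith


lemma chern2 {ι : Type} [Fintype ι] (a b : ι → ℝ) (V t : ℝ) (hV : lin a a + lin b b ≤ V) (hV0 : 0 < V)
    (ht : 0 ≤ t) :
    ((gG ι).prod (gG ι)).real {z | t ≤ lin a z.1 + lin b z.2} ≤ Real.exp (-(t^2/(2*V))) := by
  have he : ∀ s : ℝ, (fun z : (ι → ℝ) × (ι → ℝ) => Real.exp (s * (lin a z.1 + lin b z.2))) =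
      fun z => Real.exp (lin (s • a) z.1) * Real.exp (lin (s • b) z.2) := by
    intro s; ext z
    rw [← Real.exp_add, lin_smul_left, lin_smul_left, mul_add]
  have h := measure_ge_le_exp_mul_mgf (μ := (gG ι).prod (gG ι))
    (X := fun z => lin a z.1 + lin b z.2) (t := t/V) t (by positivity) (by
      rw [he]
      exact (gG_exp_integrable _).mul_prod (gG_exp_integrable _))
  refine h.trans ?_
  rw [mgf, he, integral_prod_mul (f := fun Y => Real.exp (lin ((t/V) • a) Y))
    (g := fun Y => Real.exp (lin ((t/V) • b) Y)), gG_mgf, gG_mgf, ← Real.exp_add, ← Real.exp_add]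
  refine Real.exp_le_exp.2 ?_
  simp only [lin_smul_left, lin_smul_right]
  have h1 : (t/V)^2 * (lin a a + lin b b) ≤ (t/V)^2 * V := by gcongr
  have h2 : (t/V)^2 * V = t^2/V := by field_simp
  have h3 : -(t/V) * t = -(t^2/V) := by ring
  have h4 : t^2/(2*V) = t^2/V/2 := by field_simp
  rw [h3, h4]
  nlinarith

lemma logs_ok : Real.log (68/15) - 0.47 * Real.log (5/3) ≤ 1.2715 := by
  have h1 : Real.log (17/15) ≤ 0.12517 := by
    rw [Real.log_le_iff_le_exp (by norm_num)]
    refine le_trans ?_ (Real.sum_le_exp_of_nonneg (by norm_num) 5)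
    norm_num [Finset.sum_range_succ, Nat.factorial]
  have h2 : 0.5108 ≤ Real.log (5/3) := by
    rw [Real.le_log_iff_exp_le (by norm_num)]
    refine (Real.exp_bound' (x := 0.5108) (by norm_num) (by norm_num) (n := 8) (by norm_num)).trans ?_
    norm_num [Finset.sum_range_succ, Nat.factorial]
  have h3 : Real.log (68/15) = 2 * Real.log 2 + Real.log (17/15) := by
    rw [show (68/15:ℝ) = 2^2 * (17/15) by norm_num, Real.log_mul (by norm_num) (by norm_num), Real.log_pow]
    norm_num
  have := Real.log_two_lt_d9
  rw [h3]; linarith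

open Classical in
noncomputable def pairsF (n : ℕ) : Finset ((Fin n → ℝ) × (Fin n → ℝ)) :=
  (cubeF n ×ˢ cubeF n).filter fun q => 0.47 < |ov n q.1 q.2|

lemma mem_pairsF {n : ℕ} {q : (Fin n → ℝ) × (Fin n → ℝ)} :
    q ∈ pairsF n ↔ (q.1 ∈ cubeF n ∧ q.2 ∈ cubeF n) ∧ 0.47 < |ov n q.1 q.2| := by
  simp [pairsF]

lemma pairs_half {n : ℕ} (s : ℝ) (hs : s = 1 ∨ s = -1) {x : Fin n → ℝ} (hx : x ∈ cubeF n) :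
    ∑ y ∈ cubeF n, Real.exp (Real.log (5/3) * (s * ∑ i, x i * y i)) = (34/15)^n := by
  have e : ∀ y : Fin n → ℝ, Real.log (5/3) * (s * ∑ i, x i * y i) = ∑ i, (Real.log (5/3) * s * x i) * y i := by
    intro y
    rw [Finset.mul_sum, Finset.mul_sum]
    exact Finset.sum_congr rfl fun i _ => by ring
  simp only [e]
  rw [cubeF_sum_exp]
  have : ∀ i, Real.exp (Real.log (5/3) * s * x i) + Real.exp (-(Real.log (5/3) * s * x i)) = 34/15 := by
    intro i
    have h1 : Real.exp (Real.log (5/3)) = 5/3 := Real.exp_log (by norm_num)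
    rcases hs with rfl | rfl <;> rcases mem_cubeF.1 hx i with h | h <;> rw [h] <;>
      simp [Real.exp_neg, h1] <;> norm_num
  simp only [this, Finset.prod_const, Finset.card_univ, Fintype.card_fin]

lemma pairs_card {n : ℕ} (hn : 0 < n) : ((pairsF n).card : ℝ) ≤ 2 * Real.exp (n * 1.2715) := by
  have hn' : (0:ℝ) < n := by exact_mod_cast hn
  set h := Real.log (5/3) with hh
  have hh0 : 0 < h := Real.log_pos (by norm_num)
  set g : (Fin n → ℝ) × (Fin n → ℝ) → ℝ := fun q =>
    Real.exp (h * (1 * ∑ i, q.1 i * q.2 i)) + Real.exp (h * (-1 * ∑ i, q.1 i * q.2 i)) with hg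
  have h1 : ((pairsF n).card : ℝ) * Real.exp (h * (0.47 * n)) ≤ ∑ q ∈ pairsF n, g q := by
    rw [← nsmul_eq_mul]
    refine Finset.card_nsmul_le_sum _ _ _ fun q hq => ?_
    obtain ⟨-, hq⟩ := mem_pairsF.1 hq
    have hov : ∑ i, q.1 i * q.2 i = n * ov n q.1 q.2 := by rw [ov, mul_div_cancel₀ _ hn'.ne']
    simp only [hg]
    rw [hov]
    rcases lt_abs.1 hq with h2 | h2
    · refine le_trans (Real.exp_le_exp.2 ?_) (le_add_of_nonneg_right (Real.exp_pos _).le)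
      exact mul_le_mul_of_nonneg_left (by nlinarith) hh0.le
    · refine le_trans (Real.exp_le_exp.2 ?_) (le_add_of_nonneg_left (Real.exp_pos _).le)
      exact mul_le_mul_of_nonneg_left (by nlinarith) hh0.le
  have h2 : ∑ q ∈ pairsF n, g q ≤ ∑ q ∈ cubeF n ×ˢ cubeF n, g q :=
    Finset.sum_le_sum_of_subset_of_nonneg (Finset.filter_subset _ _) fun _ _ _ => by
      simp only [hg]; positivity
  have h3 : ∑ q ∈ cubeF n ×ˢ cubeF n, g q = 2 * (68/15)^n := by
    rw [Finset.sum_product]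
    simp only [hg, Finset.sum_add_distrib]
    rw [Finset.sum_congr rfl fun x hx => pairs_half 1 (Or.inl rfl) hx,
      Finset.sum_congr rfl fun x hx => pairs_half (-1) (Or.inr rfl) hx]
    rw [Finset.sum_const, nsmul_eq_mul, cubeF_card, ← mul_pow, ← two_mul]
    norm_num
  have h4 : ((68/15:ℝ))^n = Real.exp (n * Real.log (68/15)) := by
    rw [Real.exp_nat_mul, Real.exp_log (by norm_num)]
  have h5 : Real.exp (n * Real.log (68/15)) ≤ Real.exp (n * 1.2715) * Real.exp (h * (0.47 * n)) := by
    rw [← Real.exp_add]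
    refine Real.exp_le_exp.2 ?_
    have := mul_le_mul_of_nonneg_left logs_ok hn'.le
    rw [← hh] at this
    linarith
  have h6 : ((pairsF n).card : ℝ) * Real.exp (h * (0.47 * n)) ≤
      2 * Real.exp (n * 1.2715) * Real.exp (h * (0.47 * n)) := by
    refine h1.trans (h2.trans ?_)
    rw [h3, h4]; linarith
  exact le_of_mul_le_mul_right h6 (Real.exp_pos _)

lemma pair_prob {p n : ℕ} (hn : 0 < n) (hp : 4 ≤ p) (hpe : Even p) {x y : Fin n → ℝ} (hx : x ∈ cubeF n)
    (hy : y ∈ cubeF n) (h : |ov n x y| ≤ 0.471) (s t : ℝ) :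
    ((gG (Fin p → Fin n)).prod (gG (Fin p → Fin n))).real {z | 2 * (1.1551 * n) ≤
      (Real.cos s * lin (pv p n x) z.1 + Real.sin s * lin (pv p n x) z.2) +
      (Real.cos t * lin (pv p n y) z.1 + Real.sin t * lin (pv p n y) z.2)} ≤ Real.exp (-(n * 1.27166)) := by
  have hn' : (0:ℝ) < n := by exact_mod_cast hn
  have hc := chern2 (Real.cos s • pv p n x + Real.cos t • pv p n y) (Real.sin s • pv p n x + Real.sin t • pv p n y)
    (2 * n * 1.04922) (2 * (1.1551 * n)) (by
      simp only [lin_add, lin_add_left, lin_smul_left, lin_smul_right, pv_inner hn, ov_self hn hx, ov_self hn hy, one_pow, ov_comm n y x]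
      have hR0 : 0 ≤ (ov n x y)^p := hpe.pow_nonneg _
      have hR : (ov n x y)^p ≤ 0.04922 := by
        refine (pow_even_le hp hpe (h.trans (by norm_num))).trans ?_
        rw [← (show Even 4 by decide).pow_abs]
        calc |ov n x y|^4 ≤ 0.471^4 := by gcongr
          _ ≤ _ := by norm_num
      have hcs : Real.cos s * Real.cos t + Real.sin s * Real.sin t ≤ 1 := by
        rw [← Real.cos_sub]; exact Real.cos_le_one _
      have h1 := Real.sin_sq_add_cos_sq s
      have h2 := Real.sin_sq_add_cos_sq t
      have h3 : (Real.cos s * Real.cos t + Real.sin s * Real.sin t) * (ov n x y)^p ≤ 0.04922 := by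
        nlinarith
      have h4 := mul_le_mul_of_nonneg_left h3 hn'.le
      generalize (ov n x y)^p = Q at *
      have h5 : (Real.sin s^2 + Real.cos s^2) * n = n := by rw [h1, one_mul]
      have h6 : (Real.sin t^2 + Real.cos t^2) * n = n := by rw [h2, one_mul]
      linear_combination 2 * h4 + h5 + h6) (by positivity) (by positivity)
  have hset : ∀ z : ((Fin p → Fin n) → ℝ) × ((Fin p → Fin n) → ℝ),
      lin (Real.cos s • pv p n x + Real.cos t • pv p n y) z.1 + lin (Real.sin s • pv p n x + Real.sin t • pv p n y) z.2 =
      (Real.cos s * lin (pv p n x) z.1 + Real.sin s * lin (pv p n x) z.2) +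
      (Real.cos t * lin (pv p n y) z.1 + Real.sin t * lin (pv p n y) z.2) := by
    intro z
    simp only [lin_add_left, lin_smul_left]; ring
  simp only [hset] at hc
  refine hc.trans (Real.exp_le_exp.2 ?_)
  have : (2 * (1.1551 * (n:ℝ)))^2 / (2 * (2 * n * 1.04922)) = n * (1.1551^2/1.04922) := by
    field_simp
  rw [this]
  have : (1.27166:ℝ) ≤ 1.1551^2/1.04922 := by norm_num
  nlinarith

lemma sep_prob {p n : ℕ} (hn : 0 < n) {x y : Fin n → ℝ} (hx : x ∈ cubeF n) (hy : y ∈ cubeF n) :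
    ((gG (Fin p → Fin n)).prod (gG (Fin p → Fin n))).real {z | 2 * (1.1551 * n) ≤
      lin (pv p n x) z.1 + lin (pv p n y) z.2} ≤ Real.exp (-(n * 1.27166)) := by
  have hn' : (0:ℝ) < n := by exact_mod_cast hn
  have hc := chern2 (pv p n x) (pv p n y)
    (2 * n) (2 * (1.1551 * n)) (by
      simp only [pv_inner hn, ov_self hn hx, ov_self hn hy, one_pow]; linarith) (by positivity) (by positivity)
  refine hc.trans (Real.exp_le_exp.2 ?_)
  have : (2 * (1.1551 * (n:ℝ)))^2 / (2 * (2 * n)) = n * (1.1551^2) := by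
    field_simp
  rw [this]
  nlinarith

lemma single_prob {p n : ℕ} (hn : 0 < n) {x : Fin n → ℝ} (hx : x ∈ cubeF n) :
    ((gG (Fin p → Fin n)).prod (gG (Fin p → Fin n))).real {z | 3 * n ≤ |lin (pv p n x) z.1| ∨
      3 * n ≤ |lin (pv p n x) z.2|} ≤ 4 * Real.exp (-(n * 4.5)) := by
  have hn' : (0:ℝ) < n := by exact_mod_cast hn
  have key : ∀ s r : ℝ, s^2 + r^2 = 1 → ((gG (Fin p → Fin n)).prod (gG (Fin p → Fin n))).real
      {z | 3 * n ≤ lin (s • pv p n x) z.1 + lin (r • pv p n x) z.2} ≤ Real.exp (-(n * 4.5)) := by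
    intro s r hsr
    have hc := chern2 (s • pv p n x) (r • pv p n x) n (3 * n) (by
      simp only [sv_inner hn, ov_self hn hx, one_pow]
      rw [← add_mul, hsr]; linarith) hn' (by positivity)
    refine hc.trans (Real.exp_le_exp.2 (le_of_eq ?_))
    field_simp; norm_num
  set ν := (gG (Fin p → Fin n)).prod (gG (Fin p → Fin n))
  have hsub : {z : ((Fin p → Fin n) → ℝ) × ((Fin p → Fin n) → ℝ) | 3 * n ≤ |lin (pv p n x) z.1| ∨
      3 * n ≤ |lin (pv p n x) z.2|} ⊆
      ({z | 3 * n ≤ lin ((1:ℝ) • pv p n x) z.1 + lin ((0:ℝ) • pv p n x) z.2} ∪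
       {z | 3 * n ≤ lin ((-1:ℝ) • pv p n x) z.1 + lin ((0:ℝ) • pv p n x) z.2}) ∪
      ({z | 3 * n ≤ lin ((0:ℝ) • pv p n x) z.1 + lin ((1:ℝ) • pv p n x) z.2} ∪
       {z | 3 * n ≤ lin ((0:ℝ) • pv p n x) z.1 + lin ((-1:ℝ) • pv p n x) z.2}) := by
    intro z hz
    simp only [Set.mem_union, Set.mem_ofPred_eq, lin_smul_left, zero_mul, one_mul, add_zero, zero_add, neg_mul]
    rcases hz with h | h
    · exact Or.inl (le_abs.1 h)
    · exact Or.inr (le_abs.1 h)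
  refine (measureReal_mono hsub).trans ?_
  refine (measureReal_union_le _ _).trans ?_
  have a1 := measureReal_union_le (μ := ν) {z | 3 * n ≤ lin ((1:ℝ) • pv p n x) z.1 + lin ((0:ℝ) • pv p n x) z.2}
       {z | 3 * n ≤ lin ((-1:ℝ) • pv p n x) z.1 + lin ((0:ℝ) • pv p n x) z.2}
  have a2 := measureReal_union_le (μ := ν) {z | 3 * n ≤ lin ((0:ℝ) • pv p n x) z.1 + lin ((1:ℝ) • pv p n x) z.2}
       {z | 3 * n ≤ lin ((0:ℝ) • pv p n x) z.1 + lin ((-1:ℝ) • pv p n x) z.2}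
  have k1 := key 1 0 (by norm_num)
  have k2 := key (-1) 0 (by norm_num)
  have k3 := key 0 1 (by norm_num)
  have k4 := key 0 (-1) (by norm_num)
  linarith


lemma abs_cos_sub_le (a b : ℝ) : |Real.cos a - Real.cos b| ≤ |a - b| := by
  have := Real.lipschitzWith_cos.dist_le_mul a b
  simpa [Real.dist_eq] using this

lemma abs_sin_sub_le (a b : ℝ) : |Real.sin a - Real.sin b| ≤ |a - b| := by
  have := Real.lipschitzWith_sin.dist_le_mul a b
  simpa [Real.dist_eq] using this

/-- net indices -/
def netN : ℕ := 200000

def netF : Finset ℕ := Finset.range netN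

attribute [irreducible] netN

lemma netF_card : ((netF.card : ℕ) : ℝ) = 200000 := by
  rw [netF, Finset.card_range]; unfold netN; norm_num

/-- net point below an angle -/
lemma net_pt {τ : ℝ} (h : τ ∈ Set.Icc (0:ℝ) (Real.pi/2)) :
    ∃ k ∈ netF, |τ - (k:ℝ) * 0.00001| ≤ 0.00001 := by
  refine ⟨⌊τ * 100000⌋₊, ?_, ?_⟩
  · rw [netF, Finset.mem_range]
    rw [Nat.floor_lt (mul_nonneg h.1 (by norm_num))]
    have := h.2
    have := Real.pi_lt_d6
    unfold netN
    push_cast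
    linarith
  · have h1 := Nat.floor_le (mul_nonneg h.1 (by norm_num : (0:ℝ) ≤ 100000))
    have h2 := Nat.lt_floor_add_one (τ * 100000)
    rw [abs_le]; constructor <;> linarith

lemma net_err {A B n τ t : ℝ} (hA : |A| ≤ 3 * n) (hB : |B| ≤ 3 * n) (ht : |τ - t| ≤ 0.00001)
    (h : 1.1553 * n ≤ Real.cos τ * A + Real.sin τ * B) :
    1.1551 * n ≤ Real.cos t * A + Real.sin t * B := by
  have h1 : (Real.cos τ - Real.cos t) * A ≤ 0.00001 * (3 * n) := by
    refine (le_abs_self _).trans ?_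
    rw [abs_mul]
    exact mul_le_mul ((abs_cos_sub_le _ _).trans ht) hA (abs_nonneg _) (by norm_num)
  have h2 : (Real.sin τ - Real.sin t) * B ≤ 0.00001 * (3 * n) := by
    refine (le_abs_self _).trans ?_
    rw [abs_mul]
    exact mul_le_mul ((abs_sin_sub_le _ _).trans ht) hB (abs_nonneg _) (by norm_num)
  have h3 : 0 ≤ n := by have := (abs_nonneg A).trans hA; linarith
  linarith

lemma union_bd {Ω α : Type} [MeasurableSpace Ω] (ν : Measure Ω) [IsProbabilityMeasure ν] (S : Finset α)
    (f : α → Set Ω) (q : ℝ) (h : ∀ a ∈ S, ν.real (f a) ≤ q) : ν.real (⋃ a ∈ S, f a) ≤ S.card * q := by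
  refine (measureReal_biUnion_finset_le S f).trans ?_
  rw [← nsmul_eq_mul]
  exact Finset.sum_le_card_nsmul _ _ _ h

open Classical in
noncomputable def pairsG (n : ℕ) : Finset ((Fin n → ℝ) × (Fin n → ℝ)) :=
  (pairsF n).filter fun q => |ov n q.1 q.2| ≤ 0.471

abbrev TT (p n : ℕ) := ((Fin p → Fin n) → ℝ) × ((Fin p → Fin n) → ℝ)

def bad0 (p n : ℕ) : Set (TT p n) := ⋃ x ∈ cubeF n, {z | 3 * (n:ℝ) ≤ |lin (pv p n x) z.1| ∨
      3 * (n:ℝ) ≤ |lin (pv p n x) z.2|}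

def bad1 (p n : ℕ) : Set (TT p n) :=
  ⋃ k ∈ (netF ×ˢ netF) ×ˢ pairsG n, {z | 2 * (1.1551 * (n:ℝ)) ≤
      (Real.cos (k.1.1 * 0.00001) * lin (pv p n k.2.1) z.1 + Real.sin (k.1.1 * 0.00001) * lin (pv p n k.2.1) z.2) +
      (Real.cos (k.1.2 * 0.00001) * lin (pv p n k.2.2) z.1 + Real.sin (k.1.2 * 0.00001) * lin (pv p n k.2.2) z.2)}

def bad2 (p n : ℕ) : Set (TT p n) :=
  ⋃ q ∈ pairsF n, {z | 2 * (1.1551 * (n:ℝ)) ≤ lin (pv p n q.1) z.1 + lin (pv p n q.2) z.2}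

noncomputable abbrev nu2 (p n : ℕ) : Measure (TT p n) := (gG (Fin p → Fin n)).prod (gG (Fin p → Fin n))

lemma bad0_le {p n : ℕ} (hn : 0 < n) : (nu2 p n).real (bad0 p n) ≤ 4 * Real.exp (-(n * 0.00016)) := by
  have hn' : (0:ℝ) < n := by exact_mod_cast hn
  refine (union_bd _ _ _ _ fun x hx => single_prob hn hx).trans ?_
  have e : (2:ℝ)^n = Real.exp (n * Real.log 2) := by
    rw [Real.exp_nat_mul, Real.exp_log (by norm_num)]
  rw [cubeF_card, e]
  have : Real.exp (n * Real.log 2) * Real.exp (-(n * 4.5)) ≤ Real.exp (-(n * 0.00016)) := by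
    rw [← Real.exp_add]
    refine Real.exp_le_exp.2 ?_
    have := Real.log_two_lt_d9
    nlinarith
  linarith

lemma pe_le (n : ℕ) : 2 * Real.exp (n * 1.2715) * Real.exp (-(n * 1.27166)) =
    2 * Real.exp (-(n * 0.00016)) := by
  rw [mul_assoc, ← Real.exp_add]
  congr 2; ring

lemma bad2_le {p n : ℕ} (hn : 0 < n) : (nu2 p n).real (bad2 p n) ≤ 2 * Real.exp (-(n * 0.00016)) := by
  refine (union_bd _ _ _ _ fun q hq => sep_prob hn (mem_pairsF.1 hq).1.1 (mem_pairsF.1 hq).1.2).trans ?_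
  rw [← pe_le n]
  exact mul_le_mul_of_nonneg_right (pairs_card hn) (Real.exp_pos _).le

lemma bad1_le {p n : ℕ} (hp : 4 ≤ p) (hpe : Even p) (hn : 0 < n) :
    (nu2 p n).real (bad1 p n) ≤ 200000^2 * (2 * Real.exp (-(n * 0.00016))) := by
  refine (union_bd _ _ _ (Real.exp (-(n * 1.27166))) fun k hk => ?_).trans ?_
  · obtain ⟨h1, h2⟩ := Finset.mem_filter.1 (Finset.mem_product.1 hk).2
    exact pair_prob hn hp hpe (mem_pairsF.1 h1).1.1 (mem_pairsF.1 h1).1.2 h2 _ _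
  · rw [Finset.card_product, Finset.card_product, ← pe_le n]
    have h1 : ((pairsG n).card : ℝ) ≤ (pairsF n).card := by
      exact_mod_cast Finset.card_le_card (Finset.filter_subset _ _)
    have h2 := mul_le_mul_of_nonneg_right (h1.trans (pairs_card hn)) (Real.exp_pos (-(n * 1.27166))).le
    push_cast
    rw [netF_card]
    linarith

lemma good_sub {p n : ℕ} (hn : 0 < n) (E : ℝ) (z : TT p n) (h0 : z ∉ bad0 p n) (h1 : z ∉ bad1 p n)
    (h2 : z ∉ bad2 p n) :
    HasOGP (pspinFamily p n z.1 z.2) (cubeSet n) (olap n) (E - (E - 1.1553)) 0.47 0.471 ∧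
      SeparatedAbove (Hpspin p n z.1) (Hpspin p n z.2) (cubeSet n) (olap n) (E - (E - 1.1553)) 0.47 := by
  have hn' : (0:ℝ) < n := by exact_mod_cast hn
  rw [sub_sub_cancel]
  simp only [bad0, bad1, bad2, Set.mem_iUnion, Set.mem_ofPred_eq, exists_prop, not_exists, not_and, not_or,
    not_le] at h0 h1 h2
  constructor
  · rintro f1 ⟨τ1, ht1, rfl⟩ f2 ⟨τ2, ht2, rfl⟩ x hx y hy hfx hfy
    rw [olap_eq]
    have hx' := mem_cubeF_iff.2 hx
    have hy' := mem_cubeF_iff.2 hy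
    by_contra hcon
    simp only [Set.mem_union, Set.mem_Icc, not_or, not_and, not_le] at hcon
    have c1 := hcon.1 (abs_nonneg _)
    have c2 : |ov n x y| ≤ 0.471 := by
      by_contra h
      exact absurd (hcon.2 (not_le.1 h).le) (not_lt.2 (ov_abs_le hx' hy'))
    obtain ⟨k1, hk1, hk1'⟩ := net_pt ht1
    obtain ⟨k2, hk2, hk2'⟩ := net_pt ht2
    have hm : (x, y) ∈ pairsG n := Finset.mem_filter.2 ⟨mem_pairsF.2 ⟨⟨hx', hy'⟩, c1⟩, c2⟩
    have hb := h1 ((k1, k2), (x, y)) (Finset.mem_product.2 ⟨Finset.mem_product.2 ⟨hk1, hk2⟩, hm⟩)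
    simp only at hb hfx hfy
    have e1 := net_err (h0 x hx').1.le (h0 x hx').2.le hk1' (by
      rw [pv_H hn, pv_H hn]; linarith [mul_le_mul_of_nonneg_left hfx hn'.le])
    have e2 := net_err (h0 y hy').1.le (h0 y hy').2.le hk2' (by
      rw [pv_H hn, pv_H hn]; linarith [mul_le_mul_of_nonneg_left hfy hn'.le])
    linarith
  · intro x hx y hy hfx hfy
    rw [olap_eq]
    have hx' := mem_cubeF_iff.2 hx
    have hy' := mem_cubeF_iff.2 hy
    by_contra hcon
    have hb := h2 (x, y) (mem_pairsF.2 ⟨⟨hx', hy'⟩, not_le.1 hcon⟩)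
    simp only [pv_H hn] at hb
    have a1 := mul_le_mul_of_nonneg_left hfx hn'.le
    have a2 := mul_le_mul_of_nonneg_left hfy hn'.le
    linarith

theorem stmt_10 (p : ℕ) (hp : 4 ≤ p) (hpeven : Even p) (E : ℝ)
    (hE : ∀ ε > (0 : ℝ),
      Filter.Tendsto (fun n => (tensorGaussian p n) {Y | ε ≤ |maxCube p n Y - E|})
        Filter.atTop (nhds 0)) :
    ∃ ε > (0 : ℝ), ∃ ν₁ ν₂ : ℝ, 0 ≤ ν₁ ∧ ν₁ < ν₂ ∧ ν₂ ≤ 1 ∧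
      ∃ c > (0 : ℝ), ∃ n₀ : ℕ, ∀ n ≥ n₀,
        ENNReal.ofReal (1 - Real.exp (-c * n)) ≤
          ((tensorGaussian p n).prod (tensorGaussian p n))
            {YY' | HasOGP (pspinFamily p n YY'.1 YY'.2) (cubeSet n) (olap n)
                     (E - ε) ν₁ ν₂ ∧
                   SeparatedAbove (Hpspin p n YY'.1) (Hpspin p n YY'.2)
                     (cubeSet n) (olap n) (E - ε) ν₁} := by
  have hE0 := E_lb hp hpeven E hE
  refine ⟨E - 1.1553, by linarith, 0.47, 0.471, by norm_num, by norm_num, by norm_num, 0.0001,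
    by norm_num, 10^17, fun n hnn => ?_⟩
  have hn : 0 < n := lt_of_lt_of_le (by norm_num) hnn
  have hn' : (0:ℝ) < n := by exact_mod_cast hn
  have hnb : (10:ℝ)^17 ≤ n := by exact_mod_cast hnn
  set G := {z : TT p n | HasOGP (pspinFamily p n z.1 z.2) (cubeSet n) (olap n) (E - (E - 1.1553)) 0.47 0.471 ∧
      SeparatedAbove (Hpspin p n z.1) (Hpspin p n z.2) (cubeSet n) (olap n) (E - (E - 1.1553)) 0.47}
  show _ ≤ (nu2 p n) G
  have hcov : (Set.univ : Set (TT p n)) ⊆ G ∪ (bad0 p n ∪ (bad1 p n ∪ bad2 p n)) := by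
    intro z _
    by_cases h0 : z ∈ bad0 p n
    · exact Or.inr (Or.inl h0)
    by_cases h1 : z ∈ bad1 p n
    · exact Or.inr (Or.inr (Or.inl h1))
    by_cases h2 : z ∈ bad2 p n
    · exact Or.inr (Or.inr (Or.inr h2))
    exact Or.inl (good_sub hn E z h0 h1 h2)
  have h1 : (1:ℝ) ≤ (nu2 p n).real G + ((nu2 p n).real (bad0 p n) + ((nu2 p n).real (bad1 p n) +
      (nu2 p n).real (bad2 p n))) := by
    calc (1:ℝ) = (nu2 p n).real Set.univ := by simp
      _ ≤ _ := measureReal_mono hcov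
      _ ≤ _ := measureReal_union_le _ _
      _ ≤ _ := add_le_add_right (measureReal_union_le _ _) _
      _ ≤ _ := add_le_add_right (add_le_add_right (measureReal_union_le _ _) _) _
  have b0 := bad0_le (p := p) hn
  have b1 := bad1_le hp hpeven hn
  have b2 := bad2_le (p := p) hn
  have hexp : (4 + 200000^2 * 2 + 2) * Real.exp (-(n * 0.00016)) ≤ Real.exp (-0.0001 * n) := by
    have e : Real.exp (-0.0001 * n) = Real.exp (n * 0.00006) * Real.exp (-(n * 0.00016)) := by
      rw [← Real.exp_add]; congr 1; ring
    rw [e]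
    refine mul_le_mul_of_nonneg_right ?_ (Real.exp_pos _).le
    have := Real.add_one_le_exp (n * 0.00006 : ℝ)
    refine le_trans ?_ this
    have h17 : (10:ℝ)^17 = 100000000000000000 := by norm_num
    rw [h17] at hnb
    norm_num
    linarith
  have h2 : 1 - Real.exp (-0.0001 * n) ≤ (nu2 p n).real G := by linarith
  calc ENNReal.ofReal (1 - Real.exp (-0.0001 * n)) ≤ ENNReal.ofReal ((nu2 p n).real G) :=
        ENNReal.ofReal_le_ofReal h2
    _ = (nu2 p n) G := by rw [Measure.real, ENNReal.ofReal_toReal (measure_ne_top _ _)]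
end

section
/- Let Y be a Bernoulli random vector in {0,1}^m with independent entries satisfying P(Y_i = 1) = p_i with 0 < p_i < 1, and let Y′ be an independent copy of Y. Fix c > 0 and a function f : {0,1}^m → ℝ^n, and for x ∈ {0,1}^m let q(x) be the probability over Y′ that the path x ↦ Y′ contains no c-bad edge for f. For each i ∈ [m] let B_i be the event that the hypercube edge obtained by flipping the i-th coordinate of Y is c-bad for f. Then −E[log q(Y)] ≤ Σ_{i=1}^m S(p_i) · P(B_i), where S(p) = −p log p − (1−p) log(1−p) is the binary entropy. -/
open MeasureTheory ProbabilityTheory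

/-- The Bernoulli measure on `ℝ` with mass `pr` at `1` and `1 - pr` at `0`. -/
noncomputable def bern (pr : ℝ) : Measure ℝ :=
  ENNReal.ofReal pr • Measure.dirac 1 + ENNReal.ofReal (1 - pr) • Measure.dirac 0

instance (pr : ℝ) : IsFiniteMeasure (bern pr) := by
  constructor
  simp only [bern, Measure.add_apply, Measure.smul_apply, smul_eq_mul, Measure.dirac_apply,
    MeasurableSet.univ, Measure.dirac_apply' _ MeasurableSet.univ]
  exact ENNReal.add_lt_top.2 ⟨ENNReal.mul_lt_top ENNReal.ofReal_lt_top (by simp),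
    ENNReal.mul_lt_top ENNReal.ofReal_lt_top (by simp)⟩

/-- The law of a Bernoulli random vector in `{0,1}^m` with independent entries,
`P(Y_i = 1) = p_i`. -/
noncomputable def bernoulliVec (m : ℕ) (p : Fin m → ℝ) : Measure (Fin m → ℝ) :=
  Measure.pi fun i => bern (p i)

/-- The `i`-th point `Z_i` on the path `x ↦ y` through the hypercube `{0,1}^m`:
the first `i` coordinates are those of `y`, the rest are those of `x`. -/
def pathVec (m : ℕ) (x y : Fin m → ℝ) (i : ℕ) : Fin m → ℝ :=
  fun j => if (j : ℕ) < i then y j else x j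

/-- The path `x ↦ y` contains no `c`-bad edge for `f`, where an edge `(u, v)` of the
hypercube is `c`-bad if `‖f(u) - f(v)‖₂² ≥ c E‖f(Y)‖₂²` (here `E` is the given
expectation value `Ef`). -/
def NoBadEdgePath (m n : ℕ) (f : (Fin m → ℝ) → Fin n → ℝ) (c Ef : ℝ)
    (x y : Fin m → ℝ) : Prop :=
  ∀ i : ℕ, i < m → pathVec m x y i ≠ pathVec m x y (i + 1) →
    ∑ j, (f (pathVec m x y i) j - f (pathVec m x y (i + 1)) j) ^ 2 < c * Ef

/-- Flip the `i`-th coordinate of a point of `{0,1}^m`. -/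
def flipCoord (m : ℕ) (i : Fin m) (y : Fin m → ℝ) : Fin m → ℝ :=
  Function.update y i (1 - y i)

/-- The binary entropy `S(p) = -p log p - (1-p) log (1-p)`. -/
noncomputable def binEnt (p : ℝ) : ℝ := -(p * Real.log p) - (1 - p) * Real.log (1 - p)

namespace S13

/-- Weight of a bit. -/
noncomputable def w (p : ℝ) (b : Bool) : ℝ := if b then p else 1 - p

/-- Weight of a bit vector. -/
noncomputable def W {m : ℕ} (p : Fin m → ℝ) (x : Fin m → Bool) : ℝ := ∏ i, w (p i) (x i)

def mix {m : ℕ} (x y : Fin m → Bool) (i : ℕ) : Fin m → Bool :=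
  fun j => if (j : ℕ) < i then y j else x j

def Good {m : ℕ} (bad : Fin m → (Fin m → Bool) → Prop) (x y : Fin m → Bool) : Prop :=
  ∀ i : Fin m, x i ≠ y i → ¬ bad i (mix x y i)

open Classical in
noncomputable def q {m : ℕ} (p : Fin m → ℝ) (bad : Fin m → (Fin m → Bool) → Prop)
    (x : Fin m → Bool) : ℝ := ∑ y, W p y * (if Good bad x y then 1 else 0)

lemma w_pos {p : ℝ} (h : 0 < p ∧ p < 1) (b : Bool) : 0 < w p b := by
  cases b <;> simp [w, h.1, h.2]

lemma W_pos {m : ℕ} {p : Fin m → ℝ} (h : ∀ i, 0 < p i ∧ p i < 1) (x : Fin m → Bool) :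
    0 < W p x := Finset.prod_pos fun i _ => w_pos (h i) _

lemma q_pos {m : ℕ} {p : Fin m → ℝ} (h : ∀ i, 0 < p i ∧ p i < 1)
    (bad : Fin m → (Fin m → Bool) → Prop) (x : Fin m → Bool) : 0 < q p bad x := by
  classical
  unfold q
  refine Finset.sum_pos' (fun y _ => ?_) ⟨x, Finset.mem_univ _, ?_⟩
  · have := W_pos h y
    split_ifs <;> simp [this.le]
  · have : Good bad x x := fun i hi => absurd rfl hi
    simp [this, W_pos h x]

lemma sum_cons {m : ℕ} (F : (Fin (m+1) → Bool) → ℝ) :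
    ∑ x, F x = ∑ b : Bool, ∑ x : Fin m → Bool, F (Fin.cons b x) := by
  rw [← Fintype.sum_prod_type']
  exact (Fintype.sum_equiv (Fin.consEquiv (fun _ : Fin (m+1) => Bool)) _ _ (fun _ => rfl)).symm

lemma W_cons {m : ℕ} (p : Fin (m+1) → ℝ) (b : Bool) (x : Fin m → Bool) :
    W p (Fin.cons b x) = w (p 0) b * W (fun i => p i.succ) x := by
  simp [W, Fin.prod_univ_succ]

lemma mix_zero {m : ℕ} (x y : Fin m → Bool) : mix x y 0 = x := by
  funext j; simp [mix]

lemma mix_cons {m : ℕ} (a b : Bool) (x y : Fin m → Bool) (i : ℕ) :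
    mix (Fin.cons a x : Fin (m+1) → Bool) (Fin.cons b y) (i+1) = Fin.cons b (mix x y i) := by
  funext j
  refine Fin.cases ?_ (fun j => ?_) j <;> simp [mix]

lemma good_cons {m : ℕ} (bad : Fin (m+1) → (Fin (m+1) → Bool) → Prop) (a b : Bool)
    (x y : Fin m → Bool) :
    Good bad (Fin.cons a x) (Fin.cons b y) ↔
      ((a ≠ b → ¬ bad 0 (Fin.cons a x)) ∧
        Good (fun i z => bad i.succ (Fin.cons b z)) x y) := by
  unfold Good
  rw [Fin.forall_fin_succ]
  simp [mix_zero, mix_cons]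

open Classical in
lemma q_cons {m : ℕ} (p : Fin (m+1) → ℝ) (bad : Fin (m+1) → (Fin (m+1) → Bool) → Prop)
    (a : Bool) (x : Fin m → Bool) :
    q p bad (Fin.cons a x) = ∑ b, w (p 0) b * (if a ≠ b → ¬ bad 0 (Fin.cons a x) then
      q (fun i => p i.succ) (fun i z => bad i.succ (Fin.cons b z)) x else 0) := by
  rw [q, sum_cons]
  refine Finset.sum_congr rfl fun b _ => ?_
  simp only [W_cons, good_cons]
  by_cases h : a ≠ b → ¬ bad 0 (Fin.cons a x)
  · simp only [q, if_pos h, Finset.mul_sum, mul_assoc]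
    refine Finset.sum_congr rfl fun y _ => ?_
    simp only [and_iff_right h]
  · simp [h]

lemma sum_W {m : ℕ} (p : Fin m → ℝ) : ∑ x, W p x = 1 := by
  induction m with
  | zero => simp [W]
  | succ m ih =>
    rw [sum_cons]
    simp only [W_cons, ← Finset.mul_sum, ih]
    simp [w]

open Classical in
lemma step (p A1 A0 : ℝ) (hp : 0 < p ∧ p < 1) (h1 : 0 < A1) (h0 : 0 < A0) (bad : Prop) :
    p * (-Real.log (p * A1 + (1-p) * (if bad then 0 else A0))) +
      (1-p) * (-Real.log (p * (if bad then 0 else A1) + (1-p) * A0)) ≤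
    binEnt p * (if bad then 1 else 0) + (p * (-Real.log A1) + (1-p) * (-Real.log A0)) := by
  have hp1 : 0 < 1 - p := by linarith [hp.2]
  by_cases h : bad
  · simp only [h, if_true, mul_zero, add_zero, zero_add]
    rw [Real.log_mul hp.1.ne' h1.ne', Real.log_mul hp1.ne' h0.ne']
    unfold binEnt
    apply le_of_eq; ring
  · simp only [h, if_false, mul_zero, zero_add]
    have := strictConcaveOn_log_Ioi.concaveOn.2 (Set.mem_Ioi.2 h1) (Set.mem_Ioi.2 h0)
      hp.1.le hp1.le (by ring)
    simp only [smul_eq_mul] at this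
    nlinarith

open Classical in
theorem main {m : ℕ} (p : Fin m → ℝ) (hp : ∀ i, 0 < p i ∧ p i < 1)
    (bad : Fin m → (Fin m → Bool) → Prop)
    (hbad : ∀ i x b, bad i (Function.update x i b) ↔ bad i x) :
    ∑ x, W p x * (-Real.log (q p bad x)) ≤
      ∑ i, binEnt (p i) * ∑ x, W p x * (if bad i x then 1 else 0) := by
  induction m with
  | zero =>
    have : ∀ x, q p bad x = 1 := by
      intro x
      have : ∀ y, Good bad x y := fun y i => i.elim0
      simp [q, this, W]
    simp [this]
  | succ m ih =>
    set p' : Fin m → ℝ := fun i => p i.succ with hp'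
    let bd : Bool → Fin m → (Fin m → Bool) → Prop := fun b i z => bad i.succ (Fin.cons b z)
    have IH : ∀ b, _ := fun b => ih p' (fun i => hp _) (bd b) (by
      intro i x b'
      simp only [bd, Fin.cons_update]
      exact hbad _ _ _)
    have hb0 : ∀ x : Fin m → Bool, ∀ b : Bool,
        bad 0 (Fin.cons b x) ↔ bad 0 (Fin.cons true x) := by
      intro x b
      have := hbad 0 (Fin.cons true x) b
      rwa [Fin.update_cons_zero] at this
    have hS : ∀ x : Fin m → Bool,
        w (p 0) true * (-Real.log (q p bad (Fin.cons true x))) +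
        w (p 0) false * (-Real.log (q p bad (Fin.cons false x))) ≤
        binEnt (p 0) * (if bad 0 (Fin.cons true x) then 1 else 0) +
          (w (p 0) true * (-Real.log (q p' (bd true) x)) +
           w (p 0) false * (-Real.log (q p' (bd false) x))) := by
      intro x
      have := step (p 0) (q p' (bd true) x) (q p' (bd false) x) (hp 0)
        (q_pos (fun i => hp _) _ _) (q_pos (fun i => hp _) _ _) (bad 0 (Fin.cons true x))
      rw [q_cons, q_cons]
      simp only [Fintype.sum_bool, hb0 x false]
      simp only [bd, hp'] at this ⊢
      by_cases h : bad 0 (Fin.cons true x) <;> simpa [w, h] using this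
    have hW : ∀ x, 0 ≤ W p' x := fun x => (W_pos (fun i => hp _) x).le
    have h1 := Finset.sum_le_sum fun x (_ : x ∈ Finset.univ) =>
      mul_le_mul_of_nonneg_left (hS x) (hW x)
    have Wc : ∀ b x, W p (Fin.cons b x) = w (p 0) b * W p' x := W_cons p
    rw [sum_cons, Fin.sum_univ_succ]
    simp only [sum_cons, Fintype.sum_bool, Wc, hb0 _ false]
    have w1 := w_pos (hp 0) true
    have w0 := w_pos (hp 0) false
    have h2 := mul_le_mul_of_nonneg_left (IH true) w1.le
    have h3 := mul_le_mul_of_nonneg_left (IH false) w0.le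
    have hw : w (p 0) true + w (p 0) false = 1 := by simp [w]
    simp only [mul_add, Finset.sum_add_distrib] at h1
    have e0 : ∀ (b : Bool) (F : (Fin m → Bool) → ℝ),
        ∑ x, w (p 0) b * W p' x * F x = w (p 0) b * ∑ x, W p' x * F x := by
      intro b F; simp only [Finset.mul_sum, mul_assoc]
    have e1 : ∀ (b : ℝ) (F : (Fin m → Bool) → ℝ),
        ∑ x, W p' x * (b * F x) = b * ∑ x, W p' x * F x := by
      intro b F; rw [Finset.mul_sum]; exact Finset.sum_congr rfl fun _ _ => by ring
    simp only [e1] at h1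
    simp only [e0]
    have e2 : ∑ i : Fin m, binEnt (p i.succ) *
        (w (p 0) true * ∑ x, W p' x * (if bad i.succ (Fin.cons true x) then 1 else 0) +
        w (p 0) false * ∑ x, W p' x * (if bad i.succ (Fin.cons false x) then 1 else 0)) =
        w (p 0) true * (∑ i, binEnt (p' i) * ∑ x, W p' x * (if bd true i x then 1 else 0)) +
        w (p 0) false * (∑ i, binEnt (p' i) * ∑ x, W p' x * (if bd false i x then 1 else 0)) := by
      rw [Finset.mul_sum, Finset.mul_sum, ← Finset.sum_add_distrib]
      exact Finset.sum_congr rfl fun _ _ => by simp only [bd, hp']; ring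
    rw [e2, ← add_mul, hw, one_mul]
    linarith

/-- Embedding of bit vectors. -/
def R {m : ℕ} (x : Fin m → Bool) : Fin m → ℝ := fun i => if x i then 1 else 0

lemma bern_eq (p : ℝ) : bern p =
    ∑ b : Bool, ENNReal.ofReal (w p b) • Measure.dirac (if b then (1:ℝ) else 0) := by
  simp [bern, w]

lemma vec_eq {m : ℕ} (p : Fin m → ℝ) (hp : ∀ i, 0 < p i ∧ p i < 1) :
    bernoulliVec m p = ∑ x : Fin m → Bool, ENNReal.ofReal (W p x) • Measure.dirac (R x) := by
  classical
  unfold bernoulliVec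
  refine Measure.pi_eq fun s hs => ?_
  simp only [bern_eq, Measure.finsetSum_apply, Measure.smul_apply, smul_eq_mul,
    Measure.dirac_apply]
  rw [Finset.prod_univ_sum, Fintype.piFinset_univ]
  refine Finset.sum_congr rfl fun x _ => ?_
  rw [Finset.prod_mul_distrib, W, ENNReal.ofReal_prod_of_nonneg (fun i _ => (w_pos (hp i) _).le)]
  congr 1
  simp only [Set.indicator_apply, Pi.one_apply, Set.mem_univ_pi, R]
  rw [Finset.prod_ite_zero]
  simp

lemma integral_vec {m : ℕ} (p : Fin m → ℝ) (hp : ∀ i, 0 < p i ∧ p i < 1)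
    (F : (Fin m → ℝ) → ℝ) :
    ∫ y, F y ∂(bernoulliVec m p) = ∑ x, W p x * F (R x) := by
  rw [vec_eq p hp, integral_finsetSum_measure]
  · refine Finset.sum_congr rfl fun x _ => ?_
    rw [integral_smul_measure, integral_dirac, ENNReal.toReal_ofReal (W_pos hp x).le, smul_eq_mul]
  · intro x _
    exact (integrable_dirac (by simp)).smul_measure ENNReal.ofReal_ne_top

open Classical in
lemma meas_vec {m : ℕ} (p : Fin m → ℝ) (hp : ∀ i, 0 < p i ∧ p i < 1)
    (P : (Fin m → ℝ) → Prop) :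
    ((bernoulliVec m p) {y | P y}).toReal = ∑ x, W p x * (if P (R x) then 1 else 0) := by
  rw [vec_eq p hp, Measure.finsetSum_apply, ENNReal.toReal_sum]
  · refine Finset.sum_congr rfl fun x _ => ?_
    rw [Measure.smul_apply, smul_eq_mul, ENNReal.toReal_mul, Measure.dirac_apply,
      ENNReal.toReal_ofReal (W_pos hp x).le]
    by_cases h : P (R x) <;> simp [Set.indicator_apply, h]
  · intro x _
    rw [Measure.smul_apply, smul_eq_mul]
    exact ENNReal.mul_ne_top ENNReal.ofReal_ne_top (measure_ne_top _ _)

lemma flip_R {m : ℕ} (i : Fin m) (x : Fin m → Bool) :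
    flipCoord m i (R x) = R (Function.update x i (!x i)) := by
  funext j
  by_cases h : j = i
  · subst h; cases hx : x j <;> simp [flipCoord, R, hx]
  · simp [flipCoord, R, h]

lemma path_R {m : ℕ} (x y : Fin m → Bool) (i : ℕ) :
    pathVec m (R x) (R y) i = R (mix x y i) := by
  funext j
  simp only [pathVec, R, mix]
  split_ifs <;> rfl

lemma R_inj {m : ℕ} {x y : Fin m → Bool} : R x = R y ↔ x = y := by
  refine ⟨fun h => ?_, fun h => by rw [h]⟩
  funext j
  have := congrFun h j
  cases hx : x j <;> cases hy : y j <;> simp_all [R]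

lemma mix_succ {m : ℕ} (x y : Fin m → Bool) (i : Fin m) :
    mix x y (i+1) = Function.update (mix x y i) i (y i) := by
  funext j
  by_cases h : j = i
  · subst h; simp [mix]
  · have : (j : ℕ) ≠ i := fun h' => h (Fin.ext h')
    have : (j : ℕ) < i + 1 ↔ (j : ℕ) < i := by omega
    simp [mix, h, this]

lemma mix_self {m : ℕ} (x y : Fin m → Bool) (i : Fin m) : mix x y i i = x i := by
  simp [mix]

end S13

/-- Let `Y` be a Bernoulli vector in `{0,1}^m` with independent entries,
`P(Y_i = 1) = p_i ∈ (0,1)`, and `Y'` an independent copy.  Fix `c > 0` and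
`f : {0,1}^m → ℝ^n`; for `x ∈ {0,1}^m` let `q(x)` be the probability over `Y'` that the path
`x ↦ Y'` has no `c`-bad edge for `f`, and let `B_i` be the event that the edge obtained by
flipping the `i`-th coordinate of `Y` is `c`-bad.  Then
`-E[log q(Y)] ≤ Σ_i S(p_i) P(B_i)` with `S` the binary entropy. -/
theorem stmt_13 (m n : ℕ) (p : Fin m → ℝ) (hp : ∀ i, 0 < p i ∧ p i < 1)
    (c : ℝ) (hc : 0 < c)
    (f : (Fin m → ℝ) → Fin n → ℝ) :
    (∫ y, -Real.log
        (((bernoulliVec m p)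
          {y' | NoBadEdgePath m n f c
              (∫ z, ∑ j, (f z j) ^ 2 ∂(bernoulliVec m p)) y y'}).toReal)
        ∂(bernoulliVec m p)) ≤
      ∑ i : Fin m, binEnt (p i) *
        ((bernoulliVec m p)
          {y | c * (∫ y', ∑ j, (f y' j) ^ 2 ∂(bernoulliVec m p)) ≤
               ∑ j, (f y j - f (flipCoord m i y) j) ^ 2}).toReal := by
  classical
  set Ef := ∫ z, ∑ j, (f z j) ^ 2 ∂(bernoulliVec m p) with hEf
  clear_value Ef
  let bad : Fin m → (Fin m → Bool) → Prop := fun i x =>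
    c * Ef ≤ ∑ j, (f (S13.R x) j - f (flipCoord m i (S13.R x)) j) ^ 2
  have hbad : ∀ i x b, bad i (Function.update x i b) ↔ bad i x := by
    intro i x b
    by_cases h : b = x i
    · rw [h, Function.update_eq_self]
    · have hb : b = !x i := by cases b <;> cases hx : x i <;> simp_all
      subst hb
      simp only [bad, S13.flip_R]
      simp only [Function.update_self, Bool.not_not, Function.update_idem,
        Function.update_eq_self]
      rw [Finset.sum_congr rfl fun j _ => sub_sq_comm _ _]
  have hgood : ∀ x y, NoBadEdgePath m n f c Ef (S13.R x) (S13.R y) ↔ S13.Good bad x y := by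
    intro x y
    unfold NoBadEdgePath S13.Good
    simp only [S13.path_R, ne_eq, S13.R_inj]
    rw [Fin.forall_iff]
    refine forall_congr' fun i => forall_congr' fun hi => ?_
    have h1 := S13.mix_succ x y ⟨i, hi⟩
    have h2 := S13.mix_self x y ⟨i, hi⟩
    simp only at h1 h2
    by_cases h : x ⟨i, hi⟩ = y ⟨i, hi⟩
    · rw [h1, ← h, ← h2, Function.update_eq_self]
      simp
    · have hb : y ⟨i, hi⟩ = !(S13.mix x y i ⟨i, hi⟩) := by
        rw [h2]; cases hx : x ⟨i, hi⟩ <;> cases hy : y ⟨i, hi⟩ <;> simp_all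
      have hne : ¬ S13.mix x y i = S13.mix x y (i+1) := by
        intro h'
        have := congrFun h' ⟨i, hi⟩
        rw [h1, h2, Function.update_self] at this
        exact h this
      simp only [hne, h, not_false_eq_true, forall_const, bad, not_le, S13.flip_R]
      rw [h1, hb]
  rw [S13.integral_vec p hp]
  simp only [S13.meas_vec p hp, hgood]
  have := S13.main p hp bad hbad
  unfold S13.q at this
  convert this
end
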